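/- The Hochschild homology H_*(E,M) of E with coefficients in M is the homology of the chain complex X̂_*(E,M) with X̂_n = ⊕_{r+s=n} M⊗H̄^s⊗Ā^r and differential d̂_n = Σ_{r+s=n, r+l>0} Σ_{l=0}^{s} d̂^l_{rs}. Indeed, the maps θ̂_{rs} : M⊗H̄^s⊗Ā^r → M⊗_{E^e} X_{rs} defined by θ̂_{rs}(m⊗𝐡⊗𝐚) = m ⊗ (1_E⊗𝐡⊗𝐚⊗1_E) assemble into an isomorphism of chain complexes X̂_*(E,M) ≅ M⊗_{E^e}(X_*, d_*), where (X_*, d_*) is the relative projective resolution of Theorem 1.1.1. -/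

import Mathlib

open TensorProduct DirectSum

set_option maxHeartbeats 1000000
set_option maxSynthPendingDepth 3
set_option synthInstance.maxHeartbeats 400000

noncomputable section

namespace HopfCrossed

variable (k : Type) [CommRing k]

def TpowCat (V : ModuleCat k) : ℕ → ModuleCat k
  | 0 => ModuleCat.of k k
  | n + 1 => ModuleCat.of k (V ⊗[k] (TpowCat V n))

abbrev Tpow (V : Type) [AddCommGroup V] [Module k V] (n : ℕ) : Type :=
  TpowCat k (ModuleCat.of k V) n

def tp {V : Type} [AddCommGroup V] [Module k V] : ∀ {n : ℕ}, (Fin n → V) → Tpow k V n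
  | 0, _ => (1 : k)
  | _ + 1, v => (v 0) ⊗ₜ[k] (tp fun i => v i.succ)

section Coalg
variable {H : Type} [AddCommGroup H] [Module k H]

def itComul [Coalgebra k H] : ∀ n : ℕ, H →ₗ[k] Tpow k H (n + 1)
  | 0 => (TensorProduct.rid k H).symm.toLinearMap
  | n + 1 =>
      (TensorProduct.map LinearMap.id (itComul n)) ∘ₗ (Coalgebra.comul (R := k))

def SRep [Coalgebra k H] (n : ℕ) (h : H) (N : ℕ) (u : Fin N → Fin (n + 1) → H) : Prop :=
  itComul k n h = ∑ i, tp k (u i)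

def iterAct {A : Type} [AddCommGroup A] [Module k A]
    (act : H →ₗ[k] A →ₗ[k] A) : ∀ {s : ℕ}, (Fin s → H) → A → A
  | 0, _, a => a
  | _ + 1, h, a => act (h 0) (iterAct act (fun i => h i.succ) a)

end Coalg

/-- A weak action of a Hopf algebra `H` on a `k`-algebra `A` (Blattner–Cohen–Montgomery,
Doi–Takeuchi), written `act h a = a^h`. -/
structure WeakAction (k A H : Type) [CommRing k] [Ring A] [Algebra k A] [Ring H] [HopfAlgebra k H] : Type where
  act : H →ₗ[k] A →ₗ[k] A
  act_mul : ∀ (h : H) (a b : A) (N : ℕ) (u : Fin N → Fin 2 → H), SRep k 1 h N u →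
    act h (a * b) = ∑ i, act (u i 0) a * act (u i 1) b
  act_one : ∀ h : H, act h 1 = Coalgebra.counit (R := k) h • (1 : A)
  one_act : ∀ a : A, act 1 a = a

variable {A H : Type} [Ring A] [Algebra k A] [Ring H] [HopfAlgebra k H]
variable {k}

/-- Normality of the cocycle `f`. -/
def IsNormal (f : H →ₗ[k] H →ₗ[k] A) : Prop :=
  ∀ h : H, f h 1 = Coalgebra.counit (R := k) h • (1 : A) ∧
    f 1 h = Coalgebra.counit (R := k) h • (1 : A)

/-- The cocycle condition
`f(l⁽¹⁾,m⁽¹⁾)^{h⁽¹⁾} f(h⁽²⁾, l⁽²⁾m⁽²⁾) = f(h⁽¹⁾,l⁽¹⁾) f(h⁽²⁾l⁽²⁾, m)`. -/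
def IsCocycle (W : WeakAction k A H) (f : H →ₗ[k] H →ₗ[k] A) : Prop :=
  ∀ (h l m : H) (N₁ N₂ N₃ : ℕ) (u : Fin N₁ → Fin 2 → H) (v : Fin N₂ → Fin 2 → H)
    (w : Fin N₃ → Fin 2 → H),
    SRep k 1 h N₁ u → SRep k 1 l N₂ v → SRep k 1 m N₃ w →
    (∑ i, ∑ j, ∑ p, W.act (u i 0) (f (v j 0) (w p 0)) * f (u i 1) (v j 1 * w p 1)) =
      ∑ i, ∑ j, f (u i 0) (v j 0) * f (u i 1 * v j 1) m

/-- The twisted module condition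
`(a^{l⁽¹⁾})^{h⁽¹⁾} f(h⁽²⁾,l⁽²⁾) = f(h⁽¹⁾,l⁽¹⁾) a^{h⁽²⁾l⁽²⁾}`. -/
def IsTwistedModule (W : WeakAction k A H) (f : H →ₗ[k] H →ₗ[k] A) : Prop :=
  ∀ (h l : H) (a : A) (N₁ N₂ : ℕ) (u : Fin N₁ → Fin 2 → H) (v : Fin N₂ → Fin 2 → H),
    SRep k 1 h N₁ u → SRep k 1 l N₂ v →
    (∑ i, ∑ j, W.act (u i 0) (W.act (v j 0) a) * f (u i 1) (v j 1)) =
      ∑ i, ∑ j, f (u i 0) (v j 0) * W.act (u i 1 * v j 1) a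

variable (k A H) in
/-- A crossed product `E = A #_f H` of `A` by `H`:  a ring `E` identified with `A ⊗ H`
as a `k`-module, whose multiplication is given by the crossed product formula
`(a # h)(b # l) = a b^{h⁽¹⁾} f(h⁽²⁾,l⁽¹⁾) # h⁽³⁾ l⁽²⁾`. -/
structure CrossedProduct (E : Type) [Ring E] [Algebra k E] extends WeakAction k A H where
  f : H →ₗ[k] H →ₗ[k] A
  ι : (A ⊗[k] H) ≃ₗ[k] E
  ι_one : ι (1 ⊗ₜ[k] 1) = 1
  ι_mul : ∀ (a b : A) (h l : H) (N M : ℕ) (u : Fin N → Fin 3 → H) (v : Fin M → Fin 2 → H),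
    SRep k 2 h N u → SRep k 1 l M v →
    ι (a ⊗ₜ[k] h) * ι (b ⊗ₜ[k] l) =
      ∑ i, ∑ j, ι ((a * act (u i 0) b * f (u i 1) (v j 0)) ⊗ₜ[k] (u i 2 * v j 1))
  f_normal : IsNormal f
  f_cocycle : IsCocycle toWeakAction f
  f_twisted : IsTwistedModule toWeakAction f

namespace CrossedProduct

variable {E : Type} [Ring E] [Algebra k E] (S : CrossedProduct k A H E)

/-- The canonical map `A → E`, `a ↦ a # 1`. -/
def aE : A →ₗ[k] E := S.ι.toLinearMap ∘ₗ (TensorProduct.mk k A H).flip 1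

/-- The canonical map `H → E`, `h ↦ 1 # h`. -/
def hE : H →ₗ[k] E := S.ι.toLinearMap ∘ₗ (TensorProduct.mk k A H) 1

end CrossedProduct


section Hochschild

variable (k) in
/-- For a `k`-algebra `B`, the submodule `k·1 ⊆ B`. -/
abbrev unitSub (B : Type) [Ring B] [Algebra k B] : Submodule k B :=
  LinearMap.range (Algebra.linearMap k B)

variable (k) in
/-- `B̄ = B/k`. -/
abbrev Qbar (B : Type) [Ring B] [Algebra k B] : Type := B ⧸ unitSub k B

variable (k) in
/-- The canonical projection `B → B̄`. -/
abbrev qbar (B : Type) [Ring B] [Algebra k B] : B →ₗ[k] Qbar k B :=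
  (unitSub k B).mkQ

/-- A `B`-bimodule structure (with commuting `k`-linear left and right actions)
on a `k`-module `M`. -/
structure Bimod (k B M : Type) [CommRing k] [Ring B] [Algebra k B]
    [AddCommGroup M] [Module k M] : Type where
  l : B →ₗ[k] M →ₗ[k] M
  r : B →ₗ[k] M →ₗ[k] M
  l_one : l 1 = LinearMap.id
  r_one : r 1 = LinearMap.id
  l_mul : ∀ x y : B, l (x * y) = l x ∘ₗ l y
  r_mul : ∀ x y : B, r (x * y) = r y ∘ₗ r x
  lr_comm : ∀ x y : B, l x ∘ₗ r y = r y ∘ₗ l x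

/-- Replace the `r`-tuple `a` by the `(r-1)`-tuple obtained by multiplying the
`i`-th and `(i+1)`-st entries. -/
def mulAt {A : Type} [Mul A] {r : ℕ} (a : Fin (r + 1) → A) (i : Fin r) (j : Fin r) : A :=
  if (j : ℕ) < (i : ℕ) then a j.castSucc
  else if (j : ℕ) = (i : ℕ) then a j.castSucc * a j.succ else a j.succ

variable (k) in
/-- The degree-`n` part `M ⊗ B̄^{⊗n}` of the normalized Hochschild chain complex. -/
abbrev HCh (B M : Type) [Ring B] [Algebra k B] [AddCommGroup M] [Module k M]
    (n : ℕ) : Type :=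
  M ⊗[k] Tpow k (Qbar k B) n

variable (k) in
/-- `IsHochschildD l r bd` says that `bd` is the differential of the normalized
Hochschild chain complex of `B` with coefficients in the bimodule `M` (with left
action `l` and right action `r`):
`b(m ⊗ x₁ ⊗ ⋯ ⊗ xₙ) = m x₁ ⊗ x₂ ⊗ ⋯ + ∑ (-1)^i m ⊗ ⋯ ⊗ xᵢxᵢ₊₁ ⊗ ⋯ + (-1)^n xₙ m ⊗ x₁ ⊗ ⋯ ⊗ xₙ₋₁`. -/
def IsHochschildD {B M : Type} [Ring B] [Algebra k B] [AddCommGroup M] [Module k M]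
    (l r : B →ₗ[k] M →ₗ[k] M)
    (bd : ∀ n : ℕ, HCh k B M (n + 1) →ₗ[k] HCh k B M n) : Prop :=
  ∀ (n : ℕ) (m : M) (x : Fin (n + 1) → B),
    bd n (m ⊗ₜ[k] tp k (fun i => qbar k B (x i))) =
      r (x 0) m ⊗ₜ[k] tp k (fun i : Fin n => qbar k B (x i.succ))
      + (∑ i : Fin n, ((-1 : ℤ) ^ ((i : ℕ) + 1)) •
          (m ⊗ₜ[k] tp k (fun j => qbar k B (mulAt x i j))))
      + ((-1 : ℤ) ^ (n + 1)) •
          (l (x (Fin.last n)) m ⊗ₜ[k] tp k (fun i : Fin n => qbar k B (x i.castSucc)))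

variable (k) in
/-- The homology of a (not necessarily everywhere-defined) chain complex
`⋯ → C (n+1) → C n → ⋯ → C 0`; in degree `n+1` it is `ker (d n) / im (d (n+1))`, and in
degree `0` it is `C 0 / im (d 0)`. -/
def Hml {C : ℕ → Type} [∀ n, AddCommGroup (C n)] [∀ n, Module k (C n)]
    (d : ∀ n : ℕ, C (n + 1) →ₗ[k] C n) : ℕ → Type
  | 0 => C 0 ⧸ LinearMap.range (d 0)
  | n + 1 => LinearMap.ker (d n) ⧸
      (LinearMap.range (d (n + 1))).comap (LinearMap.ker (d n)).subtype

instance {C : ℕ → Type} [∀ n, AddCommGroup (C n)] [∀ n, Module k (C n)]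
    (d : ∀ n : ℕ, C (n + 1) →ₗ[k] C n) : ∀ n, AddCommGroup (Hml k d n)
  | 0 => inferInstanceAs (AddCommGroup (C 0 ⧸ LinearMap.range (d 0)))
  | n + 1 => inferInstanceAs (AddCommGroup (LinearMap.ker (d n) ⧸
      (LinearMap.range (d (n + 1))).comap (LinearMap.ker (d n)).subtype))

instance {C : ℕ → Type} [∀ n, AddCommGroup (C n)] [∀ n, Module k (C n)]
    (d : ∀ n : ℕ, C (n + 1) →ₗ[k] C n) : ∀ n, Module k (Hml k d n)
  | 0 => inferInstanceAs (Module k (C 0 ⧸ LinearMap.range (d 0)))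
  | n + 1 => inferInstanceAs (Module k (LinearMap.ker (d n) ⧸
      (LinearMap.range (d (n + 1))).comap (LinearMap.ker (d n)).subtype))

end Hochschild

section Conv

variable {A H : Type} [Ring A] [Algebra k A] [Ring H] [HopfAlgebra k H]

/-- `IsConvInverse f g` : `g` is the convolution inverse of `f` in the convolution
algebra `Hom_k(H ⊗ H, A)`, i.e. `f * g = g * f = ε ⊗ ε · 1_A`. -/
def IsConvInverse (f g : H →ₗ[k] H →ₗ[k] A) : Prop :=
  ∀ (h l : H) (N M' : ℕ) (u : Fin N → Fin 2 → H) (v : Fin M' → Fin 2 → H),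
    SRep k 1 h N u → SRep k 1 l M' v →
    (∑ i, ∑ j, f (u i 0) (v j 0) * g (u i 1) (v j 1)) =
        (Coalgebra.counit (R := k) h * Coalgebra.counit (R := k) l) • (1 : A) ∧
    (∑ i, ∑ j, g (u i 0) (v j 0) * f (u i 1) (v j 1)) =
        (Coalgebra.counit (R := k) h * Coalgebra.counit (R := k) l) • (1 : A)

variable {E : Type} [Ring E] [Algebra k E]

/-- The elementary term `f⁻¹(S(y), z) # S(x)` appearing in the formula for the
convolution inverse `(1 # h)⁻¹ = f⁻¹(S(h⁽²⁾), h⁽³⁾) # S(h⁽¹⁾)`. -/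
def ginv (S : CrossedProduct k A H E) (finv : H →ₗ[k] H →ₗ[k] A) (x y z : H) : E :=
  S.ι ((finv (HopfAlgebra.antipode (R := k) y) z) ⊗ₜ[k] HopfAlgebra.antipode (R := k) x)

end Conv

section Bar

variable {H : Type} [Ring H] [HopfAlgebra k H]

variable (k) in
/-- The degree-`s` part `H̄^{⊗s} ⊗ N` of the normalized bar complex computing
`H_*(H, N) = Tor_*^H(k, N)`, i.e. `(H̄^* ⊗ H, d_*) ⊗_H N`. -/
abbrev BarCh (N : Type) [AddCommGroup N] [Module k N] (s : ℕ) : Type :=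
  Tpow k (Qbar k H) s ⊗[k] N

variable (k) in
/-- `IsBarD act d` : `d` is the differential of the normalized bar complex computing the
homology `H_*(H, N)` of `H` with coefficients in the left `H`-module `N` (action `act`). -/
def IsBarD {N : Type} [AddCommGroup N] [Module k N] (act : H →ₗ[k] N →ₗ[k] N)
    (d : ∀ s : ℕ, BarCh k (H := H) N (s + 1) →ₗ[k] BarCh k (H := H) N s) : Prop :=
  ∀ (s : ℕ) (h : Fin (s + 1) → H) (n : N),
    d s (tp k (fun i => qbar k H (h i)) ⊗ₜ[k] n) =
      Coalgebra.counit (R := k) (h 0) •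
          (tp k (fun i : Fin s => qbar k H (h i.succ)) ⊗ₜ[k] n)
      + (∑ i : Fin s, ((-1 : ℤ) ^ ((i : ℕ) + 1)) •
          (tp k (fun j => qbar k H (mulAt h i j)) ⊗ₜ[k] n))
      + ((-1 : ℤ) ^ (s + 1)) •
          (tp k (fun i : Fin s => qbar k H (h i.castSucc)) ⊗ₜ[k] act (h (Fin.last s)) n)

end Bar

section Sep

variable {A : Type} [Ring A] [Algebra k A]

variable (k A) in
/-- `A` is a separable `k`-algebra: the multiplication map `A ⊗ A → A` admits an
`A`-bimodule splitting (equivalently, `A` is projective as an `A ⊗ Aᵒᵖ`-module). -/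
def IsSeparableAlg : Prop :=
  ∃ s : A →ₗ[k] A ⊗[k] A,
    (LinearMap.mul' k A) ∘ₗ s = LinearMap.id ∧
    ∀ (a b x : A), s (a * x * b) =
      TensorProduct.map (LinearMap.mulLeft k a) (LinearMap.mulRight k b) (s x)

end Sep


section Resolution

variable (k A H E : Type) [CommRing k] [Ring A] [Algebra k A] [Ring H] [HopfAlgebra k H]
  [Ring E] [Algebra k E]

/-- The `E`-bimodule `X_{rs} = E ⊗ H̄^{⊗s} ⊗ Ā^{⊗r} ⊗ E`. -/
abbrev Xc (r s : ℕ) : Type :=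
  E ⊗[k] (Tpow k (Qbar k H) s ⊗[k] (Tpow k (Qbar k A) r ⊗[k] E))

/-- The `E`-bimodule `Y_s = E ⊗ H̄^{⊗s} ⊗ H`. -/
abbrev Yc (s : ℕ) : Type := E ⊗[k] (Tpow k (Qbar k H) s ⊗[k] H)

variable {k A H E}

/-- The generator `e ⊗ h̄₁ ⊗ ⋯ ⊗ h̄ₛ ⊗ ā₁ ⊗ ⋯ ⊗ āᵣ ⊗ e'` of `X_{rs}`. -/
def xgen (e : E) {s r : ℕ} (hs : Fin s → H) (as : Fin r → A) (e' : E) : Xc k A H E r s :=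
  e ⊗ₜ[k] (tp k (fun i => qbar k H (hs i)) ⊗ₜ[k] (tp k (fun i => qbar k A (as i)) ⊗ₜ[k] e'))

/-- The generator `e ⊗ h̄₁ ⊗ ⋯ ⊗ h̄ₛ ⊗ h` of `Y_s`. -/
def ygen (e : E) {s : ℕ} (hs : Fin s → H) (h : H) : Yc k H E s :=
  e ⊗ₜ[k] (tp k (fun i => qbar k H (hs i)) ⊗ₜ[k] h)

/-- Left multiplication by `e ∈ E` on `X_{rs}`. -/
def lX (e : E) {r s : ℕ} : Xc k A H E r s →ₗ[k] Xc k A H E r s :=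
  TensorProduct.map (LinearMap.mulLeft k e) LinearMap.id

/-- Right multiplication by `e ∈ E` on `X_{rs}`. -/
def rX (e : E) {r s : ℕ} : Xc k A H E r s →ₗ[k] Xc k A H E r s :=
  TensorProduct.map LinearMap.id (TensorProduct.map LinearMap.id
    (TensorProduct.map LinearMap.id (LinearMap.mulRight k e)))

/-- Transport along equalities of indices. -/
def xcast {r r' s s' : ℕ} (hr : r = r') (hs : s = s') :
    Xc k A H E r s →ₗ[k] Xc k A H E r' s' := by
  subst hr; subst hs; exact LinearMap.id

end Resolution

section ResData

variable {k A H E : Type} [CommRing k] [Ring A] [Algebra k A] [Ring H] [HopfAlgebra k H]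
  [Ring E] [Algebra k E]

variable (k A H E) in
/-- The resolution `(X_*, d_*)` of the crossed product `E = A #_f H` of Section 1 of
the paper: the maps `μ_s`, `∂_s`, `σ⁰`, and the (higher) differentials `d^l_{rs}`
(`d⁰ = dl 0`), together with all of their defining equations.  Here
`dl l r s : X_{rs} → X_{r+l-1, s-l}`. -/
structure ResData (S : CrossedProduct k A H E) : Type where
  mu : ∀ s : ℕ, Xc k A H E 0 s →ₗ[k] Yc k H E s
  del : ∀ s : ℕ, Yc k H E (s + 1) →ₗ[k] Yc k H E s
  sig0 : ∀ s : ℕ, Yc k H E s →ₗ[k] Xc k A H E 0 s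
  sig : ∀ r s : ℕ, Xc k A H E r s →ₗ[k] Xc k A H E (r + 1) s
  dl : ∀ l r s : ℕ, Xc k A H E r s →ₗ[k] Xc k A H E (r + l - 1) (s - l)
  /-- `μ_s(a₀ ⊗ 𝐡_{0s} ⊗ a₁ ⊗ h_{s+1}) = a₀ a₁^{𝐡_{0s}⁽¹⁾} ⊗ 𝐡_{0s}⁽²⁾ ⊗ h_{s+1}`. -/
  mu_eq : ∀ (s : ℕ) (a₀ : A) (h₀ : H) (hs : Fin s → H) (b : A) (h' : H)
    (Nv : Fin (s + 1) → ℕ) (v : ∀ i, Fin (Nv i) → Fin 2 → H),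
    (∀ i, SRep k 1 ((Fin.cons h₀ hs : Fin (s + 1) → H) i) (Nv i) (v i)) →
    mu s (xgen (S.ι (a₀ ⊗ₜ[k] h₀)) hs (fun i : Fin 0 => i.elim0) (S.ι (b ⊗ₜ[k] h'))) =
      ∑ c : (∀ i, Fin (Nv i)),
        ygen (S.ι ((a₀ * iterAct k S.act (fun i => v i (c i) 0) b) ⊗ₜ[k] (v 0 (c 0) 1)))
          (fun i : Fin s => v i.succ (c i.succ) 1) h'
  /-- `d⁰_{rs}` is the Hochschild-type boundary in the `A`-direction. -/
  d0_eq : ∀ (r s : ℕ) (a₀ : A) (h₀ : H) (hs : Fin s → H) (as : Fin (r + 1) → A)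
    (b : A) (h' : H) (Nv : Fin (s + 1) → ℕ) (v : ∀ i, Fin (Nv i) → Fin 2 → H),
    (∀ i, SRep k 1 ((Fin.cons h₀ hs : Fin (s + 1) → H) i) (Nv i) (v i)) →
    dl 0 (r + 1) s (xgen (S.ι (a₀ ⊗ₜ[k] h₀)) hs as (S.ι (b ⊗ₜ[k] h'))) =
      (∑ c : (∀ i, Fin (Nv i)),
        xgen (S.ι ((a₀ * iterAct k S.act (fun i => v i (c i) 0) (as 0)) ⊗ₜ[k] (v 0 (c 0) 1)))
          (fun i : Fin s => v i.succ (c i.succ) 1)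
          (fun i : Fin r => as i.succ) (S.ι (b ⊗ₜ[k] h')))
      + (∑ i : Fin r, ((-1 : ℤ) ^ ((i : ℕ) + 1)) •
          xgen (S.ι (a₀ ⊗ₜ[k] h₀)) hs (mulAt as i) (S.ι (b ⊗ₜ[k] h')))
      + ((-1 : ℤ) ^ (r + 1)) •
          xgen (S.ι (a₀ ⊗ₜ[k] h₀)) hs (fun i : Fin r => as i.castSucc)
            (S.ι ((as (Fin.last r) * b) ⊗ₜ[k] h'))
  /-- `∂_s(a ⊗ 𝐡) = ∑ᵢ (-1)^{i+1} a f(hᵢ⁽¹⁾, hᵢ₊₁⁽¹⁾)^{𝐡_{0,i-1}⁽¹⁾} ⊗ 𝐡_{0,i-1}⁽²⁾ ⊗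
  hᵢ⁽²⁾hᵢ₊₁⁽²⁾ ⊗ 𝐡_{i+2,s+1}`. -/
  del_eq : ∀ (s : ℕ) (a : A) (h₀ : H) (hs : Fin (s + 1) → H) (h' : H)
    (Nv : Fin (s + 3) → ℕ) (v : ∀ i, Fin (Nv i) → Fin 2 → H),
    (∀ i, SRep k 1 ((Fin.cons h₀ (Fin.snoc hs h') : Fin (s + 3) → H) i) (Nv i) (v i)) →
    del s (ygen (S.ι (a ⊗ₜ[k] h₀)) hs h') =
      ∑ i : Fin (s + 2), ((-1 : ℤ) ^ ((i : ℕ) + 1)) •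
        (∑ c : (∀ j : Fin ((i : ℕ) + 2),
            Fin (Nv ⟨(j : ℕ), by have := j.isLt; have := i.isLt; omega⟩)),
          ygen
            (S.ι ((a * iterAct k S.act
                (fun j : Fin (i : ℕ) =>
                  v ⟨(j : ℕ), by have := j.isLt; have := i.isLt; omega⟩
                    (c ⟨(j : ℕ), by have := j.isLt; have := i.isLt; omega⟩) 0)
                (S.f (v ⟨(i : ℕ), by have := i.isLt; omega⟩
                        (c ⟨(i : ℕ), by omega⟩) 0)
                     (v ⟨(i : ℕ) + 1, by have := i.isLt; omega⟩
                        (c ⟨(i : ℕ) + 1, by omega⟩) 0))) ⊗ₜ[k]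
              (if (i : ℕ) = 0 then
                  (v ⟨0, by omega⟩ (c ⟨0, by omega⟩) 1) * (v ⟨1, by omega⟩ (c ⟨1, by omega⟩) 1)
                else v ⟨0, by omega⟩ (c ⟨0, by omega⟩) 1)))
            (fun p : Fin s =>
              if hp : (p : ℕ) + 1 < (i : ℕ) then
                v ⟨(p : ℕ) + 1, by have := p.isLt; have := i.isLt; omega⟩
                  (c ⟨(p : ℕ) + 1, by omega⟩) 1
              else if hp' : (p : ℕ) + 1 = (i : ℕ) then
                (v ⟨(p : ℕ) + 1, by have := p.isLt; omega⟩ (c ⟨(p : ℕ) + 1, by omega⟩) 1) *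
                  (v ⟨(p : ℕ) + 2, by have := p.isLt; have := i.isLt; omega⟩
                    (c ⟨(p : ℕ) + 2, by omega⟩) 1)
              else (Fin.cons h₀ (Fin.snoc hs h') : Fin (s + 3) → H) ⟨(p : ℕ) + 2, by have := p.isLt; omega⟩)
            (if hi : (i : ℕ) = s + 1 then
                (v ⟨s + 1, by omega⟩ (c ⟨s + 1, by omega⟩) 1) *
                  (v ⟨s + 2, by omega⟩ (c ⟨s + 2, by omega⟩) 1)
              else (Fin.cons h₀ (Fin.snoc hs h') : Fin (s + 3) → H) ⟨s + 2, by omega⟩))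
  /-- `σ⁰_{0,s}(a₀ ⊗ 𝐡 ⊗ h_{s+1}) = a₀ ⊗ 𝐡 ⊗ 1 # h_{s+1}`. -/
  sig0_eq : ∀ (s : ℕ) (e : E) (hs : Fin s → H) (h : H),
    sig0 s (ygen e hs h) = xgen e hs (fun i : Fin 0 => i.elim0) (S.hE h)
  /-- `σ⁰_{r+1,s}(a₀ ⊗ 𝐡 ⊗ 𝐚 ⊗ a # h) = (-1)^{r+1} a₀ ⊗ 𝐡 ⊗ 𝐚 ⊗ ā ⊗ 1 # h`. -/
  sig_eq : ∀ (r s : ℕ) (e : E) (hs : Fin s → H) (as : Fin r → A) (b : A) (h' : H),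
    sig r s (xgen e hs as (S.ι (b ⊗ₜ[k] h'))) =
      ((-1 : ℤ) ^ (r + 1)) • xgen e hs (Fin.snoc as b) (S.hE h')
  /-- `d¹_{0s} = -σ⁰ ∘ ∂ ∘ μ` on `k ⊗ H̄^s ⊗ k`. -/
  dl_one_zero : ∀ (s : ℕ) (hs : Fin (s + 1) → H),
    dl 1 0 (s + 1) (xgen (1 : E) hs (fun i : Fin 0 => i.elim0) (1 : E)) =
      - sig0 s (del s (mu (s + 1) (xgen (1 : E) hs (fun i : Fin 0 => i.elim0) (1 : E))))
  /-- `d^l_{0s} = -∑_{j=1}^{l-1} σ⁰ ∘ d^{l-j} ∘ d^j` on `k ⊗ H̄^s ⊗ k`, for `1 < l ≤ s`. -/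
  dl_zero : ∀ (l s : ℕ) (hl : 2 ≤ l) (hls : l ≤ s) (hs : Fin s → H),
    dl l 0 s (xgen (1 : E) hs (fun i : Fin 0 => i.elim0) (1 : E)) =
      - ∑ j : Fin (l - 1),
        xcast (show (l - 2) + 1 = 0 + l - 1 by omega) rfl
          (sig (l - 2) (s - l)
            (xcast
              (show (j : ℕ) + (l - ((j : ℕ) + 1)) - 1 = l - 2 by
                have := j.isLt; omega)
              (show (s - ((j : ℕ) + 1)) - (l - ((j : ℕ) + 1)) = s - l by
                have := j.isLt; omega)
              (dl (l - ((j : ℕ) + 1)) ((j : ℕ)) (s - ((j : ℕ) + 1))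
                (xcast (show 0 + ((j : ℕ) + 1) - 1 = (j : ℕ) by omega) rfl
                  (dl ((j : ℕ) + 1) 0 s
                    (xgen (1 : E) hs (fun i : Fin 0 => i.elim0) (1 : E)))))))
  /-- `d^l_{rs} = -∑_{j=0}^{l-1} σ⁰ ∘ d^{l-j} ∘ d^j` on `k ⊗ H̄^s ⊗ Ā^r ⊗ k`, for `r > 0`,
  `1 ≤ l ≤ s`. -/
  dl_succ : ∀ (l r s : ℕ) (hl : 1 ≤ l) (hls : l ≤ s) (hs : Fin s → H) (as : Fin (r + 1) → A),
    dl l (r + 1) s (xgen (1 : E) hs as (1 : E)) =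
      - ∑ j : Fin l,
        xcast (show (r + l - 1) + 1 = (r + 1) + l - 1 by omega) rfl
          (sig (r + l - 1) (s - l)
            (xcast
              (show (r + (j : ℕ)) + (l - (j : ℕ)) - 1 = r + l - 1 by
                have := j.isLt; omega)
              (show (s - (j : ℕ)) - (l - (j : ℕ)) = s - l by
                have := j.isLt; omega)
              (dl (l - (j : ℕ)) (r + (j : ℕ)) (s - (j : ℕ))
                (xcast (show (r + 1) + (j : ℕ) - 1 = r + (j : ℕ) by omega) rfl
                  (dl (j : ℕ) (r + 1) s (xgen (1 : E) hs as (1 : E)))))))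
  /-- Each `d^l_{rs}` is a map of `E`-bimodules. -/
  dl_lmul : ∀ (l r s : ℕ) (e : E), dl l r s ∘ₗ lX e = lX e ∘ₗ dl l r s
  dl_rmul : ∀ (l r s : ℕ) (e : E), dl l r s ∘ₗ rX e = rX e ∘ₗ dl l r s

end ResData

section Xtot

variable {k A H E : Type} [CommRing k] [Ring A] [Algebra k A] [Ring H] [HopfAlgebra k H]
  [Ring E] [Algebra k E]

variable (k A H E) in
/-- The total module `X_n = ⊕_{r+s=n} X_{rs}`. -/
abbrev XT (n : ℕ) : Type :=
  ⨁ (s : Fin (n + 1)), Xc k A H E (n - (s : ℕ)) (s : ℕ)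

/-- The total differential `d_n = ∑_{r+s=n, r+l>0} ∑_{l=0}^{s} d^l_{rs}`. -/
noncomputable def dT {S : CrossedProduct k A H E} (R : ResData k A H E S) (n : ℕ) :
    XT k A H E (n + 1) →ₗ[k] XT k A H E n :=
  DirectSum.toModule k (Fin (n + 2)) (XT k A H E n) (fun s =>
    ∑ l : Fin ((s : ℕ) + 1),
      if h : 0 < (n + 1 - (s : ℕ)) + (l : ℕ) then
        (DirectSum.lof k (Fin (n + 1)) (fun s' : Fin (n + 1) => Xc k A H E (n - (s' : ℕ)) (s' : ℕ))
            ⟨(s : ℕ) - (l : ℕ), by have := s.isLt; have := l.isLt; omega⟩) ∘ₗ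
          xcast
            (show (n + 1 - (s : ℕ)) + (l : ℕ) - 1 = n - ((s : ℕ) - (l : ℕ)) by
              have := s.isLt; have := l.isLt; omega)
            rfl ∘ₗ
          R.dl (l : ℕ) (n + 1 - (s : ℕ)) (s : ℕ)
      else 0)

/-- Left multiplication by `e ∈ E` on `X_n`. -/
noncomputable def lT (e : E) (n : ℕ) : XT k A H E n →ₗ[k] XT k A H E n :=
  DirectSum.toModule k (Fin (n + 1)) (XT k A H E n) (fun s =>
    (DirectSum.lof k (Fin (n + 1)) (fun s' : Fin (n + 1) => Xc k A H E (n - (s' : ℕ)) (s' : ℕ)) s)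
      ∘ₗ lX e)

/-- Right multiplication by `e ∈ E` on `X_n`. -/
noncomputable def rT (e : E) (n : ℕ) : XT k A H E n →ₗ[k] XT k A H E n :=
  DirectSum.toModule k (Fin (n + 1)) (XT k A H E n) (fun s =>
    (DirectSum.lof k (Fin (n + 1)) (fun s' : Fin (n + 1) => Xc k A H E (n - (s' : ℕ)) (s' : ℕ)) s)
      ∘ₗ rX e)

/-- The augmentation `X_0 → E` induced by a map `μ : X_{00} → E`. -/
noncomputable def multT (mult : Xc k A H E 0 0 →ₗ[k] E) : XT k A H E 0 →ₗ[k] E :=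
  DirectSum.toModule k (Fin 1) E (fun s =>
    mult ∘ₗ xcast (show 0 - (s : ℕ) = 0 by have := s.isLt; omega)
      (show (s : ℕ) = 0 by have := s.isLt; omega))

end Xtot

section Xhat

variable {k A H E M : Type} [CommRing k] [Ring A] [Algebra k A] [Ring H] [HopfAlgebra k H]
  [Ring E] [Algebra k E] [AddCommGroup M] [Module k M]

variable (k) in
/-- The componentwise projection `A^{⊗m} → Ā^{⊗m}`. -/
noncomputable def tpQ : ∀ m : ℕ, Tpow k A m →ₗ[k] Tpow k (Qbar k A) m
  | 0 => LinearMap.id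
  | m + 1 => TensorProduct.map (qbar k A) (tpQ m)

variable (k A H M) in
/-- The component `M ⊗ H̄^{⊗s} ⊗ Ā^{⊗r}` of the complex `X̂_*(E, M)`. -/
abbrev Cms (r s : ℕ) : Type :=
  M ⊗[k] (Tpow k (Qbar k H) s ⊗[k] Tpow k (Qbar k A) r)

/-- The generator `m ⊗ h̄₁ ⊗ ⋯ ⊗ h̄ₛ ⊗ ā₁ ⊗ ⋯ ⊗ āᵣ` of `M ⊗ H̄^{⊗s} ⊗ Ā^{⊗r}`. -/
def cgen (m : M) {s r : ℕ} (hs : Fin s → H) (as : Fin r → A) : Cms k A H M r s :=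
  m ⊗ₜ[k] (tp k (fun i => qbar k H (hs i)) ⊗ₜ[k] tp k (fun i => qbar k A (as i)))

/-- Transport along equalities of indices. -/
def ccast {r r' s s' : ℕ} (hr : r = r') (hs : s = s') :
    Cms k A H M r s →ₗ[k] Cms k A H M r' s' := by
  subst hr; subst hs; exact LinearMap.id

variable (k A H M) in
/-- The total module `X̂_n = ⊕_{r+s=n} M ⊗ H̄^{⊗s} ⊗ Ā^{⊗r}`. -/
abbrev XhT (n : ℕ) : Type := ⨁ (s : Fin (n + 1)), Cms k A H M (n - (s : ℕ)) (s : ℕ)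

/-- The total differential `d̂_n = ∑_{r+s=n, r+l>0} ∑_{l=0}^{s} d̂^l_{rs}`. -/
noncomputable def dhT
    (dc : ∀ l r s : ℕ, Cms k A H M r s →ₗ[k] Cms k A H M (r + l - 1) (s - l)) (n : ℕ) :
    XhT k A H M (n + 1) →ₗ[k] XhT k A H M n :=
  DirectSum.toModule k (Fin (n + 2)) (XhT k A H M n) (fun s =>
    ∑ l : Fin ((s : ℕ) + 1),
      if h : 0 < (n + 1 - (s : ℕ)) + (l : ℕ) then
        (DirectSum.lof k (Fin (n + 1)) (fun s' : Fin (n + 1) => Cms k A H M (n - (s' : ℕ)) (s' : ℕ))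
            ⟨(s : ℕ) - (l : ℕ), by have := s.isLt; have := l.isLt; omega⟩) ∘ₗ
          ccast
            (show (n + 1 - (s : ℕ)) + (l : ℕ) - 1 = n - ((s : ℕ) - (l : ℕ)) by
              have := s.isLt; have := l.isLt; omega)
            rfl ∘ₗ
          dc (l : ℕ) (n + 1 - (s : ℕ)) (s : ℕ)
      else 0)

variable (k) in
/-- `IsDhat S Bi F dc` : `dc` is the family of maps `d̂^l_{rs}` of Theorem 2.1.1. -/
def IsDhat {E : Type} [Ring E] [Algebra k E] (S : CrossedProduct k A H E) (Bi : Bimod k E M)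
    (F : ∀ l r : ℕ, (Tpow k (Qbar k H) l ⊗[k] Tpow k (Qbar k A) r) →ₗ[k] Tpow k A (r + l - 1))
    (dc : ∀ l r s : ℕ, Cms k A H M r s →ₗ[k] Cms k A H M (r + l - 1) (s - l)) : Prop :=
  -- `d̂⁰`
  (∀ (r s : ℕ) (m : M) (hs : Fin s → H) (as : Fin (r + 1) → A)
    (Nv : Fin s → ℕ) (v : ∀ i, Fin (Nv i) → Fin 2 → H),
    (∀ i, SRep k 1 (hs i) (Nv i) (v i)) →
    dc 0 (r + 1) s (cgen m hs as) =
      (∑ c : (∀ i, Fin (Nv i)),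
        cgen (Bi.r (S.aE (iterAct k S.act (fun i => v i (c i) 0) (as 0))) m)
          (fun i => v i (c i) 1) (fun i : Fin r => as i.succ))
      + (∑ i : Fin r, ((-1 : ℤ) ^ ((i : ℕ) + 1)) • cgen m hs (mulAt as i))
      + ((-1 : ℤ) ^ (r + 1)) •
          cgen (Bi.l (S.aE (as (Fin.last r))) m) hs (fun i : Fin r => as i.castSucc)) ∧
  -- `d̂¹`
  (∀ (r s : ℕ) (m : M) (hs : Fin (s + 1) → H) (as : Fin r → A)
    (Nv : Fin (s + 1) → ℕ) (v : ∀ i, Fin (Nv i) → Fin 2 → H)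
    (Nw : ℕ) (w : Fin Nw → Fin (r + 1) → H),
    (∀ i, SRep k 1 (hs i) (Nv i) (v i)) →
    SRep k r (hs (Fin.last s)) Nw w →
    dc 1 r (s + 1) (cgen m hs as) =
      ((-1 : ℤ) ^ r) • cgen (Bi.r (S.hE (hs 0)) m) (fun i : Fin s => hs i.succ) as
      + ((-1 : ℤ) ^ (r + s + 1)) •
          (∑ mw : Fin Nw,
            cgen (Bi.l (S.hE (w mw (Fin.last r))) m) (fun i : Fin s => hs i.castSucc)
              (fun j : Fin r => S.act (w mw j.castSucc) (as j)))
      + ∑ t : Fin s, ((-1 : ℤ) ^ (r + (t : ℕ) + 1)) •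
          (∑ c : (∀ j : Fin ((t : ℕ) + 2),
              Fin (Nv ⟨(j : ℕ), by have := j.isLt; have := t.isLt; omega⟩)),
            cgen
              (Bi.r (S.aE (iterAct k S.act
                (fun j : Fin (t : ℕ) =>
                  v ⟨(j : ℕ), by have := j.isLt; have := t.isLt; omega⟩
                    (c ⟨(j : ℕ), by have := j.isLt; have := t.isLt; omega⟩) 0)
                (S.f (v ⟨(t : ℕ), by have := t.isLt; omega⟩ (c ⟨(t : ℕ), by omega⟩) 0)
                     (v ⟨(t : ℕ) + 1, by have := t.isLt; omega⟩
                        (c ⟨(t : ℕ) + 1, by omega⟩) 0)))) m)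
              (fun p : Fin s =>
                if hp : (p : ℕ) < (t : ℕ) then
                  v ⟨(p : ℕ), by have := p.isLt; omega⟩ (c ⟨(p : ℕ), by omega⟩) 1
                else if hp' : (p : ℕ) = (t : ℕ) then
                  (v ⟨(p : ℕ), by have := p.isLt; omega⟩ (c ⟨(p : ℕ), by omega⟩) 1) *
                    (v ⟨(p : ℕ) + 1, by have := p.isLt; have := t.isLt; omega⟩
                      (c ⟨(p : ℕ) + 1, by omega⟩) 1)
                else hs ⟨(p : ℕ) + 1, by have := p.isLt; omega⟩)
              as)) ∧
  -- `d̂^l` for `2 ≤ l ≤ s`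
  (∀ (l r s : ℕ) (hl : 2 ≤ l) (hls : l ≤ s) (m : M) (hs : Fin s → H) (as : Fin r → A)
    (Nv : Fin l → ℕ) (v : ∀ j, Fin (Nv j) → Fin 2 → H),
    (∀ j : Fin l, SRep k 1 (hs ⟨s - l + (j : ℕ), by have := j.isLt; omega⟩) (Nv j) (v j)) →
    dc l r s (cgen m hs as) =
      ((-1 : ℤ) ^ (l * (r + s))) •
        ∑ c : (∀ j : Fin l, Fin (Nv j)),
          (Bi.l (S.hE ((List.ofFn (fun j : Fin l => v j (c j) 1)).prod)) m) ⊗ₜ[k]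
            ((tp k (fun p : Fin (s - l) =>
                qbar k H (hs ⟨(p : ℕ), by have := p.isLt; omega⟩))) ⊗ₜ[k]
              (tpQ k (r + l - 1)
                (F l r ((tp k (fun j : Fin l => qbar k H (v j (c j) 0))) ⊗ₜ[k]
                  (tp k (fun i : Fin r => qbar k A (as i))))))))

variable (k) in
/-- `IsF S R F` : `F` is a family of maps as in Theorem 1.1.3(2): its image lies in the
span of elementary tensors with `l-1` coordinates in the image of `f`, and `d^l_{rs}` is
given by `F` on `k ⊗ H̄^s ⊗ Ā^r ⊗ k`. -/
def IsF {E : Type} [Ring E] [Algebra k E] (S : CrossedProduct k A H E)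
    (R : ResData k A H E S)
    (F : ∀ l r : ℕ, (Tpow k (Qbar k H) l ⊗[k] Tpow k (Qbar k A) r) →ₗ[k] Tpow k A (r + l - 1)) :
    Prop :=
  (∀ (l r : ℕ), 2 ≤ l → ∀ z : Tpow k (Qbar k H) l ⊗[k] Tpow k (Qbar k A) r,
    F l r z ∈ Submodule.span k
      {y : Tpow k A (r + l - 1) | ∃ (a : Fin (r + l - 1) → A) (J : Finset (Fin (r + l - 1))),
        J.card = l - 1 ∧ (∀ j ∈ J, a j ∈ LinearMap.range (TensorProduct.lift S.f)) ∧
        y = tp k a}) ∧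
  (∀ (l r s : ℕ) (hl : 2 ≤ l) (hls : l ≤ s) (a₀ : A) (h₀ : H) (hs : Fin s → H)
    (as : Fin r → A) (Nv : Fin l → ℕ) (v : ∀ j, Fin (Nv j) → Fin 2 → H),
    (∀ j : Fin l, SRep k 1 (hs ⟨s - l + (j : ℕ), by have := j.isLt; omega⟩) (Nv j) (v j)) →
    R.dl l r s (xgen (S.ι (a₀ ⊗ₜ[k] h₀)) hs as (1 : E)) =
      ((-1 : ℤ) ^ (l * (r + s))) •
        ∑ c : (∀ j : Fin l, Fin (Nv j)),
          (S.ι (a₀ ⊗ₜ[k] h₀)) ⊗ₜ[k]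
            ((tp k (fun p : Fin (s - l) =>
                qbar k H (hs ⟨(p : ℕ), by have := p.isLt; omega⟩))) ⊗ₜ[k]
              ((tpQ k (r + l - 1)
                  (F l r ((tp k (fun j : Fin l => qbar k H (v j (c j) 0))) ⊗ₜ[k]
                    (tp k (fun i : Fin r => qbar k A (as i)))))) ⊗ₜ[k]
                (S.hE ((List.ofFn (fun j : Fin l => v j (c j) 1)).prod)))))

variable (k A H E M) in
/-- `M ⊗ X_{rs}`. -/
abbrev MX (r s : ℕ) : Type := M ⊗[k] Xc k A H E r s

/-- The submodule of relations defining `M ⊗_{E^e} X_{rs}`. -/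
noncomputable def relSub (Bi : Bimod k E M) (r s : ℕ) : Submodule k (MX k A H E M r s) :=
  Submodule.span k
    {z : MX k A H E M r s |
      (∃ (m : M) (e : E) (x : Xc k A H E r s),
        z = m ⊗ₜ[k] lX e x - (Bi.r e m) ⊗ₜ[k] x) ∨
      (∃ (m : M) (e : E) (x : Xc k A H E r s),
        z = m ⊗ₜ[k] rX e x - (Bi.l e m) ⊗ₜ[k] x)}

variable (k A H E M) in
/-- `M ⊗_{E^e} X_{rs}`. -/
abbrev MQ (Bi : Bimod k E M) (r s : ℕ) : Type :=
  MX k A H E M r s ⧸ relSub Bi r s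

end Xhat


section FastInst
variable {R V W : Type} [CommRing R] [AddCommGroup V] [AddCommGroup W] [Module R V] [Module R W]
abbrev fiHom : AddMonoidHomClass (V →ₗ[R] W) V W := inferInstance
abbrev fiZHom : ZeroHomClass (V →ₗ[R] W) V W := inferInstance
abbrev fiAHom : AddHomClass (V →ₗ[R] W) V W := inferInstance
abbrev fiTG : AddCommGroup (V ⊗[R] W) := inferInstance
abbrev fiTCM : AddCommMonoid (V ⊗[R] W) := inferInstance
abbrev fiTM : AddMonoid (V ⊗[R] W) := inferInstance
abbrev fiTZ : AddZeroClass (V ⊗[R] W) := inferInstance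
abbrev fiTAG : AddGroup (V ⊗[R] W) := inferInstance
abbrev fiTMod : Module R (V ⊗[R] W) := inferInstance
abbrev fiLCM : AddCommMonoid (V →ₗ[R] W) := inferInstance
abbrev fiLM : AddMonoid (V →ₗ[R] W) := inferInstance
abbrev fiLG : AddCommGroup (V →ₗ[R] W) := inferInstance
abbrev fiLMod : Module R (V →ₗ[R] W) := inferInstance
abbrev fiPG (n : ℕ) : AddCommGroup (Tpow R V n) := inferInstance
abbrev fiPCM (n : ℕ) : AddCommMonoid (Tpow R V n) := inferInstance
abbrev fiPMod (n : ℕ) : Module R (Tpow R V n) := inferInstance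
abbrev fiRCM {B : Type} [Ring B] : AddCommMonoid B := NonUnitalNonAssocSemiring.toAddCommMonoid
variable {k A H E M : Type} [CommRing k] [Ring A] [Algebra k A] [Ring H] [HopfAlgebra k H]
  [Ring E] [Algebra k E] [AddCommGroup M] [Module k M]
abbrev fiXTG (n : ℕ) : AddCommGroup (XT k A H E n) := inferInstance
abbrev fiXTCM (n : ℕ) : AddCommMonoid (XT k A H E n) := inferInstance
abbrev fiXHG (n : ℕ) : AddCommGroup (XhT k A H M n) := inferInstance
abbrev fiXHCM (n : ℕ) : AddCommMonoid (XhT k A H M n) := inferInstance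
abbrev fiGCM {V : Type} [AddCommGroup V] : AddCommMonoid V := AddCommGroup.toAddCommMonoid
abbrev fiGZ {V : Type} [AddCommGroup V] : AddMonoid V := AddCommMonoid.toAddMonoid
end FastInst

section FastAll
set_option linter.all false
attribute [local instance] fiHom fiZHom fiAHom fiTM fiTZ fiTAG fiXTG fiXTCM fiXHG fiXHCM fiGCM

section PTens

variable {k V W N B : Type} [CommRing k] [AddCommGroup V] [Module k V] [AddCommGroup W] [Module k W]
  [AddCommGroup N] [Module k N] [Ring B] [Algebra k B]

def tcons {n : ℕ} : V →ₗ[k] Tpow k V n →ₗ[k] Tpow k V (n + 1) :=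
  TensorProduct.mk k V (Tpow k V n)

def tlift {n : ℕ} (f : V →ₗ[k] Tpow k V n →ₗ[k] N) : Tpow k V (n + 1) →ₗ[k] N :=
  TensorProduct.lift f

theorem tlift_tcons {n : ℕ} (f : V →ₗ[k] Tpow k V n →ₗ[k] N) (v : V) (t : Tpow k V n) :
    tlift f (tcons v t) = f v t :=
  TensorProduct.lift.tmul v t

theorem tp_succ {n : ℕ} (v : Fin (n + 1) → V) :
    tp k v = tcons (v 0) (tp k fun i => v i.succ) := rfl

theorem tp_zero (v : Fin 0 → V) : tp k v = (1 : k) := rfl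

theorem tlift_ext {n : ℕ} {f g : Tpow k V (n + 1) →ₗ[k] N}
    (h : ∀ v t, f (tcons v t) = g (tcons v t)) : f = g :=
  TensorProduct.ext' h

def tone : Tpow k V 0 := (1 : k)

theorem tzero_ext {f g : Tpow k V 0 →ₗ[k] N} (h : f tone = g tone) : f = g :=
  LinearMap.ext_ring h

theorem tp_zero' (v : Fin 0 → V) : tp k v = tone := rfl

def tlift0 (x : N) : Tpow k V 0 →ₗ[k] N := LinearMap.toSpanSingleton k N x

theorem tlift0_tone (x : N) : tlift0 (k := k) (V := V) x tone = x := by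
  change (1 : k) • x = x
  simp

theorem tpow_ext (p : W →ₗ[k] V) (hp : Function.Surjective p) : ∀ {n : ℕ} {N : Type}
    [AddCommGroup N] [Module k N] {f g : Tpow k V n →ₗ[k] N}
    (_ : ∀ x : Fin n → W, f (tp k fun i => p (x i)) = g (tp k fun i => p (x i))), f = g
  | 0, _, _, _, _, _, h => tzero_ext (h Fin.elim0)
  | n + 1, N, _, _, f, g, h => by
    apply tlift_ext
    intro v t
    obtain ⟨w, rfl⟩ := hp v
    have : f ∘ₗ tcons (p w) = g ∘ₗ tcons (p w) := by
      apply tpow_ext p hp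
      intro x
      have := h (Fin.cons w x)
      simpa [tp_succ] using this
    exact LinearMap.congr_fun this t

theorem qbar_surj : Function.Surjective (qbar k B) := Submodule.mkQ_surjective _

theorem qbar_one : qbar k B 1 = 0 := by
  rw [Submodule.mkQ_apply, Submodule.Quotient.mk_eq_zero]
  exact ⟨1, by simp⟩

theorem tpQ_tp : ∀ {n : ℕ} (x : Fin n → B), tpQ k n (tp k x) = tp k fun i => qbar k B (x i)
  | 0, _ => rfl
  | n + 1, x => by
    change TensorProduct.map (qbar k B) (tpQ k n) (x 0 ⊗ₜ[k] tp k fun i => x i.succ) = _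
    rw [TensorProduct.map_tmul, tpQ_tp]; rfl

theorem tpQ_tcons {n : ℕ} (x : B) (t : Tpow k B n) :
    tpQ k (n + 1) (tcons x t) = tcons (qbar k B x) (tpQ k n t) := rfl

theorem tpow_rep : ∀ {n : ℕ} (z : Tpow k V (n + 1)),
    ∃ (M : ℕ) (u : Fin M → Fin (n + 1) → V), z = ∑ i, tp k (u i) := by
  intro n
  induction n with
  | zero =>
    intro z
    induction z using TensorProduct.induction_on with
    | zero => exact ⟨0, Fin.elim0, by simp; rfl⟩
    | tmul v t =>
      refine ⟨1, fun _ _ => (show k from t) • v, ?_⟩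
      rw [Finset.univ_unique, Finset.sum_singleton, tp_succ]
      change v ⊗ₜ[k] (show k from t) = (((show k from t) • v) ⊗ₜ[k] (1 : k))
      rw [TensorProduct.smul_tmul, smul_eq_mul, mul_one]
    | add x y hx hy =>
      obtain ⟨M, u, rfl⟩ := hx
      obtain ⟨M', u', rfl⟩ := hy
      exact ⟨M + M', Fin.append u u', by rw [Fin.sum_univ_add]; simp; rfl⟩
  | succ n ih =>
    intro z
    induction z using TensorProduct.induction_on with
    | zero => exact ⟨0, Fin.elim0, by simp; rfl⟩
    | tmul v t =>
      obtain ⟨M, u, hu⟩ := ih t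
      refine ⟨M, fun i => Fin.cons v (u i), ?_⟩
      change tcons v t = _
      rw [hu, map_sum]
      rfl
    | add x y hx hy =>
      obtain ⟨M, u, rfl⟩ := hx
      obtain ⟨M', u', rfl⟩ := hy
      exact ⟨M + M', Fin.append u u', by rw [Fin.sum_univ_add]; simp; rfl⟩

theorem tp_eq_zero : ∀ {n : ℕ} (x : Fin n → V) (i : Fin n), x i = 0 → tp k x = 0
  | 0, _, i, _ => i.elim0
  | n + 1, x, i, h => by
    rw [tp_succ]
    refine Fin.cases (motive := fun i => x i = 0 → _) (fun h => by rw [h]; simp) (fun j hj => ?_) i h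
    rw [tp_eq_zero (fun i => x i.succ) j hj, map_zero]

def tsnoc (l : V) : ∀ n : ℕ, Tpow k V n →ₗ[k] Tpow k V (n + 1)
  | 0 => tlift0 (tcons l tone)
  | n + 1 => tlift ((LinearMap.lcomp k (Tpow k V (n + 1 + 1)) (tsnoc l n)) ∘ₗ tcons)

theorem tsnoc_tcons (l : V) {n : ℕ} (v : V) (t : Tpow k V n) :
    tsnoc l (n + 1) (tcons v t) = tcons v (tsnoc l n t) := by
  rw [tsnoc, tlift_tcons]; rfl

theorem snoc_fun_succ {U : Type} {n : ℕ} (x : Fin (n + 1) → U) (l : U) :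
    (fun i : Fin (n + 1) => (Fin.snoc x l : Fin (n + 2) → U) i.succ) =
      Fin.snoc (fun i => x i.succ) l := by
  funext i
  refine Fin.lastCases ?_ (fun j => ?_) i
  · rw [Fin.snoc_last, Fin.succ_last, Fin.snoc_last]
  · rw [Fin.snoc_castSucc, Fin.succ_castSucc, Fin.snoc_castSucc]

theorem snoc_fun_zero {U : Type} {n : ℕ} (x : Fin (n + 1) → U) (l : U) :
    (Fin.snoc x l : Fin (n + 2) → U) 0 = x 0 :=
  Fin.snoc_castSucc (α := fun _ => U) l x 0

theorem tsnoc_tp (l : V) : ∀ {n : ℕ} (x : Fin n → V),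
    tsnoc l n (tp k x) = tp k (Fin.snoc x l : Fin (n + 1) → V)
  | 0, x => by
    rw [tp_zero', tsnoc, tlift0_tone]; rfl
  | n + 1, x => by
    rw [tp_succ x, tsnoc_tcons, tsnoc_tp, tp_succ (Fin.snoc x l : Fin (n + 2) → V),
      snoc_fun_succ, snoc_fun_zero]

end PTens


section PCross

variable {k A H E N : Type} [CommRing k] [Ring A] [Algebra k A] [Ring H] [HopfAlgebra k H]
  [Ring E] [Algebra k E] [AddCommGroup N] [Module k N]

theorem exists_SRep (n : ℕ) (h : H) : ∃ (N : ℕ) (u : Fin N → Fin (n + 1) → H), SRep k n h N u :=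
  tpow_rep (itComul k n h)

theorem itComul_succ (n : ℕ) (h : H) :
    itComul k (n + 1) h = TensorProduct.lift (tcons (k := k) (V := H) (n := n + 1))
      (TensorProduct.map LinearMap.id (itComul k n) (Coalgebra.comul (R := k) h)) := by
  have : TensorProduct.lift (tcons (k := k) (V := H) (n := n + 1)) = LinearMap.id := by
    apply TensorProduct.ext'; intro x y; rfl
  rw [this]; rfl

theorem itComul_zero (h : H) : itComul k 0 h = tcons h tone := rfl

def tuncons2 : Tpow k H 2 →ₗ[k] H ⊗[k] H :=
  tlift (LinearMap.mk₂ k (fun x t => x ⊗ₜ[k] (tlift (tlift0 (k := k) (V := H) (LinearMap.id (R := k) (M := H))).flip t))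
    (by intro a b c; rw [TensorProduct.add_tmul]) (by intro a b c; rw [TensorProduct.smul_tmul'])
    (by intro a b c; rw [map_add, TensorProduct.tmul_add]) (by intro a b c; rw [map_smul, TensorProduct.tmul_smul]))

theorem tuncons2_tcons (x y : H) : tuncons2 (k := k) (tcons x (tcons y tone)) = x ⊗ₜ[k] y := by
  rw [tuncons2, tlift_tcons, LinearMap.mk₂_apply, tlift_tcons, LinearMap.flip_apply, tlift0_tone,
    LinearMap.id_apply]

theorem SRep_two {h : H} {N : ℕ} {u : Fin N → Fin 2 → H} (hu : SRep k 1 h N u) :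
    Coalgebra.comul (R := k) h = ∑ i, u i 0 ⊗ₜ[k] u i 1 := by
  have e : ∀ z : H ⊗[k] H, tuncons2 (TensorProduct.lift (tcons (k := k) (V := H) (n := 1))
      (TensorProduct.map LinearMap.id (itComul k 0) z)) = z := by
    intro z
    induction z using TensorProduct.induction_on with
    | zero => simp only [map_zero]
    | tmul x y =>
      rw [TensorProduct.map_tmul, TensorProduct.lift.tmul, itComul_zero, LinearMap.id_apply, tuncons2_tcons]
    | add x y hx hy => rw [map_add, map_add, map_add, hx, hy]
  have h1 := e (Coalgebra.comul (R := k) h)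
  unfold SRep at hu
  rw [← h1, ← itComul_succ, hu, map_sum]
  refine Finset.sum_congr rfl fun i _ => ?_
  rw [← tuncons2_tcons]; rfl

theorem SRep_of_two {h : H} {N : ℕ} {u : Fin N → Fin 2 → H}
    (hu : Coalgebra.comul (R := k) h = ∑ i, u i 0 ⊗ₜ[k] u i 1) : SRep k 1 h N u := by
  change TensorProduct.map LinearMap.id (itComul k 0) (Coalgebra.comul (R := k) h) = _
  rw [hu, map_sum]; rfl

theorem SRep_one : SRep k 1 (1 : H) 1 (fun _ _ => 1) := by
  apply SRep_of_two
  simp [Bialgebra.comul_one, Algebra.TensorProduct.one_def]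

theorem SRep_counit_left {h : H} {N : ℕ} {u : Fin N → Fin 2 → H} (hu : SRep k 1 h N u) :
    ∑ i, Coalgebra.counit (R := k) (u i 0) • u i 1 = h := by
  have h1 := LinearMap.congr_fun (Coalgebra.rTensor_counit_comp_comul (R := k) (A := H)) h
  rw [LinearMap.comp_apply, SRep_two hu, map_sum] at h1
  have h2 := congrArg (TensorProduct.lid k H) h1
  simpa using h2

theorem SRep_counit_right {h : H} {N : ℕ} {u : Fin N → Fin 2 → H} (hu : SRep k 1 h N u) :
    ∑ i, Coalgebra.counit (R := k) (u i 1) • u i 0 = h := by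
  have h1 := LinearMap.congr_fun (Coalgebra.lTensor_counit_comp_comul (R := k) (A := H)) h
  rw [LinearMap.comp_apply, SRep_two hu, map_sum] at h1
  have h2 := congrArg (TensorProduct.rid k H) h1
  simpa using h2

/-- Build a 3-fold representation from a 2-fold one. -/
theorem SRep_three {h : H} {N : ℕ} {u : Fin N → Fin 2 → H} (hu : SRep k 1 h N u) :
    ∃ (P : Fin N → ℕ) (w : ∀ i, Fin (P i) → Fin 2 → H), (∀ i, SRep k 1 (u i 1) (P i) (w i)) ∧
      SRep k 2 h (∑ i, P i) (fun j => ![u (finSigmaFinEquiv.symm j).1 0,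
        w _ (finSigmaFinEquiv.symm j).2 0, w _ (finSigmaFinEquiv.symm j).2 1]) := by
  choose P w hw using fun i => exists_SRep (k := k) 1 (u i 1)
  refine ⟨P, w, hw, ?_⟩
  unfold SRep
  rw [itComul_succ, SRep_two hu, map_sum, map_sum]
  have : ∀ i, TensorProduct.lift (tcons (k := k) (V := H) (n := 2))
      (TensorProduct.map LinearMap.id (itComul k 1) (u i 0 ⊗ₜ[k] u i 1)) =
      ∑ j, tp k ![u i 0, w i j 0, w i j 1] := by
    intro i
    rw [TensorProduct.map_tmul, TensorProduct.lift.tmul, LinearMap.id_apply]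
    have := hw i
    unfold SRep at this
    rw [this, map_sum]
    rfl
  rw [Finset.sum_congr rfl fun i _ => this i]
  rw [← Fintype.sum_sigma (fun x : (Σ i, Fin (P i)) => tp k ![u x.1 0, w x.1 x.2 0, w x.1 x.2 1])]
  rw [← (finSigmaFinEquiv (n := P)).symm.sum_comp]

namespace CrossedProduct

variable (S : CrossedProduct k A H E)

theorem iota_mul' (a b : A) (h l : H) {N M : ℕ} {u : Fin N → Fin 2 → H} {v : Fin M → Fin 2 → H}
    (hu : SRep k 1 h N u) (P : Fin N → ℕ) (w : ∀ i, Fin (P i) → Fin 2 → H)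
    (hw : ∀ i, SRep k 1 (u i 1) (P i) (w i))
    (h3 : SRep k 2 h (∑ i, P i) (fun j => ![u (finSigmaFinEquiv.symm j).1 0,
        w _ (finSigmaFinEquiv.symm j).2 0, w _ (finSigmaFinEquiv.symm j).2 1]))
    (hv : SRep k 1 l M v) :
    S.ι (a ⊗ₜ[k] h) * S.ι (b ⊗ₜ[k] l) =
      ∑ i, ∑ p, ∑ j, S.ι ((a * S.act (u i 0) b * S.f (w i p 0) (v j 0)) ⊗ₜ[k] (w i p 1 * v j 1)) := by
  rw [S.ι_mul a b h l _ _ _ _ h3 hv]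
  rw [← Fintype.sum_sigma (fun x : (Σ i, Fin (P i)) =>
    ∑ j, S.ι ((a * S.act (u x.1 0) b * S.f (w x.1 x.2 0) (v j 0)) ⊗ₜ[k] (w x.1 x.2 1 * v j 1)))]
  rw [← (finSigmaFinEquiv (n := P)).symm.sum_comp]
  rfl

theorem aE_mul (a b : A) (h : H) : S.aE a * S.ι (b ⊗ₜ[k] h) = S.ι ((a * b) ⊗ₜ[k] h) := by
  obtain ⟨M, v, hv⟩ := exists_SRep (k := k) 1 h
  have h3 : SRep k 2 (1 : H) 1 (fun _ _ => 1) := by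
    unfold SRep
    rw [itComul_succ, Bialgebra.comul_one, Algebra.TensorProduct.one_def,
      TensorProduct.map_tmul, TensorProduct.lift.tmul]
    have := SRep_one (k := k) (H := H)
    unfold SRep at this
    rw [this]; simp; rfl
  change S.ι (a ⊗ₜ[k] 1) * _ = _
  rw [S.ι_mul a b 1 h _ _ _ _ h3 hv]
  simp only [Finset.univ_unique, Finset.sum_singleton, S.one_act, (S.f_normal _).2, one_mul]
  rw [← map_sum]
  congr 1
  conv_rhs => rw [← SRep_counit_left hv, TensorProduct.tmul_sum]
  refine Finset.sum_congr rfl fun i _ => ?_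
  rw [mul_smul_comm, mul_one, TensorProduct.smul_tmul]

theorem aE_one : S.aE 1 = 1 := S.ι_one
theorem hE_one : S.hE 1 = 1 := S.ι_one

theorem aE_mul_aE (a b : A) : S.aE a * S.aE b = S.aE (a * b) := S.aE_mul a b 1

theorem aE_mul_hE (a : A) (h : H) : S.aE a * S.hE h = S.ι (a ⊗ₜ[k] h) := by
  have := S.aE_mul a 1 h
  rw [mul_one] at this
  exact this

theorem hE_mul_aE (h : H) (b : A) {N : ℕ} {u : Fin N → Fin 2 → H} (hu : SRep k 1 h N u) :
    S.hE h * S.aE b = ∑ i, S.ι (S.act (u i 0) b ⊗ₜ[k] u i 1) := by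
  obtain ⟨P, w, hw, h3⟩ := SRep_three hu
  change S.ι (1 ⊗ₜ[k] h) * S.ι (b ⊗ₜ[k] 1) = _
  rw [S.iota_mul' 1 b h 1 hu P w hw h3 SRep_one]
  refine Finset.sum_congr rfl fun i _ => ?_
  simp only [Finset.univ_unique, Finset.sum_singleton, (S.f_normal _).1, one_mul, mul_one]
  rw [← map_sum]
  congr 1
  conv_rhs => rw [← SRep_counit_left (hw i), TensorProduct.tmul_sum]
  refine Finset.sum_congr rfl fun i _ => ?_
  rw [mul_smul_comm, mul_one, TensorProduct.smul_tmul]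

theorem hE_mul_hE (h l : H) {N M : ℕ} {u : Fin N → Fin 2 → H} {v : Fin M → Fin 2 → H}
    (hu : SRep k 1 h N u) (hv : SRep k 1 l M v) :
    S.hE h * S.hE l = ∑ i, ∑ j, S.ι (S.f (u i 0) (v j 0) ⊗ₜ[k] (u i 1 * v j 1)) := by
  obtain ⟨P, w, hw, h3⟩ := SRep_three hu
  change S.ι (1 ⊗ₜ[k] h) * S.ι (1 ⊗ₜ[k] l) = _
  rw [S.iota_mul' 1 1 h l hu P w hw h3 hv]
  -- the bilinear functional
  let G : H ⊗[k] H →ₗ[k] E := TensorProduct.lift (LinearMap.mk₂ k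
    (fun x y => ∑ j, S.ι (S.f x (v j 0) ⊗ₜ[k] (y * v j 1)))
    (by intro a b c; simp [TensorProduct.add_tmul, Finset.sum_add_distrib])
    (by intro a b c; simp [← TensorProduct.smul_tmul', Finset.smul_sum])
    (by intro a b c; simp [TensorProduct.tmul_add, add_mul, Finset.sum_add_distrib])
    (by intro a b c; simp [Finset.smul_sum]))
  have hG : ∀ x y, G (x ⊗ₜ[k] y) = ∑ j, S.ι (S.f x (v j 0) ⊗ₜ[k] (y * v j 1)) := fun x y => rfl
  have h1 : ∑ i, ∑ j, S.ι (S.f (u i 0) (v j 0) ⊗ₜ[k] (u i 1 * v j 1)) =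
      G (Coalgebra.comul (R := k) h) := by
    rw [SRep_two hu, map_sum]
    exact Finset.sum_congr rfl fun i _ => (hG _ _).symm
  rw [h1]
  conv_rhs => rw [← SRep_counit_left hu, map_sum, map_sum]
  refine Finset.sum_congr rfl fun i _ => ?_
  rw [map_smul, map_smul, SRep_two (hw i), map_sum, Finset.smul_sum]
  refine Finset.sum_congr rfl fun p _ => ?_
  rw [hG, Finset.smul_sum]
  refine Finset.sum_congr rfl fun j _ => ?_
  rw [S.act_one, one_mul, smul_one_mul, ← TensorProduct.smul_tmul', map_smul]

end CrossedProduct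

end PCross


section PZ

variable {k A H E N : Type} [CommRing k] [Ring A] [Algebra k A] [Ring H] [HopfAlgebra k H]
  [Ring E] [Algebra k E] [AddCommGroup N] [Module k N]

variable (k A H) in
abbrev Zm (n : ℕ) : Type := A ⊗[k] Tpow k H n

namespace CrossedProduct

variable (S : CrossedProduct k A H E)

def zE {n : ℕ} : E →ₗ[k] Tpow k H n →ₗ[k] Zm k A H (n + 1) :=
  (TensorProduct.lift (LinearMap.mk₂ k
    (fun (a : A) (h : H) => (TensorProduct.mk k A (Tpow k H (n + 1)) a) ∘ₗ (tcons (k := k) (n := n) h))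
    (by intro a b c; ext x; simp [TensorProduct.add_tmul])
    (by intro a b c; ext x; simp [TensorProduct.smul_tmul'])
    (by intro a b c; ext x; simp [TensorProduct.tmul_add])
    (by intro a b c; ext x; simp))) ∘ₗ S.ι.symm.toLinearMap

theorem zE_ι {n : ℕ} (a : A) (h : H) (q : Tpow k H n) :
    S.zE (S.ι (a ⊗ₜ[k] h)) q = a ⊗ₜ[k] tcons h q := by
  simp [zE]

def zlift {n : ℕ} (g : E →ₗ[k] Tpow k H n →ₗ[k] N) : Zm k A H (n + 1) →ₗ[k] N :=
  TensorProduct.lift (LinearMap.mk₂ k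
    (fun (a : A) (t : Tpow k H (n + 1)) => tlift (g ∘ₗ S.ι.toLinearMap ∘ₗ TensorProduct.mk k A H a) t)
    (by
      intro a b t
      rw [← LinearMap.add_apply]
      congr 1
      apply tlift_ext
      intro v t
      simp [tlift_tcons, TensorProduct.add_tmul])
    (by
      intro c a t
      rw [← LinearMap.smul_apply]
      congr 1
      apply tlift_ext
      intro v t
      simp [tlift_tcons, ← TensorProduct.smul_tmul'])
    (by intro a b c; rw [map_add])
    (by intro a b c; rw [map_smul]))

theorem zlift_ι {n : ℕ} (g : E →ₗ[k] Tpow k H n →ₗ[k] N) (a : A) (h : H) (q : Tpow k H n) :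
    S.zlift g (a ⊗ₜ[k] tcons h q) = g (S.ι (a ⊗ₜ[k] h)) q := by
  rw [zlift, TensorProduct.lift.tmul, LinearMap.mk₂_apply, tlift_tcons]; rfl

/-- induction on E -/
theorem E_ext {f g : E →ₗ[k] N} (h : ∀ a x, f (S.ι (a ⊗ₜ[k] x)) = g (S.ι (a ⊗ₜ[k] x))) : f = g := by
  have : f ∘ₗ S.ι.toLinearMap = g ∘ₗ S.ι.toLinearMap := TensorProduct.ext' h
  ext x
  have := LinearMap.congr_fun this (S.ι.symm x)
  simpa using this

theorem zlift_zE {n : ℕ} (g : E →ₗ[k] Tpow k H n →ₗ[k] N) (e : E) (q : Tpow k H n) :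
    S.zlift g (S.zE e q) = g e q := by
  have : (LinearMap.compr₂ S.zE (S.zlift g)) = g := by
    apply S.E_ext
    intro a h
    ext q
    rw [LinearMap.compr₂_apply, zE_ι, zlift_ι]
  exact LinearMap.congr_fun₂ this e q

theorem z_ext {n : ℕ} {f g : Zm k A H (n + 1) →ₗ[k] N}
    (h : ∀ e q, f (S.zE e q) = g (S.zE e q)) : f = g := by
  apply TensorProduct.ext'
  intro a q
  have : f ∘ₗ (TensorProduct.mk k A (Tpow k H (n + 1)) a) = g ∘ₗ (TensorProduct.mk k A _ a) := by
    apply tlift_ext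
    intro v t
    have := h (S.ι (a ⊗ₜ[k] v)) t
    rwa [zE_ι] at this
  exact LinearMap.congr_fun this q

def zcons {n : ℕ} : E →ₗ[k] Zm k A H n →ₗ[k] Zm k A H (n + 1) :=
  LinearMap.mk₂ k (fun e z => TensorProduct.lift (LinearMap.mk₂ k
      (fun (a : A) (q : Tpow k H n) => S.zE (e * S.aE a) q)
      (by intro a b c; simp [mul_add]) (by intro a b c; simp)
      (by intro a b c; simp) (by intro a b c; simp)) z)
    (by
      intro a b z; rw [← LinearMap.add_apply]; congr 1
      apply TensorProduct.ext'; intro x y; simp [add_mul])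
    (by
      intro a b z; rw [← LinearMap.smul_apply]; congr 1
      apply TensorProduct.ext'; intro x y; simp)
    (by intro a b c; rw [map_add]) (by intro a b c; rw [map_smul])

theorem zcons_tmul {n : ℕ} (e : E) (a : A) (q : Tpow k H n) :
    S.zcons e (a ⊗ₜ[k] q) = S.zE (e * S.aE a) q := rfl

theorem zcons_one {n : ℕ} (e : E) (q : Tpow k H n) : S.zcons e (1 ⊗ₜ[k] q) = S.zE e q := by
  rw [zcons_tmul, aE_one, mul_one]

theorem z_ext' {n : ℕ} {f g : Zm k A H (n + 1) →ₗ[k] N}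
    (h : ∀ e z, f (S.zcons e z) = g (S.zcons e z)) : f = g := by
  apply S.z_ext
  intro e q
  rw [← zcons_one, h]

def zL {n : ℕ} : E →ₗ[k] Zm k A H (n + 1) →ₗ[k] Zm k A H (n + 1) :=
  LinearMap.mk₂ k (fun e z => S.zlift (LinearMap.lcomp k (Tpow k H n →ₗ[k] Zm k A H (n + 1))
      (LinearMap.mulLeft k e) S.zE) z)
    (by
      intro a b z; rw [← LinearMap.add_apply]; congr 1
      apply S.z_ext; intro x y; simp [zlift_zE, add_mul])
    (by
      intro a b z; rw [← LinearMap.smul_apply]; congr 1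
      apply S.z_ext; intro x y; simp [zlift_zE])
    (by intro a b c; rw [map_add]) (by intro a b c; rw [map_smul])

theorem zL_zE {n : ℕ} (e e' : E) (q : Tpow k H n) : S.zL e (S.zE e' q) = S.zE (e * e') q := by
  rw [zL, LinearMap.mk₂_apply, zlift_zE]; rfl

theorem zL_zcons {n : ℕ} (e e' : E) (z : Zm k A H n) :
    S.zL e (S.zcons e' z) = S.zcons (e * e') z := by
  have : S.zL e ∘ₗ S.zcons e' = S.zcons (n := n) (e * e') := by
    apply TensorProduct.ext'
    intro a q
    rw [LinearMap.comp_apply, zcons_tmul, zL_zE, zcons_tmul, mul_assoc]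
  exact LinearMap.congr_fun this z

theorem zL_zL {n : ℕ} (e e' : E) (z : Zm k A H (n + 1)) :
    S.zL e (S.zL e' z) = S.zL (e * e') z := by
  have : S.zL e ∘ₗ S.zL e' = S.zL (n := n) (e * e') := by
    apply S.z_ext
    intro a q
    rw [LinearMap.comp_apply, zL_zE, zL_zE, zL_zE, mul_assoc]
  exact LinearMap.congr_fun this z

theorem zL_one {n : ℕ} (z : Zm k A H (n + 1)) : S.zL 1 z = z := by
  have : S.zL (n := n) 1 = LinearMap.id := by
    apply S.z_ext
    intro a q
    rw [zL_zE, one_mul]; rfl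
  exact LinearMap.congr_fun this z

theorem zL_aE {n : ℕ} (a b : A) (q : Tpow k H (n + 1)) :
    S.zL (S.aE a) (b ⊗ₜ[k] q) = (a * b) ⊗ₜ[k] q := by
  have : S.zL (S.aE a) ∘ₗ TensorProduct.mk k A (Tpow k H (n + 1)) b = TensorProduct.mk k A (Tpow k H (n + 1)) (a * b) := by
    apply tlift_ext
    intro h q
    rw [LinearMap.comp_apply, TensorProduct.mk_apply, TensorProduct.mk_apply, ← S.zE_ι, zL_zE,
      aE_mul, zE_ι]
  exact LinearMap.congr_fun this q

theorem zcons_aE {n : ℕ} (e : E) (a : A) (z : Zm k A H (n + 1)) :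
    S.zcons (e * S.aE a) z = S.zcons e (S.zL (S.aE a) z) := by
  have : S.zcons (e * S.aE a) = S.zcons (n := n + 1) e ∘ₗ (S.zL (S.aE a)) := by
    apply TensorProduct.ext'
    intro b q
    rw [LinearMap.comp_apply, zL_aE, zcons_tmul, zcons_tmul, mul_assoc, aE_mul_aE]
  exact LinearMap.congr_fun this z

def zb : ∀ n : ℕ, Zm k A H (n + 2) →ₗ[k] Zm k A H (n + 1)
  | 0 => S.zlift (LinearMap.compl₂ S.zL (TensorProduct.mk k A (Tpow k H 1) 1))
  | n + 1 => S.zlift (LinearMap.compl₂ S.zL (TensorProduct.mk k A (Tpow k H (n + 2)) 1)) -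
      S.zlift (LinearMap.compl₂ S.zcons ((zb n) ∘ₗ TensorProduct.mk k A (Tpow k H (n + 2)) 1))

theorem zb_zero_zE (e : E) (q : Tpow k H 1) : S.zb 0 (S.zE e q) = S.zL e (1 ⊗ₜ[k] q) := by
  rw [zb, zlift_zE]; rfl

theorem zb_succ_zE (n : ℕ) (e : E) (q : Tpow k H (n + 2)) :
    S.zb (n + 1) (S.zE e q) = S.zL e (1 ⊗ₜ[k] q) - S.zcons e (S.zb n (1 ⊗ₜ[k] q)) := by
  rw [zb, LinearMap.sub_apply, zlift_zE, zlift_zE]; rfl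

theorem zb_zL : ∀ (n : ℕ) (e : E) (z : Zm k A H (n + 2)), S.zb n (S.zL e z) = S.zL e (S.zb n z) := by
  intro n e z
  have : S.zb n ∘ₗ S.zL e = S.zL e ∘ₗ S.zb n := by
    apply S.z_ext
    intro e' q
    rw [LinearMap.comp_apply, LinearMap.comp_apply, zL_zE]
    cases n with
    | zero => rw [zb_zero_zE, zb_zero_zE, zL_zL]
    | succ n => rw [zb_succ_zE, zb_succ_zE, map_sub, zL_zL, zL_zcons]
  exact LinearMap.congr_fun this z

theorem zb_zero_zcons (e : E) (z : Zm k A H 1) : S.zb 0 (S.zcons e z) = S.zL e z := by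
  have : S.zb 0 ∘ₗ S.zcons e = S.zL e := by
    apply TensorProduct.ext'
    intro a q
    rw [LinearMap.comp_apply, zcons_tmul, zb_zero_zE, ← zL_zL, zL_aE, mul_one]
  exact LinearMap.congr_fun this z

theorem zb_succ_zcons (n : ℕ) (e : E) (z : Zm k A H (n + 2)) :
    S.zb (n + 1) (S.zcons e z) = S.zL e z - S.zcons e (S.zb n z) := by
  have : S.zb (n + 1) ∘ₗ S.zcons e = S.zL e - S.zcons e ∘ₗ S.zb n := by
    apply TensorProduct.ext'
    intro a q
    rw [LinearMap.comp_apply, zcons_tmul, zb_succ_zE, ← zL_zL, zL_aE, mul_one, zcons_aE, ← zb_zL,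
      zL_aE, mul_one]
    rfl
  exact LinearMap.congr_fun this z

theorem zb_zb : ∀ (n : ℕ) (z : Zm k A H (n + 3)), S.zb n (S.zb (n + 1) z) = 0 := by
  intro n
  induction n with
  | zero =>
    intro z
    have : S.zb 0 ∘ₗ S.zb 1 = 0 := by
      apply S.z_ext'
      intro e z
      rw [LinearMap.comp_apply, zb_succ_zcons, map_sub, zb_zL, zb_zero_zcons, sub_self]; rfl
    exact LinearMap.congr_fun this z
  | succ n ih =>
    intro z
    have : S.zb (n + 1) ∘ₗ S.zb (n + 2) = 0 := by
      apply S.z_ext'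
      intro e z
      rw [LinearMap.comp_apply, zb_succ_zcons, map_sub, zb_zL, zb_succ_zcons, ih, map_zero, sub_zero,
        sub_self]; rfl
    exact LinearMap.congr_fun this z

def zR (e : E) : ∀ n : ℕ, Zm k A H (n + 1) →ₗ[k] Zm k A H (n + 1)
  | 0 => S.zlift (LinearMap.lcomp k (Tpow k H 0 →ₗ[k] Zm k A H 1) (LinearMap.mulRight k e) S.zE)
  | n + 1 => S.zlift (LinearMap.compl₂ S.zcons (zR e n ∘ₗ TensorProduct.mk k A (Tpow k H (n + 1)) 1))

theorem zR_zero (e e' : E) (q : Tpow k H 0) : S.zR e 0 (S.zE e' q) = S.zE (e' * e) q := by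
  rw [zR, zlift_zE]; rfl

theorem zR_succ_zE (e e' : E) (n : ℕ) (q : Tpow k H (n + 1)) :
    S.zR e (n + 1) (S.zE e' q) = S.zcons e' (S.zR e n (1 ⊗ₜ[k] q)) := by
  rw [zR, zlift_zE]; rfl

theorem zR_zL (n : ℕ) (e e' : E) (z : Zm k A H (n + 1)) :
    S.zR e n (S.zL e' z) = S.zL e' (S.zR e n z) := by
  have : S.zR e n ∘ₗ S.zL e' = S.zL e' ∘ₗ S.zR e n := by
    apply S.z_ext
    intro x q
    rw [LinearMap.comp_apply, LinearMap.comp_apply, zL_zE]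
    cases n with
    | zero => rw [zR_zero, zR_zero, zL_zE, mul_assoc]
    | succ n => rw [zR_succ_zE, zR_succ_zE, zL_zcons]
  exact LinearMap.congr_fun this z

theorem zR_zcons (n : ℕ) (e e' : E) (z : Zm k A H (n + 1)) :
    S.zR e (n + 1) (S.zcons e' z) = S.zcons e' (S.zR e n z) := by
  have : S.zR e (n + 1) ∘ₗ S.zcons e' = S.zcons e' ∘ₗ S.zR e n := by
    apply TensorProduct.ext'
    intro a q
    rw [LinearMap.comp_apply, zcons_tmul, zR_succ_zE, zcons_aE, ← zR_zL, zL_aE, mul_one]; rfl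
  exact LinearMap.congr_fun this z

theorem zb_zR : ∀ (n : ℕ) (e : E) (z : Zm k A H (n + 2)),
    S.zb n (S.zR e (n + 1) z) = S.zR e n (S.zb n z) := by
  intro n e
  induction n with
  | zero =>
    intro z
    have : S.zb 0 ∘ₗ S.zR e 1 = S.zR e 0 ∘ₗ S.zb 0 := by
      apply S.z_ext'
      intro e' z
      rw [LinearMap.comp_apply, LinearMap.comp_apply, zb_zero_zcons, zR_zL, zR_zcons, zb_zero_zcons]
    exact LinearMap.congr_fun this z
  | succ n ih =>
    intro z
    have : S.zb (n + 1) ∘ₗ S.zR e (n + 2) = S.zR e (n + 1) ∘ₗ S.zb (n + 1) := by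
      apply S.z_ext'
      intro e' z
      rw [LinearMap.comp_apply, LinearMap.comp_apply, zb_succ_zcons, map_sub, zR_zL, zR_zcons,
        zR_zcons, zb_succ_zcons, ih]
    exact LinearMap.congr_fun this z

end CrossedProduct

end PZ


section PY

variable {k A H E N : Type} [CommRing k] [Ring A] [Algebra k A] [Ring H] [HopfAlgebra k H]
  [Ring E] [Algebra k E] [AddCommGroup N] [Module k N]

theorem sum_cons {N : Type} [AddCommGroup N] {n : ℕ} (Nv : Fin (n + 1) → ℕ)
    (g : (∀ i, Fin (Nv i)) → N) :
    ∑ c, g c = ∑ i : Fin (Nv 0), ∑ c' : (∀ i : Fin n, Fin (Nv i.succ)), g (Fin.cons i c') := by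
  rw [← (Fin.consEquiv (fun i => Fin (Nv i))).sum_comp, Fintype.sum_prod_type]
  rfl

def split : ∀ n : ℕ, Tpow k H (n + 1) →ₗ[k] Tpow k (Qbar k H) n ⊗[k] H
  | 0 => tlift (tlift0 (k := k) (V := H)
      (TensorProduct.mk k (Tpow k (Qbar k H) 0) H (tone (k := k) (V := Qbar k H)))).flip
  | n + 1 => tlift (LinearMap.lcomp k (Tpow k (Qbar k H) (n + 1) ⊗[k] H) (split n) ∘ₗ
      LinearMap.rTensorHom H ∘ₗ tcons (k := k) (n := n) ∘ₗ qbar k H)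

theorem split_zero (h : H) : split 0 (tcons h tone) = (tone (k := k) (V := Qbar k H)) ⊗ₜ[k] h := by
  rw [split, tlift_tcons, LinearMap.flip_apply, tlift0_tone]; rfl

theorem split_succ (n : ℕ) (h : H) (q : Tpow k H (n + 1)) :
    split (n + 1) (tcons h q) = LinearMap.rTensor H (tcons (k := k) (qbar k H h)) (split n q) := by
  rw [split, tlift_tcons]; rfl

theorem split_tsnoc (l : H) : ∀ (n : ℕ) (q : Tpow k H n),
    split n (tsnoc l n q) = tpQ k n q ⊗ₜ[k] l := by
  intro n
  induction n with
  | zero =>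
    intro q
    have : split 0 ∘ₗ tsnoc l 0 = (TensorProduct.mk k _ H).flip l ∘ₗ tpQ k 0 := by
      apply tzero_ext
      rw [LinearMap.comp_apply, tsnoc, tlift0_tone, split_zero]; rfl
    exact LinearMap.congr_fun this q
  | succ n ih =>
    intro q
    have : split (n + 1) ∘ₗ tsnoc l (n + 1) = (TensorProduct.mk k _ H).flip l ∘ₗ tpQ k (n + 1) := by
      apply tlift_ext
      intro v t
      rw [LinearMap.comp_apply, tsnoc_tcons, split_succ, ih]; rfl
    exact LinearMap.congr_fun this q

theorem split_tp {n : ℕ} (x : Fin n → H) (l : H) :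
    split n (tp k (Fin.snoc x l : Fin (n + 1) → H)) = tp k (fun i => qbar k H (x i)) ⊗ₜ[k] l := by
  rw [← tsnoc_tp, split_tsnoc, tpQ_tp]

theorem y_ext {s : ℕ} {f g : Yc k H E s →ₗ[k] N}
    (h : ∀ e (hs : Fin s → H) x, f (ygen e hs x) = g (ygen e hs x)) : f = g := by
  apply TensorProduct.ext'
  intro e t
  have : f ∘ₗ TensorProduct.mk k E (Tpow k (Qbar k H) s ⊗[k] H) e =
      g ∘ₗ TensorProduct.mk k E (Tpow k (Qbar k H) s ⊗[k] H) e := by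
    apply TensorProduct.ext'
    intro t x
    have : f ∘ₗ TensorProduct.mk k E (Tpow k (Qbar k H) s ⊗[k] H) e ∘ₗ
        (TensorProduct.mk k (Tpow k (Qbar k H) s) H).flip x =
      g ∘ₗ TensorProduct.mk k E (Tpow k (Qbar k H) s ⊗[k] H) e ∘ₗ
        (TensorProduct.mk k (Tpow k (Qbar k H) s) H).flip x := by
      apply tpow_ext (qbar k H) qbar_surj
      intro hs
      exact h e hs x
    exact LinearMap.congr_fun this t
  exact LinearMap.congr_fun this t

namespace CrossedProduct

variable (S : CrossedProduct k A H E)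

def Yof (s : ℕ) : Zm k A H (s + 2) →ₗ[k] Yc k H E s :=
  S.zlift (LinearMap.compl₂ (TensorProduct.mk k E (Tpow k (Qbar k H) s ⊗[k] H)) (split s))

theorem Yof_zE {s : ℕ} (e : E) (q : Tpow k H (s + 1)) :
    S.Yof s (S.zE e q) = e ⊗ₜ[k] split s q := by
  rw [Yof, zlift_zE]; rfl

theorem Yof_gen {s : ℕ} (e : E) (hs : Fin s → H) (h : H) :
    S.Yof s (S.zE e (tp k (Fin.snoc hs h : Fin (s + 1) → H))) = ygen e hs h := by
  rw [Yof_zE, split_tp]; rfl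

theorem y_ext' {s : ℕ} {f g : Yc k H E s →ₗ[k] N}
    (h : ∀ z, f (S.Yof s z) = g (S.Yof s z)) : f = g := by
  apply y_ext
  intro e hs x
  rw [← S.Yof_gen, h]

def PZ : ∀ {s : ℕ} (_ : Fin s → H) (_ : E), Zm k A H (s + 1)
  | 0, _, e => S.zE e tone
  | _ + 1, hs, e => S.zcons (S.hE (hs 0)) (PZ (fun i => hs i.succ) e)

theorem PZ_one : ∀ {s : ℕ} (hs : Fin s → H),
    S.PZ hs 1 = 1 ⊗ₜ[k] tp k (Fin.snoc hs 1 : Fin (s + 1) → H)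
  | 0, hs => by
    rw [PZ, ← S.ι_one, zE_ι]; rfl
  | s + 1, hs => by
    rw [PZ, PZ_one, zcons_one, tp_succ (Fin.snoc hs 1 : Fin (s + 2) → H), snoc_fun_succ, snoc_fun_zero]
    exact S.zE_ι _ _ _

theorem PZ_sum : ∀ {s : ℕ} (hs : Fin s → H) (b : A) (h' : H)
    (Nv : Fin s → ℕ) (v : ∀ i, Fin (Nv i) → Fin 2 → H) (_ : ∀ i, SRep k 1 (hs i) (Nv i) (v i)),
    S.PZ hs (S.ι (b ⊗ₜ[k] h')) = ∑ c : (∀ i, Fin (Nv i)),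
      (iterAct k S.act (fun i => v i (c i) 0) b) ⊗ₜ[k]
        tp k (Fin.snoc (fun i => v i (c i) 1) h' : Fin (s + 1) → H)
  | 0, hs, b, h', Nv, v, _ => by
    rw [PZ, zE_ι, Finset.univ_unique, Finset.sum_singleton]; rfl
  | s + 1, hs, b, h', Nv, v, hv => by
    rw [PZ, PZ_sum _ b h' _ (fun i => v i.succ) (fun i => hv i.succ), sum_cons, Finset.sum_comm, map_sum]
    refine Finset.sum_congr rfl fun c _ => ?_
    rw [zcons_tmul, S.hE_mul_aE _ _ (hv 0), map_sum, LinearMap.sum_apply]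
    refine Finset.sum_congr rfl fun i _ => ?_
    rw [zE_ι, tp_succ (Fin.snoc _ h' : Fin (s + 2) → H), snoc_fun_succ, snoc_fun_zero]
    rfl

theorem zcons_ι {n : ℕ} (a : A) (h : H) (z : Zm k A H n) :
    S.zcons (S.ι (a ⊗ₜ[k] h)) z = S.zL (S.aE a) (S.zcons (S.hE h) z) := by
  rw [zL_zcons, aE_mul_hE]

def zmid : ∀ (i n : ℕ) (_ : A) (_ : Fin (n + 2) → H), Zm k A H (n + 1)
  | 0, _, a, x => S.zE (S.ι (a ⊗ₜ[k] x 0) * S.hE (x 1)) (tp k fun j => x j.succ.succ)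
  | _ + 1, 0, _, _ => 0
  | i + 1, n + 1, a, x => S.zcons (S.ι (a ⊗ₜ[k] x 0)) (zmid i n 1 (fun j => x j.succ))

theorem zb_tp : ∀ (n : ℕ) (a : A) (x : Fin (n + 2) → H),
    S.zb n (a ⊗ₜ[k] tp k x) = ∑ i ∈ Finset.range (n + 1), ((-1 : ℤ) ^ i) • S.zmid i n a x := by
  intro n
  induction n with
  | zero =>
    intro a x
    rw [tp_succ x, ← S.zE_ι, zb_zero_zE, tp_succ, ← S.zE_ι, zL_zE]
    simp [zmid]; rfl
  | succ n ih =>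
    intro a x
    rw [Finset.sum_range_succ', tp_succ x, ← S.zE_ι, zb_succ_zE, ih, tp_succ, ← S.zE_ι, zL_zE, map_sum,
      sub_eq_neg_add, ← Finset.sum_neg_distrib]
    congr 1
    · refine Finset.sum_congr rfl fun i _ => ?_
      rw [map_zsmul, pow_succ, mul_neg_one, neg_smul]; rfl
    · rw [pow_zero, one_smul]; rfl

theorem zmid_snoc : ∀ (i n : ℕ) (_ : i < n + 1) (a : A) (x : Fin (n + 2) → H) (l : H),
    S.zmid i (n + 1) a (Fin.snoc x l : Fin (n + 3) → H) =
      LinearMap.lTensor A (tsnoc l (n + 1)) (S.zmid i n a x) := by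
  have key : ∀ (n : ℕ) (l : H) (e : E) (q : Tpow k H n),
      LinearMap.lTensor A (tsnoc l (n + 1)) (S.zE e q) = S.zE e (tsnoc l n q) := by
    intro n l e q
    have : LinearMap.compr₂ S.zE (LinearMap.lTensor A (tsnoc l (n + 1))) =
        LinearMap.compl₂ S.zE (tsnoc l n) := by
      apply S.E_ext
      intro a h
      ext q
      rw [LinearMap.compr₂_apply, LinearMap.compl₂_apply, zE_ι, zE_ι, LinearMap.lTensor_tmul,
        tsnoc_tcons]
    exact LinearMap.congr_fun₂ this e q
  have key2 : ∀ (n : ℕ) (l : H) (e : E) (z : Zm k A H n),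
      LinearMap.lTensor A (tsnoc l (n + 1)) (S.zcons e z) =
        S.zcons e (LinearMap.lTensor A (tsnoc l n) z) := by
    intro n l e z
    have : LinearMap.lTensor A (tsnoc l (n + 1)) ∘ₗ (S.zcons e) =
        S.zcons e ∘ₗ (LinearMap.lTensor A (tsnoc l n)) := by
      apply TensorProduct.ext'
      intro a q
      rw [LinearMap.comp_apply, LinearMap.comp_apply, LinearMap.lTensor_tmul, zcons_tmul, key, zcons_tmul]
    exact LinearMap.congr_fun this z
  intro i
  induction i with
  | zero =>
    intro n _ a x l
    rw [zmid, zmid, key, tsnoc_tp, snoc_fun_zero]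
    have h1 : (Fin.snoc x l : Fin (n + 3) → H) 1 = x 1 := by
      have := congrFun (snoc_fun_succ x l) 0
      rw [snoc_fun_zero] at this
      exact this
    have h2 : (fun j : Fin (n + 1) => (Fin.snoc x l : Fin (n + 3) → H) j.succ.succ) =
        Fin.snoc (fun j => x j.succ.succ) l := by
      have := snoc_fun_succ (fun j => x j.succ) l
      rw [← snoc_fun_succ x l] at this
      exact this
    rw [h1, h2]
  | succ i ih =>
    intro n hi a x l
    cases n with
    | zero => omega
    | succ n =>
      rw [zmid, zmid, key2, snoc_fun_zero, snoc_fun_succ, ih n (by omega)]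

theorem zmid_last : ∀ (n : ℕ) (a : A) (x : Fin (n + 1) → H),
    S.zmid n n a (Fin.snoc x 1 : Fin (n + 2) → H) = a ⊗ₜ[k] tp k x := by
  intro n
  induction n with
  | zero =>
    intro a x
    have h1 : (Fin.snoc x 1 : Fin 2 → H) 1 = 1 := rfl
    rw [zmid, snoc_fun_zero, h1, hE_one, mul_one, zE_ι, tp_succ x]; rfl
  | succ n ih =>
    intro a x
    rw [zmid, snoc_fun_zero, snoc_fun_succ, ih, zcons_one, zE_ι, tp_succ x]

theorem zmid_sum : ∀ (i n : ℕ) (hi : i < n + 1) (a : A) (x : Fin (n + 2) → H)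
    (Nv : Fin (n + 2) → ℕ) (v : ∀ j, Fin (Nv j) → Fin 2 → H) (_ : ∀ j, SRep k 1 (x j) (Nv j) (v j)),
    S.zmid i n a x = ∑ c : (∀ j : Fin (i + 2), Fin (Nv ⟨(j : ℕ), by have := j.isLt; omega⟩)),
      (a * iterAct k S.act (fun j : Fin i => v ⟨(j : ℕ), by have := j.isLt; omega⟩
          (c ⟨(j : ℕ), by have := j.isLt; omega⟩) 0)
        (S.f (v ⟨i, by omega⟩ (c ⟨i, by omega⟩) 0)
          (v ⟨i + 1, by omega⟩ (c ⟨i + 1, by omega⟩) 0))) ⊗ₜ[k]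
      tp k (fun p : Fin (n + 1) =>
        if hp : (p : ℕ) < i then
          v ⟨(p : ℕ), by have := p.isLt; omega⟩ (c ⟨(p : ℕ), by omega⟩) 1
        else if hp' : (p : ℕ) = i then
          (v ⟨(p : ℕ), by have := p.isLt; omega⟩ (c ⟨(p : ℕ), by omega⟩) 1) *
            (v ⟨(p : ℕ) + 1, by have := p.isLt; omega⟩ (c ⟨(p : ℕ) + 1, by omega⟩) 1)
        else x ⟨(p : ℕ) + 1, by have := p.isLt; omega⟩) := by
  intro i
  induction i with
  | zero =>
    intro n hi a x Nv v hv
    rw [sum_cons (fun j : Fin 2 => Nv ⟨(j : ℕ), by have := j.isLt; omega⟩)]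
    rw [zmid, ← aE_mul_hE, mul_assoc, S.hE_mul_hE _ _ (hv 0) (hv 1), Finset.mul_sum, map_sum,
      LinearMap.sum_apply]
    refine Finset.sum_congr rfl fun p _ => ?_
    rw [sum_cons (fun j : Fin 1 => Nv ⟨(j.succ : ℕ), by have := j.isLt; omega⟩), Finset.mul_sum, map_sum,
      LinearMap.sum_apply]
    refine Finset.sum_congr rfl fun q _ => ?_
    rw [Finset.univ_unique, Finset.sum_singleton, aE_mul, zE_ι, tp_succ (n := n)]
    rfl
  | succ i ih =>
    intro n hi a x Nv v hv
    cases n with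
    | zero => omega
    | succ n =>
      rw [sum_cons (fun j : Fin (i + 3) => Nv ⟨(j : ℕ), by have := j.isLt; omega⟩), Finset.sum_comm]
      rw [zmid, ih n (by omega) 1 _ (fun j => Nv j.succ) (fun j => v j.succ) (fun j => hv j.succ), map_sum]
      refine Finset.sum_congr rfl fun c _ => ?_
      rw [zcons_tmul, one_mul, ← aE_mul_hE, mul_assoc, S.hE_mul_aE _ _ (hv 0), Finset.mul_sum, map_sum,
        LinearMap.sum_apply]
      refine Finset.sum_congr rfl fun q _ => ?_
      rw [aE_mul, zE_ι, tp_succ (n := n + 1)]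
      congr 3
      funext p
      simp only [Fin.val_succ, Nat.add_lt_add_iff_right, Nat.add_right_cancel_iff]
      rfl

end CrossedProduct

end PY


section PR

variable {k A H E N : Type} [CommRing k] [Ring A] [Algebra k A] [Ring H] [HopfAlgebra k H]
  [Ring E] [Algebra k E] [AddCommGroup N] [Module k N]

theorem x_ext {r s : ℕ} {f g : Xc k A H E r s →ₗ[k] N}
    (h : ∀ e (hs : Fin s → H) (as : Fin r → A) e', f (xgen e hs as e') = g (xgen e hs as e')) : f = g := by
  apply TensorProduct.ext'
  intro e t
  have h1 : f ∘ₗ TensorProduct.mk k E (Tpow k (Qbar k H) s ⊗[k] (Tpow k (Qbar k A) r ⊗[k] E)) e =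
      g ∘ₗ TensorProduct.mk k E (Tpow k (Qbar k H) s ⊗[k] (Tpow k (Qbar k A) r ⊗[k] E)) e := by
    apply TensorProduct.ext
    apply tpow_ext (qbar k H) qbar_surj
    intro hs
    apply TensorProduct.ext
    apply tpow_ext (qbar k A) qbar_surj
    intro as
    ext e'
    exact h e hs as e'
  exact LinearMap.congr_fun h1 t

def xg {r s : ℕ} (hs : Fin s → H) (as : Fin r → A) : E →ₗ[k] E →ₗ[k] Xc k A H E r s :=
  LinearMap.compl₂ (TensorProduct.mk k E _)
    ((TensorProduct.mk k (Tpow k (Qbar k H) s) (Tpow k (Qbar k A) r ⊗[k] E)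
      (tp k (fun i => qbar k H (hs i)))) ∘ₗ TensorProduct.mk k (Tpow k (Qbar k A) r) E
      (tp k (fun i => qbar k A (as i))))

theorem xg_apply {r s : ℕ} (hs : Fin s → H) (as : Fin r → A) (e e' : E) :
    xg (k := k) hs as e e' = xgen e hs as e' := rfl

theorem lX_xgen {r s : ℕ} (x e : E) (hs : Fin s → H) (as : Fin r → A) (e' : E) :
    lX (k := k) x (xgen e hs as e') = xgen (x * e) hs as e' := rfl

theorem rX_xgen {r s : ℕ} (x e : E) (hs : Fin s → H) (as : Fin r → A) (e' : E) :
    rX (k := k) x (xgen e hs as e') = xgen e hs as (e' * x) := rfl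

theorem xgen_eq {r s : ℕ} (e : E) (hs : Fin s → H) (as : Fin r → A) (e' : E) :
    (xgen e hs as e' : Xc k A H E r s) = lX e (rX e' (xgen 1 hs as 1)) := by
  rw [rX_xgen, lX_xgen, mul_one, one_mul]

namespace CrossedProduct

variable (S : CrossedProduct k A H E)

theorem E_ext₂ {f g : E →ₗ[k] E →ₗ[k] N}
    (h : ∀ a x b y, f (S.ι (a ⊗ₜ[k] x)) (S.ι (b ⊗ₜ[k] y)) = g (S.ι (a ⊗ₜ[k] x)) (S.ι (b ⊗ₜ[k] y))) :
    f = g := by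
  apply S.E_ext
  intro a x
  apply S.E_ext
  intro b y
  exact h a x b y

theorem x_ext₂ {r s : ℕ} {f g : Xc k A H E r s →ₗ[k] N}
    (h : ∀ a₀ h₀ (hs : Fin s → H) (as : Fin r → A) b h',
      f (xgen (S.ι (a₀ ⊗ₜ[k] h₀)) hs as (S.ι (b ⊗ₜ[k] h'))) =
      g (xgen (S.ι (a₀ ⊗ₜ[k] h₀)) hs as (S.ι (b ⊗ₜ[k] h')))) : f = g := by
  apply x_ext
  intro e hs as e'
  have : LinearMap.compr₂ (xg hs as) f = LinearMap.compr₂ (xg hs as) g := by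
    apply S.E_ext₂
    intro a x b y
    exact h a x hs as b y
  exact LinearMap.congr_fun₂ this e e'

def PZl : ∀ {s : ℕ} (_ : Fin s → H), E →ₗ[k] Zm k A H (s + 1)
  | 0, _ => S.zE.flip tone
  | _ + 1, hs => S.zcons (S.hE (hs 0)) ∘ₗ PZl (fun i => hs i.succ)

theorem PZl_apply : ∀ {s : ℕ} (hs : Fin s → H) (e : E), S.PZl hs e = S.PZ hs e
  | 0, _, _ => rfl
  | s + 1, hs, e => by rw [PZl, LinearMap.comp_apply, PZl_apply, PZ]

theorem zR_PZ : ∀ {s : ℕ} (hs : Fin s → H) (e e' : E), S.zR e s (S.PZ hs e') = S.PZ hs (e' * e)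
  | 0, _, _, _ => by rw [PZ, PZ, zR_zero]
  | s + 1, hs, e, e' => by rw [PZ, PZ, zR_zcons, zR_PZ]

theorem Yof_tp {s : ℕ} (a : A) (y : Fin (s + 2) → H) :
    S.Yof s (a ⊗ₜ[k] tp k y) =
      ygen (S.ι (a ⊗ₜ[k] y 0)) (fun p : Fin s => y p.castSucc.succ) (y (Fin.last (s + 1))) := by
  rw [tp_succ y, ← S.zE_ι, ← S.Yof_gen]
  congr 3
  funext p
  refine Fin.lastCases ?_ (fun j => ?_) p
  · rw [Fin.snoc_last]; rfl
  · rw [Fin.snoc_castSucc]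

theorem z_ext_tp {n : ℕ} {f g : Zm k A H n →ₗ[k] N}
    (h : ∀ a (x : Fin n → H), f (a ⊗ₜ[k] tp k x) = g (a ⊗ₜ[k] tp k x)) : f = g := by
  apply TensorProduct.ext
  ext a : 1
  apply tpow_ext LinearMap.id Function.surjective_id
  exact h a

end CrossedProduct

namespace ResData

variable {S : CrossedProduct k A H E} (R : ResData k A H E S)

theorem mu_Yof {s : ℕ} (e : E) (hs : Fin s → H) (as : Fin 0 → A) (e' : E) :
    R.mu s (xgen e hs as e') = S.Yof s (S.zcons e (S.PZ hs e')) := by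
  have : LinearMap.compr₂ (xg hs as) (R.mu s) =
      LinearMap.compr₂ (LinearMap.compl₂ S.zcons (S.PZl hs)) (S.Yof s) := by
    apply S.E_ext₂
    intro a₀ h₀ b h'
    rw [LinearMap.compr₂_apply, LinearMap.compr₂_apply, LinearMap.compl₂_apply, S.PZl_apply]
    choose Nv v hv using fun i => exists_SRep (k := k) 1 ((Fin.cons h₀ hs : Fin (s + 1) → H) i)
    refine (R.mu_eq s a₀ h₀ hs b h' Nv v hv).trans ?_
    have h1 : S.zcons (S.hE h₀) (S.PZ hs (S.ι (b ⊗ₜ[k] h'))) =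
        S.PZ (Fin.cons h₀ hs : Fin (s + 1) → H) (S.ι (b ⊗ₜ[k] h')) := rfl
    rw [S.zcons_ι, h1, S.PZ_sum _ b h' Nv v hv, map_sum, map_sum]
    refine Finset.sum_congr rfl fun c _ => ?_
    rw [S.zL_aE, S.Yof_tp, Fin.snoc_last, snoc_fun_zero]
    congr 1
    funext p
    rw [Fin.succ_castSucc, Fin.snoc_castSucc]
  have := LinearMap.congr_fun₂ this e e'
  rwa [LinearMap.compr₂_apply, LinearMap.compr₂_apply, LinearMap.compl₂_apply, S.PZl_apply] at this

theorem del_Yof (s : ℕ) (z : Zm k A H (s + 3)) :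
    R.del s (S.Yof (s + 1) z) = - S.Yof s (S.zb (s + 1) z) := by
  have : R.del s ∘ₗ S.Yof (s + 1) = - S.Yof s ∘ₗ S.zb (s + 1) := by
    apply CrossedProduct.z_ext_tp
    intro a x
    obtain ⟨h₀, x, rfl⟩ : ∃ h₀ y, x = (Fin.cons h₀ y : Fin (s + 3) → H) :=
      ⟨x 0, fun i => x i.succ, (Fin.cons_self_tail x).symm⟩
    obtain ⟨hs, h', rfl⟩ : ∃ hs h', x = (Fin.snoc hs h' : Fin (s + 2) → H) :=
      ⟨fun i => x i.castSucc, x (Fin.last _), (Fin.snoc_init_self x).symm⟩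
    choose Nv v hv using fun i => exists_SRep (k := k) 1 ((Fin.cons h₀ (Fin.snoc hs h') : Fin (s + 3) → H) i)
    rw [LinearMap.comp_apply, LinearMap.neg_apply, LinearMap.comp_apply]
    have h1 : S.Yof (s + 1) (a ⊗ₜ[k] tp k (Fin.cons h₀ (Fin.snoc hs h') : Fin (s + 3) → H)) =
        ygen (S.ι (a ⊗ₜ[k] h₀)) hs h' := by
      rw [S.Yof_tp]
      congr 1
      · funext p
        rw [Fin.cons_succ, Fin.snoc_castSucc]
      · rw [← Fin.succ_last, Fin.cons_succ, Fin.snoc_last]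
    rw [h1, R.del_eq s a h₀ hs h' Nv v hv, S.zb_tp, Finset.sum_range, map_sum, ← Finset.sum_neg_distrib]
    refine Finset.sum_congr rfl fun i _ => ?_
    rw [map_zsmul, pow_succ, mul_neg_one, neg_smul, S.zmid_sum i (s + 1) i.isLt a _ Nv v hv, map_sum]
    congr 2
    refine Finset.sum_congr rfl fun c _ => ?_
    rw [S.Yof_tp]
    congr 1
    · congr 2
      by_cases h0 : (i : ℕ) = 0
      · rw [if_pos h0, dif_neg (by rw [h0]; simp), dif_pos (by rw [h0]; rfl)]
        rfl
      · rw [if_neg h0, dif_pos (by simp only [Fin.val_zero]; omega)]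
        rfl
    · by_cases h0 : (i : ℕ) = s + 1
      · rw [dif_pos h0, dif_neg (by rw [h0]; simp), dif_pos (by rw [h0]; rfl)]
        rfl
      · rw [dif_neg h0, dif_neg (by have := i.isLt; rw [Fin.val_last]; omega),
          dif_neg (by rw [Fin.val_last]; omega)]
        rfl
  exact LinearMap.congr_fun this z

end ResData

end PR


section PRow

variable {k A H E N : Type} [CommRing k] [Ring A] [Algebra k A] [Ring H] [HopfAlgebra k H]
  [Ring E] [Algebra k E] [AddCommGroup N] [Module k N]

theorem mulAt_snoc {r : ℕ} (as : Fin (r + 1) → A) (b : A) (i : Fin r) :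
    mulAt (Fin.snoc as b : Fin (r + 2) → A) i.castSucc = Fin.snoc (mulAt as i) b := by
  funext j
  refine Fin.lastCases ?_ (fun j => ?_) j
  · have := i.isLt
    rw [Fin.snoc_last, mulAt, if_neg (by simp <;> omega), if_neg (by simp <;> omega), Fin.succ_last,
      Fin.snoc_last]
  · rw [Fin.snoc_castSucc, mulAt, mulAt, Fin.succ_castSucc, Fin.snoc_castSucc, Fin.snoc_castSucc]
    rfl

theorem mulAt_snoc_last {r : ℕ} (as : Fin (r + 1) → A) (b : A) :
    mulAt (Fin.snoc as b : Fin (r + 2) → A) (Fin.last r) =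
      Fin.snoc (fun i : Fin r => as i.castSucc) (as (Fin.last r) * b) := by
  funext j
  refine Fin.lastCases ?_ (fun j => ?_) j
  · rw [Fin.snoc_last, mulAt, if_neg (by simp), if_pos rfl, Fin.succ_last, Fin.snoc_last,
      Fin.snoc_castSucc]
  · have := j.isLt
    rw [Fin.snoc_castSucc, mulAt, if_pos (by simp), Fin.snoc_castSucc]

namespace CrossedProduct
variable (S : CrossedProduct k A H E)

theorem PZ_hE : ∀ {s : ℕ} (hs : Fin s → H) (h : H),
    S.PZ hs (S.hE h) = 1 ⊗ₜ[k] tp k (Fin.snoc hs h : Fin (s + 1) → H)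
  | 0, hs, h => by
    rw [PZ]; exact S.zE_ι _ _ _
  | s + 1, hs, h => by
    rw [PZ, PZ_hE, zcons_one, tp_succ (Fin.snoc hs h : Fin (s + 2) → H), snoc_fun_succ, snoc_fun_zero]
    exact S.zE_ι _ _ _

def sY (s : ℕ) : Yc k H E s →ₗ[k] Yc k H E (s + 1) :=
  TensorProduct.lift ((TensorProduct.lift (LinearMap.mk₂ k
    (fun (a : A) (h : H) => TensorProduct.mk k E (Tpow k (Qbar k H) (s + 1) ⊗[k] H) (S.aE a) ∘ₗ
      LinearMap.rTensor H (tcons (k := k) (n := s) (qbar k H h)))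
    (by intro a b c; rw [map_add, map_add]; rfl)
    (by intro a b c; rw [map_smul, map_smul]; rfl)
    (by intro a b c; rw [map_add, map_add, LinearMap.rTensor_add, LinearMap.comp_add])
    (by intro a b c; rw [map_smul, map_smul, LinearMap.rTensor_smul, LinearMap.comp_smul])))
    ∘ₗ S.ι.symm.toLinearMap)

theorem sY_Yof (s : ℕ) (z : Zm k A H (s + 2)) : S.sY s (S.Yof s z) = S.Yof (s + 1) (S.zcons 1 z) := by
  have : S.sY s ∘ₗ S.Yof s = S.Yof (s + 1) ∘ₗ S.zcons 1 := by
    apply TensorProduct.ext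
    ext a : 1
    apply tlift_ext
    intro h q
    change S.sY s (S.Yof s (a ⊗ₜ[k] tcons h q)) = S.Yof (s + 1) (S.zcons 1 (a ⊗ₜ[k] tcons h q))
    rw [← S.zE_ι, S.Yof_zE, S.zE_ι, zcons_tmul, Yof_zE, one_mul, split_succ, sY,
      TensorProduct.lift.tmul, LinearMap.comp_apply, LinearEquiv.coe_coe, LinearEquiv.symm_apply_apply,
      TensorProduct.lift.tmul]
    rfl
  exact LinearMap.congr_fun this z

def eY : Yc k H E 0 →ₗ[k] E :=
  TensorProduct.lift (LinearMap.compl₂ (LinearMap.mul k E)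
    (TensorProduct.lift (tlift0 (k := k) (V := Qbar k H) S.hE)))

def zeps : Zm k A H 1 →ₗ[k] E := S.zlift (tlift0 (k := k) (V := H) LinearMap.id).flip

theorem zeps_zE (e : E) : S.zeps (S.zE e tone) = e := by
  rw [zeps, zlift_zE, LinearMap.flip_apply, tlift0_tone]; rfl

theorem z1_ext {f g : Zm k A H 1 →ₗ[k] N} (h : ∀ e, f (S.zE e tone) = g (S.zE e tone)) : f = g := by
  apply S.z_ext
  intro e q
  have : f ∘ₗ S.zE e = g ∘ₗ S.zE e := tzero_ext (h e)
  exact LinearMap.congr_fun this q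

theorem eY_Yof (z : Zm k A H 2) : S.eY (S.Yof 0 z) = S.zeps (S.zb 0 z) := by
  have : S.eY ∘ₗ S.Yof 0 = S.zeps ∘ₗ S.zb 0 := by
    apply S.z_ext
    intro e q
    have : S.eY ∘ₗ S.Yof 0 ∘ₗ S.zE e = S.zeps ∘ₗ S.zb 0 ∘ₗ S.zE e := by
      apply tlift_ext
      intro h t
      have : S.eY ∘ₗ S.Yof 0 ∘ₗ S.zE e ∘ₗ tcons h = S.zeps ∘ₗ S.zb 0 ∘ₗ S.zE e ∘ₗ tcons h := by
        apply tzero_ext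
        simp only [LinearMap.comp_apply]
        rw [Yof_zE, zb_zero_zE, ← S.zE_ι, zL_zE, zeps_zE, split_zero, eY, TensorProduct.lift.tmul,
          LinearMap.compl₂_apply, TensorProduct.lift.tmul, tlift0_tone]
        rfl
      exact LinearMap.congr_fun this t
    exact LinearMap.congr_fun this q
  exact LinearMap.congr_fun this z

def sm1 : E →ₗ[k] Yc k H E 0 := S.Yof 0 ∘ₗ S.zcons 1 ∘ₗ S.zE.flip tone

theorem sm1_zeps (w : Zm k A H 1) : S.sm1 (S.zeps w) = S.Yof 0 (S.zcons 1 w) := by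
  have : S.sm1 ∘ₗ S.zeps = S.Yof 0 ∘ₗ S.zcons 1 := by
    apply S.z1_ext
    intro e
    rw [LinearMap.comp_apply, zeps_zE]; rfl
  exact LinearMap.congr_fun this w

theorem eY_sm1 (e : E) : S.eY (S.sm1 e) = e := by
  rw [sm1, LinearMap.comp_apply, eY_Yof, LinearMap.comp_apply, zb_zero_zcons, zL_one, LinearMap.flip_apply,
    zeps_zE]

end CrossedProduct

namespace ResData

variable {S : CrossedProduct k A H E} (R : ResData k A H E S)

def d0 (r s : ℕ) : Xc k A H E (r + 1) s →ₗ[k] Xc k A H E r s := R.dl 0 (r + 1) s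

def d1 (r s : ℕ) : Xc k A H E r (s + 1) →ₗ[k] Xc k A H E r s := R.dl 1 r (s + 1)

theorem sig_hE (r s : ℕ) (e : E) (hs : Fin s → H) (as : Fin r → A) (b : A) :
    R.sig r s (xgen e hs as (S.aE b)) = ((-1 : ℤ) ^ (r + 1)) • xgen e hs (Fin.snoc as b) 1 := by
  rw [← S.hE_one]; exact R.sig_eq r s e hs as b 1

theorem d0_gen (r s : ℕ) (a₀ : A) (h₀ : H) (hs : Fin s → H) (as : Fin (r + 1) → A)
    (b : A) (h' : H) (Nv : Fin (s + 1) → ℕ) (v : ∀ i, Fin (Nv i) → Fin 2 → H)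
    (hv : ∀ i, SRep k 1 ((Fin.cons h₀ hs : Fin (s + 1) → H) i) (Nv i) (v i)) :
    R.d0 r s (xgen (S.ι (a₀ ⊗ₜ[k] h₀)) hs as (S.ι (b ⊗ₜ[k] h'))) =
      (∑ c : (∀ i, Fin (Nv i)),
        xgen (S.ι ((a₀ * iterAct k S.act (fun i => v i (c i) 0) (as 0)) ⊗ₜ[k] (v 0 (c 0) 1)))
          (fun i : Fin s => v i.succ (c i.succ) 1)
          (fun i : Fin r => as i.succ) (S.ι (b ⊗ₜ[k] h')))
      + (∑ i : Fin r, ((-1 : ℤ) ^ ((i : ℕ) + 1)) •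
          xgen (S.ι (a₀ ⊗ₜ[k] h₀)) hs (mulAt as i) (S.ι (b ⊗ₜ[k] h')))
      + ((-1 : ℤ) ^ (r + 1)) •
          xgen (S.ι (a₀ ⊗ₜ[k] h₀)) hs (fun i : Fin r => as i.castSucc)
            (S.ι ((as (Fin.last r) * b) ⊗ₜ[k] h')) :=
  R.d0_eq r s a₀ h₀ hs as b h' Nv v hv

theorem hE_ι (h : H) : S.hE h = S.ι (1 ⊗ₜ[k] h) := rfl

theorem d0_sig (r s : ℕ) (x : Xc k A H E (r + 1) s) :
    R.d0 (r + 1) s (R.sig (r + 1) s x) + R.sig r s (R.d0 r s x) = x := by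
  have : R.d0 (r + 1) s ∘ₗ R.sig (r + 1) s + R.sig r s ∘ₗ R.d0 r s = LinearMap.id := by
    apply S.x_ext₂
    intro a₀ h₀ hs as b h'
    choose Nv v hv using fun i => exists_SRep (k := k) 1 ((Fin.cons h₀ hs : Fin (s + 1) → H) i)
    rw [LinearMap.add_apply, LinearMap.comp_apply, LinearMap.comp_apply, LinearMap.id_apply,
      R.sig_eq, map_zsmul, hE_ι, R.d0_gen r s a₀ h₀ hs as b h' Nv v hv,
      R.d0_gen (r + 1) s a₀ h₀ hs (Fin.snoc as b) 1 h' Nv v hv]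
    rw [map_add, map_add, map_sum, map_sum, map_zsmul, R.sig_eq, Fin.sum_univ_castSucc]
    simp only [map_zsmul, R.sig_eq, mulAt_snoc, mulAt_snoc_last, snoc_fun_succ, snoc_fun_zero,
      Fin.snoc_castSucc, Fin.snoc_last, mul_one, Fin.val_castSucc, Fin.val_last, hE_ι]
    simp only [smul_add, smul_smul, ← pow_add, Finset.smul_sum]
    have s1 : ∀ n m : ℕ, (n = m + 1) → ((-1 : ℤ) ^ n) = - (-1) ^ m := by
      intro n m h; rw [h, pow_succ, mul_neg_one]
    rw [s1 (r + 1 + 1) (r + 1) rfl]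
    rw [s1 (r + 1 + 1 + (r + 1)) (r + 1 + (r + 1)) (by omega)]
    rw [Finset.sum_congr rfl fun (i : Fin r) _ => by
      rw [s1 (r + 1 + 1 + (i + 1)) ((i + 1) + (r + 1)) (by omega)]]
    have s2 : ((-1 : ℤ) ^ (r + 1 + 1 + (r + 1 + 1))) = 1 := by
      rw [show r + 1 + 1 + (r + 1 + 1) = 2 * (r + 2) by omega, pow_mul]; simp
    rw [s2]
    simp only [neg_smul, Finset.sum_neg_distrib, one_smul]
    have s3 : ∀ i : Fin r, (-1 : ℤ) ^ (r + 1 + ((i : ℕ) + 1)) = (-1) ^ ((i : ℕ) + 1 + (r + 1)) := by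
      intro i; rw [add_comm]
    try simp only [s3]
    abel
  exact LinearMap.congr_fun this x

theorem d0_sig0 (s : ℕ) (x : Xc k A H E 0 s) :
    R.d0 0 s (R.sig 0 s x) + R.sig0 s (R.mu s x) = x := by
  have : R.d0 0 s ∘ₗ R.sig 0 s + R.sig0 s ∘ₗ R.mu s = LinearMap.id := by
    apply S.x_ext₂
    intro a₀ h₀ hs as b h'
    choose Nv v hv using fun i => exists_SRep (k := k) 1 ((Fin.cons h₀ hs : Fin (s + 1) → H) i)
    have h0 : as = (fun i : Fin 0 => i.elim0) := Subsingleton.elim _ _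
    subst h0
    rw [LinearMap.add_apply, LinearMap.comp_apply, LinearMap.comp_apply, LinearMap.id_apply,
      R.sig_eq, map_zsmul, R.mu_eq s a₀ h₀ hs b h' Nv v hv, hE_ι,
      R.d0_gen 0 s a₀ h₀ hs (Fin.snoc _ b) 1 h' Nv v hv, map_sum]
    simp only [R.sig0_eq, mul_one]
    have s2 : (Fin.snoc (fun i : Fin 0 => i.elim0) b : Fin 1 → A) 0 = b := rfl
    have s3 : (Fin.snoc (fun i : Fin 0 => i.elim0) b : Fin 1 → A) (Fin.last 0) = b := rfl
    have s4 : ∀ g : Fin 0 → A, g = fun i : Fin 0 => i.elim0 := fun g => Subsingleton.elim _ _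
    rw [s2, s3, s4 (fun i => (Fin.snoc (fun i : Fin 0 => i.elim0) b : Fin 1 → A) i.succ),
      s4 (fun i => (Fin.snoc (fun i : Fin 0 => i.elim0) b : Fin 1 → A) i.castSucc)]
    simp only [hE_ι, zero_add, pow_one, Finset.univ_eq_empty, Finset.sum_empty, neg_smul, one_smul]
    abel
  exact LinearMap.congr_fun this x

theorem mu_sig0 (s : ℕ) (y : Yc k H E s) : R.mu s (R.sig0 s y) = y := by
  have : R.mu s ∘ₗ R.sig0 s = LinearMap.id := by
    apply y_ext
    intro e hs h
    rw [LinearMap.comp_apply, R.sig0_eq, R.mu_Yof, S.PZ_hE, S.zcons_one, S.Yof_gen]; rfl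
  exact LinearMap.congr_fun this y

theorem d0_l (r s : ℕ) (e : E) (x : Xc k A H E (r + 1) s) : R.d0 r s (lX e x) = lX e (R.d0 r s x) :=
  LinearMap.congr_fun (R.dl_lmul 0 (r + 1) s e) x
theorem d0_r (r s : ℕ) (e : E) (x : Xc k A H E (r + 1) s) : R.d0 r s (rX e x) = rX e (R.d0 r s x) :=
  LinearMap.congr_fun (R.dl_rmul 0 (r + 1) s e) x
theorem d1_l (r s : ℕ) (e : E) (x : Xc k A H E r (s + 1)) : R.d1 r s (lX e x) = lX e (R.d1 r s x) :=
  LinearMap.congr_fun (R.dl_lmul 1 r (s + 1) e) x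
theorem d1_r (r s : ℕ) (e : E) (x : Xc k A H E r (s + 1)) : R.d1 r s (rX e x) = rX e (R.d1 r s x) :=
  LinearMap.congr_fun (R.dl_rmul 1 r (s + 1) e) x

theorem mu_d0 (s : ℕ) (x : Xc k A H E 1 s) : R.mu s (R.d0 0 s x) = 0 := by
  have : R.mu s ∘ₗ R.d0 0 s = 0 := by
    apply S.x_ext₂
    intro a₀ h₀ hs as b h'
    choose Nv v hv using fun i => exists_SRep (k := k) 1 ((Fin.cons h₀ hs : Fin (s + 1) → H) i)
    rw [LinearMap.comp_apply, LinearMap.zero_apply, R.d0_gen 0 s a₀ h₀ hs as b h' Nv v hv]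
    simp only [zero_add, pow_one, Finset.univ_eq_empty, Finset.sum_empty, neg_smul, one_smul, add_zero]
    rw [map_add, map_neg, ← sub_eq_add_neg]
    rw [map_sum, R.mu_Yof, ← S.aE_mul, ← S.zR_PZ, ← S.zR_zcons, S.zcons_ι]
    have h2 : S.zcons (S.hE h₀) (S.PZ hs (S.aE (as (Fin.last 0)))) =
        S.PZ (Fin.cons h₀ hs : Fin (s + 1) → H) (S.ι (as 0 ⊗ₜ[k] 1)) := rfl
    rw [h2, S.PZ_sum _ _ 1 Nv v hv, map_sum, map_sum, map_sum, sub_eq_zero]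
    refine Finset.sum_congr rfl fun c _ => ?_
    refine (R.mu_Yof _ _ _ _).trans ?_
    rw [S.zL_aE, tp_succ (n := s + 1), ← S.zE_ι, snoc_fun_succ, snoc_fun_zero, ← S.zcons_one, ← S.PZ_one,
      S.zR_zcons, S.zR_PZ, one_mul]
  exact LinearMap.congr_fun this x

theorem x_ext_sig {r s : ℕ} {f g : Xc k A H E (r + 1) s →ₗ[k] N}
    (h : ∀ (e : E) (x : Xc k A H E r s), f (rX e (R.sig r s x)) = g (rX e (R.sig r s x))) : f = g := by
  apply x_ext
  intro e hs as e'
  obtain ⟨as, b, rfl⟩ : ∃ as' b, as = (Fin.snoc as' b : Fin (r + 1) → A) :=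
      ⟨fun i => as i.castSucc, as (Fin.last _), (Fin.snoc_init_self as).symm⟩
  have h1 := h e' (((-1 : ℤ) ^ (r + 1)) • xgen e hs as (S.aE b))
  rw [map_zsmul, R.sig_hE, smul_smul, ← mul_pow] at h1
  simpa [rX_xgen] using h1

theorem d0_d0 (r s : ℕ) (x : Xc k A H E (r + 2) s) : R.d0 r s (R.d0 (r + 1) s x) = 0 := by
  induction r with
  | zero =>
    have : R.d0 0 s ∘ₗ R.d0 1 s = 0 := by
      apply R.x_ext_sig
      intro e x
      rw [LinearMap.comp_apply, R.d0_r, R.d0_r, eq_sub_of_add_eq (R.d0_sig 0 s x), map_sub,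
        eq_sub_of_add_eq (R.d0_sig0 s _), R.mu_d0, map_zero, sub_zero, sub_self, map_zero]; rfl
    exact LinearMap.congr_fun this x
  | succ r ih =>
    have : R.d0 (r + 1) s ∘ₗ R.d0 (r + 2) s = 0 := by
      apply R.x_ext_sig
      intro e x
      rw [LinearMap.comp_apply, R.d0_r, R.d0_r, eq_sub_of_add_eq (R.d0_sig (r + 1) s x), map_sub,
        eq_sub_of_add_eq (R.d0_sig r s _), ih, map_zero, sub_zero, sub_self, map_zero]; rfl
    exact LinearMap.congr_fun this x

theorem mu_lr (s : ℕ) (e e' : E) (z : Zm k A H (s + 2)) :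
    R.mu s (lX e (rX e' (R.sig0 s (S.Yof s z)))) = S.Yof s (S.zL e (S.zR e' (s + 1) z)) := by
  have : R.mu s ∘ₗ lX e ∘ₗ rX e' ∘ₗ R.sig0 s ∘ₗ S.Yof s = S.Yof s ∘ₗ S.zL e ∘ₗ S.zR e' (s + 1) := by
    apply CrossedProduct.z_ext_tp
    intro a y
    simp only [LinearMap.comp_apply]
    rw [S.Yof_tp, R.sig0_eq, rX_xgen, lX_xgen, R.mu_Yof, ← S.zR_PZ, ← S.zL_zcons, ← S.zR_zcons, S.PZ_hE,
      S.zcons_one, S.zE_ι, tp_succ y]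
    congr 6
    funext p
    refine Fin.lastCases ?_ (fun j => ?_) p
    · rw [Fin.snoc_last]; rfl
    · rw [Fin.snoc_castSucc]
  exact LinearMap.congr_fun this z

theorem mu_d1 (s : ℕ) (x : Xc k A H E 0 (s + 1)) : R.mu s (R.d1 0 s x) = - R.del s (R.mu (s + 1) x) := by
  have : R.mu s ∘ₗ R.d1 0 s = - R.del s ∘ₗ R.mu (s + 1) := by
    apply x_ext
    intro e hs as e'
    rw [LinearMap.comp_apply, LinearMap.neg_apply, LinearMap.comp_apply]
    rw [R.mu_Yof, R.del_Yof, xgen_eq e, R.d1_l, R.d1_r]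
    have h1 : R.d1 0 s (xgen 1 hs as 1) = - R.sig0 s (R.del s (R.mu (s + 1) (xgen (1 : E) hs as (1 : E)))) :=
      R.dl_one_zero s hs
    rw [h1, R.mu_Yof, R.del_Yof]
    simp only [map_neg, neg_neg]
    rw [R.mu_lr, ← S.zb_zR, ← S.zb_zL, S.zR_zcons,
      S.zL_zcons, mul_one, S.zR_PZ, one_mul]
  exact LinearMap.congr_fun this x

theorem del_del (s : ℕ) (y : Yc k H E (s + 2)) : R.del s (R.del (s + 1) y) = 0 := by
  have : R.del s ∘ₗ R.del (s + 1) = 0 := by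
    apply S.y_ext'
    intro z
    rw [LinearMap.comp_apply, R.del_Yof, map_neg, R.del_Yof, S.zb_zb, map_zero, neg_zero, neg_zero]; rfl
  exact LinearMap.congr_fun this y

theorem del_sY (s : ℕ) (y : Yc k H E (s + 1)) :
    R.del (s + 1) (S.sY (s + 1) y) + S.sY s (R.del s y) = - y := by
  have : R.del (s + 1) ∘ₗ S.sY (s + 1) + S.sY s ∘ₗ R.del s = - LinearMap.id := by
    apply S.y_ext'
    intro z
    rw [LinearMap.add_apply, LinearMap.comp_apply, LinearMap.comp_apply, S.sY_Yof, R.del_Yof, R.del_Yof,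
      S.zb_succ_zcons, S.zL_one, map_neg, S.sY_Yof, map_sub]
    simp
    try abel
  exact LinearMap.congr_fun this y

theorem del_sY0 (y : Yc k H E 0) :
    R.del 0 (S.sY 0 y) = - y + S.sm1 (S.eY y) := by
  have : R.del 0 ∘ₗ S.sY 0 = - LinearMap.id + S.sm1 ∘ₗ S.eY := by
    apply S.y_ext'
    intro z
    rw [LinearMap.add_apply, LinearMap.comp_apply, LinearMap.comp_apply, S.sY_Yof, R.del_Yof,
      S.zb_succ_zcons, S.zL_one, S.eY_Yof, S.sm1_zeps, map_sub]
    simp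
    abel
  exact LinearMap.congr_fun this y

theorem eY_del (y : Yc k H E 1) : S.eY (R.del 0 y) = 0 := by
  have : S.eY ∘ₗ R.del 0 = 0 := by
    apply S.y_ext'
    intro z
    rw [LinearMap.comp_apply, R.del_Yof, map_neg, S.eY_Yof, S.zb_zb, map_zero, neg_zero]; rfl
  exact LinearMap.congr_fun this y

end ResData

end PRow


section PTot

variable {k A H E N : Type} [CommRing k] [Ring A] [Algebra k A] [Ring H] [HopfAlgebra k H]
  [Ring E] [Algebra k E] [AddCommGroup N] [Module k N]

variable (k A H E) in
def TT : Type := ⨁ p : ℕ × ℕ, Xc k A H E p.1 p.2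

instance : AddCommGroup (TT k A H E) := inferInstanceAs (AddCommGroup (⨁ p : ℕ × ℕ, Xc k A H E p.1 p.2))
instance : Module k (TT k A H E) := inferInstanceAs (Module k (⨁ p : ℕ × ℕ, Xc k A H E p.1 p.2))

variable (k H E) in
def YT : Type := ⨁ s : ℕ, Yc k H E s

instance : AddCommGroup (YT k H E) := inferInstanceAs (AddCommGroup (⨁ s : ℕ, Yc k H E s))
instance : Module k (YT k H E) := inferInstanceAs (Module k (⨁ s : ℕ, Yc k H E s))

def inn (r s : ℕ) : Xc k A H E r s →ₗ[k] TT k A H E :=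
  DirectSum.lof k (ℕ × ℕ) (fun p => Xc k A H E p.1 p.2) (r, s)

def yin (s : ℕ) : Yc k H E s →ₗ[k] YT k H E := DirectSum.lof k ℕ (fun s => Yc k H E s) s

def tmod (f : ∀ r s : ℕ, Xc k A H E r s →ₗ[k] N) : TT k A H E →ₗ[k] N :=
  DirectSum.toModule k (ℕ × ℕ) N (fun p => f p.1 p.2)

def ymod (f : ∀ s : ℕ, Yc k H E s →ₗ[k] N) : YT k H E →ₗ[k] N :=
  DirectSum.toModule k ℕ N f

theorem tmod_inn (f : ∀ r s : ℕ, Xc k A H E r s →ₗ[k] N) (r s : ℕ) (x : Xc k A H E r s) :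
    tmod f (inn r s x) = f r s x := DirectSum.toModule_lof k _ _

theorem ymod_yin (f : ∀ s : ℕ, Yc k H E s →ₗ[k] N) (s : ℕ) (x : Yc k H E s) :
    ymod f (yin s x) = f s x := DirectSum.toModule_lof k _ _

theorem t_ext {f g : TT k A H E →ₗ[k] N} (h : ∀ r s x, f (inn r s x) = g (inn r s x)) : f = g :=
  DirectSum.linearMap_ext k fun p => LinearMap.ext fun x => h p.1 p.2 x

theorem yt_ext {f g : YT k H E →ₗ[k] N} (h : ∀ s x, f (yin s x) = g (yin s x)) : f = g :=
  DirectSum.linearMap_ext k fun p => LinearMap.ext fun x => h p x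

theorem inn_xcast {r r' s s' : ℕ} (hr : r = r') (hs : s = s') (x : Xc k A H E r s) :
    inn r' s' (xcast hr hs x) = inn r s x := by
  subst hr; subst hs; rfl

def LT (e : E) : TT k A H E →ₗ[k] TT k A H E := tmod fun r s => inn r s ∘ₗ lX e
def RT (e : E) : TT k A H E →ₗ[k] TT k A H E := tmod fun r s => inn r s ∘ₗ rX e

theorem LT_inn (e : E) (r s : ℕ) (x : Xc k A H E r s) : LT e (inn r s x) = inn r s (lX e x) := tmod_inn _ _ _ _
theorem RT_inn (e : E) (r s : ℕ) (x : Xc k A H E r s) : RT e (inn r s x) = inn r s (rX e x) := tmod_inn _ _ _ _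

variable (k A H E) in
def FT (p : ℕ) : Submodule k (TT k A H E) :=
  Submodule.span k {z | ∃ (r s : ℕ) (x : Xc k A H E r s), s < p ∧ z = inn r s x}

theorem inn_mem {r s p : ℕ} (h : s < p) (x : Xc k A H E r s) : inn r s x ∈ FT k A H E p :=
  Submodule.subset_span ⟨r, s, x, h, rfl⟩

theorem FT_mono {p q : ℕ} (h : p ≤ q) {z : TT k A H E} (hz : z ∈ FT k A H E p) : z ∈ FT k A H E q :=
  Submodule.span_mono (by rintro _ ⟨a, b, c, h1, h2⟩; exact ⟨a, b, c, by omega, h2⟩) hz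

theorem FT_zero : FT k A H E 0 = ⊥ := by
  rw [FT, Submodule.span_eq_bot]
  rintro x ⟨r, s, x, h, -⟩
  exact absurd h (Nat.not_lt_zero s)

theorem FT_map {p : ℕ} {f : TT k A H E →ₗ[k] N} {G : Submodule k N}
    (h : ∀ r s x, s < p → f (inn r s x) ∈ G) {z : TT k A H E} (hz : z ∈ FT k A H E p) : f z ∈ G := by
  have : FT k A H E p ≤ G.comap f := by
    rw [FT, Submodule.span_le]
    rintro _ ⟨r, s, x, hs, rfl⟩
    exact h r s x hs
  exact this hz

variable (k H E) in
def FY (p : ℕ) : Submodule k (YT k H E) :=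
  Submodule.span k {z | ∃ (s : ℕ) (x : Yc k H E s), s < p ∧ z = yin s x}

theorem yin_mem {s p : ℕ} (h : s < p) (x : Yc k H E s) : yin s x ∈ FY k H E p :=
  Submodule.subset_span ⟨s, x, h, rfl⟩

theorem FY_map {p : ℕ} {f : YT k H E →ₗ[k] N} {G : Submodule k N}
    (h : ∀ s x, s < p → f (yin s x) ∈ G) {z : YT k H E} (hz : z ∈ FY k H E p) : f z ∈ G := by
  have : FY k H E p ≤ G.comap f := by
    rw [FY, Submodule.span_le]
    rintro _ ⟨s, x, hs, rfl⟩
    exact h s x hs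
  exact this hz

namespace CrossedProduct
variable (S : CrossedProduct k A H E)

def sYT : YT k H E →ₗ[k] YT k H E := ymod fun s => - (yin (s + 1) ∘ₗ S.sY s)
def eYc : ∀ s : ℕ, Yc k H E s →ₗ[k] E
  | 0 => S.eY
  | _ + 1 => 0
def eYT : YT k H E →ₗ[k] E := ymod S.eYc

end CrossedProduct

namespace ResData

variable {S : CrossedProduct k A H E} (R : ResData k A H E S)

def ddc (l r s : ℕ) : Xc k A H E r s →ₗ[k] TT k A H E :=
  if l ≤ s ∧ 0 < r + l then inn (r + l - 1) (s - l) ∘ₗ R.dl l r s else 0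

def dd (l : ℕ) : TT k A H E →ₗ[k] TT k A H E := tmod (R.ddc l)

theorem dd_inn {l r s : ℕ} (h1 : l ≤ s) (h2 : 0 < r + l) (x : Xc k A H E r s) :
    R.dd l (inn r s x) = inn (r + l - 1) (s - l) (R.dl l r s x) := by
  rw [dd, tmod_inn, ddc, if_pos ⟨h1, h2⟩]; rfl

theorem dd_inn0 {l r s : ℕ} (h : ¬ (l ≤ s ∧ 0 < r + l)) (x : Xc k A H E r s) :
    R.dd l (inn r s x) = 0 := by
  rw [dd, tmod_inn, ddc, if_neg h]; rfl

theorem dd_zero (r s : ℕ) (x : Xc k A H E (r + 1) s) : R.dd 0 (inn (r + 1) s x) = inn r s (R.d0 r s x) :=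
  R.dd_inn (Nat.zero_le _) (by omega) x

theorem dd_zero0 (s : ℕ) (x : Xc k A H E 0 s) : R.dd 0 (inn 0 s x) = 0 :=
  R.dd_inn0 (by omega) x

theorem dd_mem (l r s : ℕ) (x : Xc k A H E r s) : R.dd l (inn r s x) ∈ FT k A H E (s - l + 1) := by
  by_cases h : l ≤ s ∧ 0 < r + l
  · rw [R.dd_inn h.1 h.2]; exact inn_mem (by omega) _
  · rw [R.dd_inn0 h]; exact Submodule.zero_mem _

def dt : TT k A H E →ₗ[k] TT k A H E :=
  tmod fun r s => ∑ l ∈ Finset.range (s + 1), R.dd l ∘ₗ inn r s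

theorem dt_inn (r s : ℕ) (x : Xc k A H E r s) :
    R.dt (inn r s x) = ∑ l ∈ Finset.range (s + 1), R.dd l (inn r s x) := by
  rw [dt, tmod_inn, LinearMap.sum_apply]; rfl

def nt : TT k A H E →ₗ[k] TT k A H E := R.dt - R.dd 0

theorem nt_inn (r s : ℕ) (x : Xc k A H E r s) :
    R.nt (inn r s x) = ∑ i ∈ Finset.range s, R.dd (i + 1) (inn r s x) := by
  rw [nt, LinearMap.sub_apply, dt_inn, Finset.sum_range_succ', add_sub_cancel_right]

theorem nt_mem' (r s : ℕ) (x : Xc k A H E r s) : R.nt (inn r s x) ∈ FT k A H E s := by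
  rw [nt_inn]
  refine Submodule.sum_mem _ fun i hi => ?_
  rw [Finset.mem_range] at hi
  exact FT_mono (by omega) (R.dd_mem (i + 1) r s x)

theorem nt_mem {p : ℕ} {z : TT k A H E} (hz : z ∈ FT k A H E (p + 1)) : R.nt z ∈ FT k A H E p :=
  FT_map (fun r s x h => FT_mono (by omega) (R.nt_mem' r s x)) hz

theorem dt_mem {p : ℕ} {z : TT k A H E} (hz : z ∈ FT k A H E p) : R.dt z ∈ FT k A H E p :=
  FT_map (fun r s x h => by
    rw [dt_inn]
    exact Submodule.sum_mem _ fun i hi => FT_mono (by omega) (R.dd_mem i r s x)) hz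

theorem dt_eq (z : TT k A H E) : R.dt z = R.dd 0 z + R.nt z := by
  rw [nt, LinearMap.sub_apply, add_sub_cancel]

def sgT : TT k A H E →ₗ[k] TT k A H E := tmod fun r s => inn (r + 1) s ∘ₗ R.sig r s
theorem sgT_inn (r s : ℕ) (x : Xc k A H E r s) : R.sgT (inn r s x) = inn (r + 1) s (R.sig r s x) :=
  tmod_inn _ _ _ _
theorem sgT_mem {p : ℕ} {z : TT k A H E} (hz : z ∈ FT k A H E p) : R.sgT z ∈ FT k A H E p :=
  FT_map (fun r s x h => by rw [sgT_inn]; exact inn_mem h _) hz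

def muc : ∀ r s : ℕ, Xc k A H E r s →ₗ[k] YT k H E
  | 0, s => yin s ∘ₗ R.mu s
  | _ + 1, _ => 0
def muT : TT k A H E →ₗ[k] YT k H E := tmod R.muc
theorem muT_zero (s : ℕ) (x : Xc k A H E 0 s) : R.muT (inn 0 s x) = yin s (R.mu s x) := tmod_inn _ _ _ _
theorem muT_succ (r s : ℕ) (x : Xc k A H E (r + 1) s) : R.muT (inn (r + 1) s x) = 0 := tmod_inn _ _ _ _
theorem muT_pos {r s : ℕ} (h : 0 < r) (x : Xc k A H E r s) : R.muT (inn r s x) = 0 := by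
  cases r with
  | zero => omega
  | succ r => exact R.muT_succ r s x
theorem muT_mem {p : ℕ} {z : TT k A H E} (hz : z ∈ FT k A H E p) : R.muT z ∈ FY k H E p :=
  FT_map (fun r s x h => by
    cases r with
    | zero => rw [muT_zero]; exact yin_mem h _
    | succ r => rw [muT_succ]; exact Submodule.zero_mem _) hz

def delc : ∀ s : ℕ, Yc k H E s →ₗ[k] YT k H E
  | 0 => 0
  | s + 1 => yin s ∘ₗ R.del s
def delT : YT k H E →ₗ[k] YT k H E := ymod R.delc
theorem delT_zero (x : Yc k H E 0) : R.delT (yin 0 x) = 0 := ymod_yin _ _ _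
theorem delT_succ (s : ℕ) (x : Yc k H E (s + 1)) : R.delT (yin (s + 1) x) = yin s (R.del s x) :=
  ymod_yin _ _ _

def sg0T : YT k H E →ₗ[k] TT k A H E := ymod fun s => inn 0 s ∘ₗ R.sig0 s
theorem sg0T_yin (s : ℕ) (x : Yc k H E s) : R.sg0T (yin s x) = inn 0 s (R.sig0 s x) := ymod_yin _ _ _

theorem i1 (z : TT k A H E) : R.dd 0 (R.sgT z) + R.sgT (R.dd 0 z) + R.sg0T (R.muT z) = z := by
  have : R.dd 0 ∘ₗ R.sgT + R.sgT ∘ₗ R.dd 0 + R.sg0T ∘ₗ R.muT = LinearMap.id := by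
    apply t_ext
    intro r s x
    simp only [LinearMap.add_apply, LinearMap.comp_apply, LinearMap.id_apply]
    cases r with
    | zero => rw [sgT_inn, dd_zero, dd_zero0, map_zero, add_zero, muT_zero, sg0T_yin, ← map_add, R.d0_sig0]
    | succ r => rw [sgT_inn, dd_zero, dd_zero, muT_succ, map_zero, add_zero, sgT_inn, ← map_add, R.d0_sig]
  exact LinearMap.congr_fun this z

theorem i2 (z : TT k A H E) : R.muT (R.sgT z) = 0 := by
  have : R.muT ∘ₗ R.sgT = 0 := by
    apply t_ext
    intro r s x
    rw [LinearMap.comp_apply, sgT_inn, muT_succ]; rfl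
  exact LinearMap.congr_fun this z

theorem i2' (z : YT k H E) : R.muT (R.sg0T z) = z := by
  have : R.muT ∘ₗ R.sg0T = LinearMap.id := by
    apply yt_ext
    intro s x
    rw [LinearMap.comp_apply, sg0T_yin, muT_zero, R.mu_sig0]; rfl
  exact LinearMap.congr_fun this z

theorem i3 (z : YT k H E) : R.delT (R.delT z) = 0 := by
  have : R.delT ∘ₗ R.delT = 0 := by
    apply yt_ext
    intro s x
    match s, x with
    | 0, x => rw [LinearMap.comp_apply, delT_zero, map_zero]; rfl
    | 1, x => rw [LinearMap.comp_apply, delT_succ, delT_zero]; rfl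
    | s + 2, x => rw [LinearMap.comp_apply, delT_succ, delT_succ, R.del_del, map_zero]; rfl
  exact LinearMap.congr_fun this z

theorem i3' (z : YT k H E) : S.eYT (R.delT z) = 0 := by
  have : S.eYT ∘ₗ R.delT = 0 := by
    apply yt_ext
    intro s x
    match s, x with
    | 0, x => rw [LinearMap.comp_apply, delT_zero, map_zero]; rfl
    | 1, x =>
      rw [LinearMap.comp_apply, delT_succ, CrossedProduct.eYT, ymod_yin]
      exact R.eY_del x
    | s + 2, x => rw [LinearMap.comp_apply, delT_succ, CrossedProduct.eYT, ymod_yin]; rfl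
  exact LinearMap.congr_fun this z

theorem i4 (z : TT k A H E) : R.muT (R.dt z) = - R.delT (R.muT z) := by
  have : R.muT ∘ₗ R.dt = - R.delT ∘ₗ R.muT := by
    apply t_ext
    intro r s x
    rw [LinearMap.comp_apply, dt_inn, map_sum, LinearMap.neg_apply, LinearMap.comp_apply]
    have h2 : ∀ l, 2 ≤ l → R.muT (R.dd l (inn r s x)) = 0 := by
      intro l hl
      by_cases h : l ≤ s ∧ 0 < r + l
      · rw [R.dd_inn h.1 h.2, muT_pos _ (by omega)]
      · rw [R.dd_inn0 h, map_zero]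
    match r, x with
    | 0, x =>
      rw [muT_zero]
      cases s with
      | zero => rw [Finset.sum_range_one, dd_zero0, delT_zero, map_zero, neg_zero]
      | succ s =>
        rw [Finset.sum_range_succ', Finset.sum_range_succ', Finset.sum_eq_zero (fun i _ => h2 _ (by omega)),
          dd_zero0, map_zero, zero_add, add_zero, R.dd_inn (by omega) (by omega), delT_succ]
        have : R.muT (inn 0 s (R.d1 0 s x)) = yin s (R.mu s (R.d1 0 s x)) := R.muT_zero s _
        refine this.trans ?_
        rw [R.mu_d1, map_neg]
    | 1, x =>
      rw [muT_succ, map_zero, neg_zero, Finset.sum_range_succ', dd_zero, muT_zero, R.mu_d0, map_zero, add_zero]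
      refine Finset.sum_eq_zero fun i _ => ?_
      by_cases h : i + 1 ≤ s
      · rw [R.dd_inn h (by omega), muT_pos _ (by omega)]
      · rw [R.dd_inn0 (by omega), map_zero]
    | r + 2, x =>
      rw [muT_succ, map_zero, neg_zero]
      refine Finset.sum_eq_zero fun i _ => ?_
      by_cases h : i ≤ s
      · rw [R.dd_inn h (by omega), muT_pos _ (by omega)]
      · rw [R.dd_inn0 (by omega), map_zero]
  exact LinearMap.congr_fun this z

theorem i5 (z : YT k H E) :
    R.delT (S.sYT z) + S.sYT (R.delT z) = z - yin 0 (S.sm1 (S.eYT z)) := by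
  have : R.delT ∘ₗ S.sYT + S.sYT ∘ₗ R.delT = LinearMap.id - yin 0 ∘ₗ S.sm1 ∘ₗ S.eYT := by
    apply yt_ext
    intro s x
    simp only [LinearMap.add_apply, LinearMap.sub_apply, LinearMap.comp_apply, LinearMap.id_apply]
    cases s with
    | zero =>
      rw [delT_zero, map_zero, add_zero, CrossedProduct.sYT, ymod_yin, CrossedProduct.eYT, ymod_yin,
        LinearMap.neg_apply, map_neg, LinearMap.comp_apply, delT_succ, R.del_sY0, ← map_neg, neg_add,
        neg_neg, map_add, map_neg, sub_eq_add_neg]; rfl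
    | succ s =>
      rw [delT_succ, CrossedProduct.sYT, ymod_yin, ymod_yin, CrossedProduct.eYT, ymod_yin,
        LinearMap.neg_apply, map_neg, LinearMap.comp_apply, delT_succ, LinearMap.neg_apply, LinearMap.comp_apply,
        ← neg_add, ← map_add, R.del_sY, map_neg, neg_neg]
      change _ = _ - yin 0 (S.sm1 0)
      rw [map_zero, map_zero, sub_zero]
  exact LinearMap.congr_fun this z

theorem dd_L (l : ℕ) (e : E) (z : TT k A H E) : R.dd l (LT e z) = LT e (R.dd l z) := by
  have : R.dd l ∘ₗ LT e = LT e ∘ₗ R.dd l := by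
    apply t_ext
    intro r s x
    rw [LinearMap.comp_apply, LinearMap.comp_apply, LT_inn]
    by_cases h : l ≤ s ∧ 0 < r + l
    · rw [R.dd_inn h.1 h.2, R.dd_inn h.1 h.2, LT_inn]
      exact congrArg _ (LinearMap.congr_fun (R.dl_lmul l r s e) x)
    · rw [R.dd_inn0 h, R.dd_inn0 h, map_zero]
  exact LinearMap.congr_fun this z

theorem dd_R (l : ℕ) (e : E) (z : TT k A H E) : R.dd l (RT e z) = RT e (R.dd l z) := by
  have : R.dd l ∘ₗ RT e = RT e ∘ₗ R.dd l := by
    apply t_ext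
    intro r s x
    rw [LinearMap.comp_apply, LinearMap.comp_apply, RT_inn]
    by_cases h : l ≤ s ∧ 0 < r + l
    · rw [R.dd_inn h.1 h.2, R.dd_inn h.1 h.2, RT_inn]
      exact congrArg _ (LinearMap.congr_fun (R.dl_rmul l r s e) x)
    · rw [R.dd_inn0 h, R.dd_inn0 h, map_zero]
  exact LinearMap.congr_fun this z

theorem dt_L (e : E) (z : TT k A H E) : R.dt (LT e z) = LT e (R.dt z) := by
  have : R.dt ∘ₗ LT e = LT e ∘ₗ R.dt := by
    apply t_ext
    intro r s x
    rw [LinearMap.comp_apply, LinearMap.comp_apply, LT_inn, dt_inn, dt_inn, map_sum]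
    exact Finset.sum_congr rfl fun l _ => by rw [← LT_inn, dd_L]
  exact LinearMap.congr_fun this z

theorem dt_R (e : E) (z : TT k A H E) : R.dt (RT e z) = RT e (R.dt z) := by
  have : R.dt ∘ₗ RT e = RT e ∘ₗ R.dt := by
    apply t_ext
    intro r s x
    rw [LinearMap.comp_apply, LinearMap.comp_apply, RT_inn, dt_inn, dt_inn, map_sum]
    exact Finset.sum_congr rfl fun l _ => by rw [← RT_inn, dd_R]
  exact LinearMap.congr_fun this z

end ResData

end PTot


section PSq

variable {k A H E N : Type} [CommRing k] [Ring A] [Algebra k A] [Ring H] [HopfAlgebra k H]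
  [Ring E] [Algebra k E] [AddCommGroup N] [Module k N]

namespace ResData

variable {S : CrossedProduct k A H E} (R : ResData k A H E S)

theorem aux_grp {G : Type} [AddCommGroup G] {a b c d f p : G} (h1 : a = b - (c - d) - f)
    (h2 : p + d + -f = a) : c = b - p := by
  rw [h1] at h2
  have : c - (b - p) = (p + d + -f) - (b - (c - d) - f) := by abel
  rwa [h2, sub_self, sub_eq_zero] at this

theorem gen_aux {l j r s q : ℕ} (hj : j ≤ l) (hl : 1 ≤ l) (hls : l ≤ s) (hrj : 0 < r + j) (x : Xc k A H E r s)
    (h1 : q + 1 = r + l - 1) (h2 : r + j - 1 + (l - j) - 1 = q) (h3 : s - j - (l - j) = s - l)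
    (h4 : j < l) {t : ℕ} (h5 : r + j - 1 = t) (h2' : t + (l - j) - 1 = q) :
    inn (r + l - 1) (s - l) (xcast h1 rfl (R.sig q (s - l) (xcast h2' h3
      (R.dl (l - j) t (s - j) (xcast h5 rfl (R.dl j r s x)))))) =
      R.sgT (R.dd (l - j) (R.dd j (inn r s x))) := by
  rw [R.dd_inn (by omega) hrj, inn_xcast, ← R.sgT_inn, inn_xcast, ← R.dd_inn (by omega) (by omega), inn_xcast]

theorem gen_eq (i r s : ℕ) (hi : i < s) (hs : Fin s → H) (as : Fin r → A) :
    R.dd (i + 1) (inn r s (xgen (1 : E) hs as (1 : E))) =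
      - R.sgT (∑ j ∈ Finset.range (i + 1), R.dd (i - j + 1) (R.dd j (inn r s (xgen (1 : E) hs as (1 : E)))))
      - (if i = 0 then R.sg0T (R.delT (R.muT (inn r s (xgen (1 : E) hs as (1 : E))))) else 0) := by
  rw [R.dd_inn (by omega) (by omega)]
  match r, i, s with
  | 0, 0, s + 1 =>
    rw [Finset.sum_range_one, dd_zero0, map_zero, map_zero, neg_zero, zero_sub, if_pos rfl, muT_zero,
      delT_succ, sg0T_yin, ← map_neg]
    have : as = fun i : Fin 0 => i.elim0 := Subsingleton.elim _ _
    subst this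
    exact congrArg (inn 0 s) (R.dl_one_zero s hs)
  | 0, i + 1, s =>
    have : as = fun i : Fin 0 => i.elim0 := Subsingleton.elim _ _
    subst this
    rw [if_neg (by omega), sub_zero, R.dl_zero (i + 2) s (by omega) (by omega), map_neg, map_sum,
      Finset.sum_range_succ', dd_zero0, map_zero, add_zero, map_sum, Finset.sum_range]
    refine congrArg Neg.neg (Finset.sum_congr rfl fun j _ => ?_)
    have hj : (j : ℕ) < i + 1 := j.isLt
    refine (R.gen_aux (l := i + 2) (j := j + 1) (r := 0) (by omega) (by omega) (by omega) (by omega) _ _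
      (by omega) _ (by omega) _ _).trans ?_
    rw [show i + 2 - ((j : ℕ) + 1) = i + 1 - (j + 1) + 1 by omega]
  | r + 1, i, s =>
    have : (if i = 0 then R.sg0T (R.delT (R.muT (inn (r + 1) s (xgen (1 : E) hs as (1 : E))))) else 0) = 0 := by
      rw [muT_succ, map_zero, map_zero, ite_self]
    rw [this, sub_zero, R.dl_succ (i + 1) r s (by omega) (by omega), map_neg, map_sum,
      map_sum, Finset.sum_range]
    refine congrArg Neg.neg (Finset.sum_congr rfl fun j _ => ?_)
    have hj : (j : ℕ) < i + 1 := j.isLt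
    refine (R.gen_aux (l := i + 1) (j := j) (r := r + 1) (by omega) (by omega) (by omega) (by omega) _ _
      (by omega) _ (by omega) _ _).trans ?_
    rw [show i + 1 - (j : ℕ) = i - j + 1 by omega]

theorem nt_dd (j r s : ℕ) (x : Xc k A H E r s) :
    R.nt (R.dd j (inn r s x)) = ∑ i ∈ Finset.range (s - j), R.dd (i + 1) (R.dd j (inn r s x)) := by
  by_cases h : j ≤ s ∧ 0 < r + j
  · rw [R.dd_inn h.1 h.2, nt_inn]
  · rw [R.dd_inn0 h]; simp

theorem gen_tot (r s : ℕ) (hs : Fin s → H) (as : Fin r → A) :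
    R.dt (inn r s (xgen (1 : E) hs as (1 : E))) = R.dd 0 (inn r s (xgen (1 : E) hs as (1 : E)))
      - R.sgT (R.nt (R.dt (inn r s (xgen (1 : E) hs as (1 : E)))))
      - R.sg0T (R.delT (R.muT (inn r s (xgen (1 : E) hs as (1 : E))))) := by
  have h1 : R.sg0T (R.delT (R.muT (inn r s (xgen (1 : E) hs as (1 : E))))) =
      ∑ i ∈ Finset.range s,
        (if i = 0 then R.sg0T (R.delT (R.muT (inn r s (xgen (1 : E) hs as (1 : E))))) else 0) := by
    rw [Finset.sum_ite_eq' (Finset.range s) 0]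
    split_ifs with h
    · rfl
    · obtain rfl : s = 0 := by simpa using h
      cases r with
      | zero => rw [muT_zero, delT_zero, map_zero]
      | succ r => rw [muT_succ, map_zero, map_zero]
  have h2 : R.nt (R.dt (inn r s (xgen (1 : E) hs as (1 : E)))) = ∑ i ∈ Finset.range s,
      ∑ j ∈ Finset.range (i + 1), R.dd (i - j + 1) (R.dd j (inn r s (xgen (1 : E) hs as (1 : E)))) := by
    rw [dt_inn, map_sum, Finset.sum_range_succ, nt_dd R s, Nat.sub_self, Finset.sum_range_zero, add_zero]
    rw [Finset.sum_range_diag_flip s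
      (fun j m => R.dd (m + 1) (R.dd j (inn r s (xgen (1 : E) hs as (1 : E)))))]
    exact Finset.sum_congr rfl fun j _ => R.nt_dd j r s _
  rw [h1, h2, dt_eq, nt_inn, Finset.sum_congr rfl fun i hi => R.gen_eq i r s (Finset.mem_range.1 hi) hs as,
    Finset.sum_sub_distrib, map_sum, Finset.sum_neg_distrib]
  abel

theorem fix_zero {y : TT k A H E} (h : y = - R.sgT (R.nt y)) : ∀ p, y ∈ FT k A H E p → y = 0
  | 0, hy => by rw [FT_zero] at hy; exact hy
  | p + 1, hy => fix_zero h p (by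
      rw [h]; exact Submodule.neg_mem _ (R.sgT_mem (R.nt_mem hy)))

theorem dd0_dd0 (z : TT k A H E) : R.dd 0 (R.dd 0 z) = 0 := by
  have : R.dd 0 ∘ₗ R.dd 0 = 0 := by
    apply t_ext
    intro r s x
    match r, x with
    | 0, x => rw [LinearMap.comp_apply, dd_zero0, map_zero]; rfl
    | 1, x => rw [LinearMap.comp_apply, dd_zero, dd_zero0]; rfl
    | r + 2, x => rw [LinearMap.comp_apply, dd_zero, dd_zero, R.d0_d0, map_zero]; rfl
  exact LinearMap.congr_fun this z

theorem gen_sq (r s : ℕ) (hs : Fin s → H) (as : Fin r → A)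
    (h1 : R.dt (R.dt (R.dd 0 (inn r s (xgen (1 : E) hs as (1 : E))))) = 0)
    (h2 : R.dt (R.dt (R.nt (inn r s (xgen (1 : E) hs as (1 : E))))) = 0) :
    R.dt (R.dt (inn r s (xgen (1 : E) hs as (1 : E)))) = 0 := by
  have hg := R.gen_tot r s hs as
  have hm : inn r s (xgen (1 : E) hs as (1 : E)) ∈ FT k A H E (s + 1) := inn_mem (by omega) _
  generalize hgd : (inn r s (xgen (1 : E) hs as (1 : E)) : TT k A H E) = g at *
  have h3 : R.dd 0 (R.dd 0 g) = 0 := R.dd0_dd0 g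
  have h4 : R.sgT (R.dt (R.dt g)) = R.dd 0 g - R.dd 0 (R.sgT (R.dt g)) := by
    have e1 := R.dt_eq (R.dt g)
    have e2 := R.i1 (R.dt g)
    rw [R.i4, map_neg] at e2
    have e3 : R.nt (R.dt g) = R.dt (R.dt g) - R.dd 0 (R.dt g) := by rw [e1]; abel
    rw [e3, map_sub] at hg
    exact aux_grp hg e2
  have h5 : R.dd 0 (R.sgT (R.dt (R.dt g))) = 0 := by
    rw [h4, map_sub, h3, R.dd0_dd0, sub_zero]
  have h6 : R.muT (R.dt (R.dt g)) = 0 := by rw [i4, i4, map_neg, i3, neg_zero, neg_zero]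
  have h7 : R.dd 0 (R.dt (R.dt g)) = - R.nt (R.dt (R.dt g)) := by
    have := R.dt_eq (R.dt (R.dt g))
    have h8 : R.dt (R.dt (R.dt g)) = 0 := by
      nth_rewrite 3 [dt_eq]; rw [map_add, map_add, h1, h2, add_zero]
    rw [h8] at this
    exact eq_neg_of_add_eq_zero_left this.symm
  refine R.fix_zero ?_ (s + 1) (R.dt_mem (R.dt_mem hm))
  have := R.i1 (R.dt (R.dt g))
  rw [h5, h6, h7, map_zero, add_zero, zero_add, map_neg] at this
  exact this.symm

theorem sq_aux {r s : ℕ}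
    (h1 : ∀ (hs : Fin s → H) (as : Fin r → A), R.dt (R.dt (R.dd 0 (inn r s (xgen (1 : E) hs as (1 : E))))) = 0)
    (ihs : ∀ m < s, ∀ (r : ℕ) (x : Xc k A H E r m), R.dt (R.dt (inn r m x)) = 0) (x : Xc k A H E r s) :
    R.dt (R.dt (inn r s x)) = 0 := by
  have h2 : ∀ z ∈ FT k A H E s, R.dt (R.dt z) = 0 := by
    intro z hz
    have := FT_map (f := R.dt ∘ₗ R.dt) (G := ⊥) (fun r m x h => ihs m h r x) hz
    exact this
  have : R.dt ∘ₗ R.dt ∘ₗ inn r s = 0 := by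
    apply x_ext
    intro e hs as e'
    simp only [LinearMap.comp_apply]
    rw [xgen_eq, ← LT_inn, ← RT_inn, dt_L, dt_L, dt_R, dt_R, R.gen_sq r s hs as (h1 hs as) (h2 _ (R.nt_mem' _ _ _)),
      map_zero, map_zero]; rfl
  exact LinearMap.congr_fun this x

theorem dt_dt (z : TT k A H E) : R.dt (R.dt z) = 0 := by
  have key : ∀ s r (x : Xc k A H E r s), R.dt (R.dt (inn r s x)) = 0 := by
    intro s
    induction s using Nat.strong_induction_on with
    | _ s ihs =>
    intro r
    induction r with
    | zero => exact R.sq_aux (fun hs as => by rw [dd_zero0, map_zero, map_zero]) ihs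
    | succ r ih => exact R.sq_aux (fun hs as => by rw [dd_zero]; exact ih _) ihs
  have : R.dt ∘ₗ R.dt = 0 := t_ext fun r s x => key s r x
  exact LinearMap.congr_fun this z

theorem dt_sg0 {p : ℕ} {y : YT k H E} (hy : y ∈ FY k H E (p + 1)) : R.dt (R.sg0T y) ∈ FT k A H E p :=
  FY_map (f := R.dt ∘ₗ R.sg0T) (fun s x h => by
    rw [LinearMap.comp_apply, sg0T_yin, dt_eq, dd_zero0, zero_add]
    exact FT_mono (by omega) (R.nt_mem' _ _ _)) hy

def wt : TT k A H E →ₗ[k] TT k A H E := R.sg0T ∘ₗ S.sYT ∘ₗ R.muT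

theorem sYT_mem {p : ℕ} {y : YT k H E} (hy : y ∈ FY k H E p) : S.sYT y ∈ FY k H E (p + 1) :=
  FY_map (fun s x h => by
    rw [CrossedProduct.sYT, ymod_yin]
    exact Submodule.neg_mem _ (yin_mem (by omega) _)) hy

def ut : TT k A H E →ₗ[k] TT k A H E :=
  R.sgT - R.wt + R.sgT ∘ₗ (LinearMap.id - R.dt ∘ₗ R.sgT + R.dt ∘ₗ R.wt)

theorem step_mem {p : ℕ} {x : TT k A H E} (hx : x ∈ FT k A H E (p + 1)) (hd : R.dt x = 0) (hm : R.muT x = 0) :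
    x - R.dt (R.sgT x) ∈ FT k A H E p := by
  have h1 := R.i1 x
  have h2 : R.dd 0 x = - R.nt x := by
    rw [dt_eq] at hd; exact eq_neg_of_add_eq_zero_left hd
  rw [hm, map_zero, add_zero, h2, map_neg] at h1
  have h3 : x - R.dt (R.sgT x) = - R.sgT (R.nt x) - R.nt (R.sgT x) := by
    rw [dt_eq]; nth_rewrite 1 [← h1]; abel
  rw [h3]
  exact Submodule.sub_mem _ (Submodule.neg_mem _ (R.sgT_mem (R.nt_mem hx))) (R.nt_mem (R.sgT_mem hx))

theorem ut_mem {p : ℕ} {x : TT k A H E} (hx : x ∈ FT k A H E (p + 1)) (hd : R.dt x = 0)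
    (he : S.eYT (R.muT x) = 0) : x - R.dt (R.ut x) ∈ FT k A H E p := by
  have h1 := R.i5 (R.muT x)
  have h2 : R.delT (R.muT x) = 0 := by
    have := R.i4 x
    rw [hd, map_zero] at this
    exact neg_eq_zero.1 this.symm
  rw [h2, he, map_zero, map_zero, map_zero, add_zero, sub_zero] at h1
  have h3 : R.muT (x - R.dt (R.sgT x) + R.dt (R.wt x)) = 0 := by
    rw [map_add, map_sub, i4, i2, map_zero, neg_zero, sub_zero, i4, wt, LinearMap.comp_apply, i2',
      LinearMap.comp_apply, h1, add_neg_cancel]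
  have h4 := R.step_mem (p := p) (x := x - R.dt (R.sgT x) + R.dt (R.wt x))
    (Submodule.add_mem _ (Submodule.sub_mem _ hx (R.dt_mem (R.sgT_mem hx)))
      (R.dt_sg0 (sYT_mem (R.muT_mem hx))))
    (by rw [map_add, map_sub, hd, dt_dt, dt_dt, sub_zero, add_zero]) h3
  have h5 : x - R.dt (R.ut x) = x - R.dt (R.sgT x) + R.dt (R.wt x) -
      R.dt (R.sgT (x - R.dt (R.sgT x) + R.dt (R.wt x))) := by
    have : R.ut x = R.sgT x - R.wt x + R.sgT (x - R.dt (R.sgT x) + R.dt (R.wt x)) := rfl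
    rw [this, map_add, map_sub R.dt (R.sgT x)]; abel
  rw [h5]; exact h4

theorem contraction : ∀ p : ℕ, ∃ s : TT k A H E →ₗ[k] TT k A H E,
    ∀ x ∈ FT k A H E p, R.dt x = 0 → S.eYT (R.muT x) = 0 → R.dt (s x) = x
  | 0 => ⟨0, fun x hx _ _ => by
      rw [FT_zero] at hx
      rw [show x = 0 from hx, map_zero, map_zero]⟩
  | p + 1 => by
    obtain ⟨s, hs⟩ := contraction p
    refine ⟨R.ut + s ∘ₗ (LinearMap.id - R.dt ∘ₗ R.ut), fun x hx hd he => ?_⟩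
    have h1 := hs (x - R.dt (R.ut x)) (R.ut_mem hx hd he) (by rw [map_sub, hd, dt_dt, sub_zero])
      (by rw [map_sub, i4, map_sub, map_neg, i3', he, neg_zero, sub_zero])
    rw [LinearMap.add_apply, LinearMap.comp_apply, LinearMap.sub_apply, LinearMap.id_apply, LinearMap.comp_apply, map_add, h1, add_sub_cancel]

end ResData

end PSq


section PComp

variable {k E M X Y W C D D' : Type} [CommRing k] [Ring E] [Algebra k E] [AddCommGroup M] [Module k M]
  [AddCommGroup X] [Module k X] [AddCommGroup Y] [Module k Y] [AddCommGroup W] [Module k W]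
  [AddCommGroup C] [Module k C] [AddCommGroup D] [Module k D] [AddCommGroup D'] [Module k D']

def IsBi (b : Bimod k E X) (c : Bimod k E Y) (φ : X →ₗ[k] Y) : Prop :=
  (∀ e x, φ (b.l e x) = c.l e (φ x)) ∧ (∀ e x, φ (b.r e x) = c.r e (φ x))

theorem IsBi.comp {b : Bimod k E X} {c : Bimod k E Y} {b' : Bimod k E W} {φ : X →ₗ[k] Y} {ψ : Y →ₗ[k] W}
    (h : IsBi b c φ) (h' : IsBi c b' ψ) : IsBi b b' (ψ ∘ₗ φ) :=
  ⟨fun e x => by rw [LinearMap.comp_apply, h.1, h'.1]; rfl, fun e x => by rw [LinearMap.comp_apply, h.2, h'.2]; rfl⟩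

theorem IsBi.add {b : Bimod k E X} {c : Bimod k E Y} {φ ψ : X →ₗ[k] Y}
    (h : IsBi b c φ) (h' : IsBi b c ψ) : IsBi b c (φ + ψ) :=
  ⟨fun e x => by rw [LinearMap.add_apply, h.1, h'.1, ← map_add]; rfl,
   fun e x => by rw [LinearMap.add_apply, h.2, h'.2, ← map_add]; rfl⟩

theorem IsBi.sub {b : Bimod k E X} {c : Bimod k E Y} {φ ψ : X →ₗ[k] Y}
    (h : IsBi b c φ) (h' : IsBi b c ψ) : IsBi b c (φ - ψ) :=
  ⟨fun e x => by rw [LinearMap.sub_apply, h.1, h'.1, ← map_sub]; rfl,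
   fun e x => by rw [LinearMap.sub_apply, h.2, h'.2, ← map_sub]; rfl⟩

theorem IsBi.id {b : Bimod k E X} : IsBi b b LinearMap.id := ⟨fun _ _ => rfl, fun _ _ => rfl⟩

variable (k E) in
def regBi : Bimod k E E where
  l := LinearMap.mul k E
  r := (LinearMap.mul k E).flip
  l_one := by ext; simp
  r_one := by ext; simp
  l_mul x y := by ext; simp [mul_assoc]
  r_mul x y := by ext; simp [mul_assoc]
  lr_comm x y := by ext; simp [mul_assoc]

variable (k E) in
structure Res (N : ℕ → Type) [∀ n, AddCommGroup (N n)] [∀ n, Module k (N n)] where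
  b : ∀ n, Bimod k E (N n)
  d : ∀ n, N (n + 1) →ₗ[k] N n
  bd : ∀ n, IsBi (b (n + 1)) (b n) (d n)
  eps : N 0 →ₗ[k] E
  beps : IsBi (b 0) (regBi k E) eps
  eps_d : ∀ x, eps (d 0 x) = 0
  dd : ∀ n x, d n (d (n + 1) x) = 0
  sm : E →ₗ[k] N 0
  eps_sm : ∀ e, eps (sm e) = e
  s : ∀ n, N n →ₗ[k] N (n + 1)
  s0 : ∀ x, eps x = 0 → d 0 (s 0 x) = x
  s1 : ∀ n x, d n x = 0 → d (n + 1) (s (n + 1) x) = x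
  G : ∀ n, Set (N n)
  free : ∀ n {W : Type} [AddCommGroup W] [Module k W] (c : Bimod k E W) (P : N n →ₗ[k] W),
    ∃ φ : N n →ₗ[k] W, IsBi (b n) c φ ∧ ∀ x ∈ G n, φ x = P x
  ext : ∀ n {W : Type} [AddCommGroup W] [Module k W] (c : Bimod k E W) (φ ψ : N n →ₗ[k] W),
    IsBi (b n) c φ → IsBi (b n) c ψ → (∀ x ∈ G n, φ x = ψ x) → φ = ψ

namespace Res

variable {N N' : ℕ → Type} [∀ n, AddCommGroup (N n)] [∀ n, Module k (N n)]
  [∀ n, AddCommGroup (N' n)] [∀ n, Module k (N' n)]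

variable (P : Res k E N) (Q : Res k E N')

def Z : ∀ n, Submodule k (N n)
  | 0 => LinearMap.ker P.eps
  | n + 1 => LinearMap.ker (P.d n)

theorem d_Z : ∀ n x, P.d n x ∈ P.Z n
  | 0, x => P.eps_d x
  | n + 1, x => P.dd n x

theorem d_s : ∀ n x, x ∈ P.Z n → P.d n (P.s n x) = x
  | 0, x, h => P.s0 x h
  | n + 1, x, h => P.s1 n x h

def CM (n : ℕ) : Type := {φ : N n →ₗ[k] N' n // IsBi (P.b n) (Q.b n) φ ∧ ∀ x ∈ P.Z n, φ x ∈ Q.Z n}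

theorem cm_zero : ∃ φ : CM P Q 0, ∀ x, Q.eps (φ.1 x) = P.eps x := by
  obtain ⟨φ, h1, h2⟩ := P.free 0 (Q.b 0) (Q.sm ∘ₗ P.eps)
  have h3 : Q.eps ∘ₗ φ = P.eps := P.ext 0 (regBi k E) _ _ (h1.comp Q.beps) P.beps (fun x hx => by
    rw [LinearMap.comp_apply, h2 x hx, LinearMap.comp_apply, Q.eps_sm])
  refine ⟨⟨φ, h1, fun x hx => ?_⟩, fun x => LinearMap.congr_fun h3 x⟩
  have := LinearMap.congr_fun h3 x
  exact this.trans hx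

theorem cm_succ (n : ℕ) (φ : CM P Q n) : ∃ ψ : CM P Q (n + 1), ∀ x, Q.d n (ψ.1 x) = φ.1 (P.d n x) := by
  obtain ⟨ψ, h1, h2⟩ := P.free (n + 1) (Q.b (n + 1)) (Q.s n ∘ₗ φ.1 ∘ₗ P.d n)
  have h3 : Q.d n ∘ₗ ψ = φ.1 ∘ₗ P.d n := P.ext (n + 1) (Q.b n) _ _ (h1.comp (Q.bd n)) ((P.bd n).comp φ.2.1)
    (fun x hx => by
      rw [LinearMap.comp_apply, h2 x hx]
      exact Q.d_s n _ (φ.2.2 _ (P.d_Z n x)))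
  refine ⟨⟨ψ, h1, fun x hx => ?_⟩, fun x => LinearMap.congr_fun h3 x⟩
  have := LinearMap.congr_fun h3 x
  have hx' : P.d n x = 0 := hx
  change Q.d n (ψ x) = 0
  rw [LinearMap.comp_apply, LinearMap.comp_apply, hx', map_zero] at this
  exact this

structure Mor where
  φ : ∀ n, N n →ₗ[k] N' n
  bi : ∀ n, IsBi (P.b n) (Q.b n) (φ n)
  eps : ∀ x, Q.eps (φ 0 x) = P.eps x
  comm : ∀ n x, Q.d n (φ (n + 1) x) = φ n (P.d n x)

theorem exists_mor : Nonempty (Mor P Q) := by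
  obtain ⟨z, hz⟩ := cm_zero P Q
  choose f hf using cm_succ P Q
  let F : ∀ n, CM P Q n := fun n => Nat.rec z (fun n p => f n p) n
  exact ⟨⟨fun n => (F n).1, fun n => (F n).2.1, hz, fun n x => hf n (F n) x⟩⟩

variable {P Q}

def Ho (φ ψ : Mor P Q) (n : ℕ) : Type := {h : N n →ₗ[k] N' (n + 1) // IsBi (P.b n) (Q.b (n + 1)) h ∧
  ∀ x ∈ P.Z n, Q.d n (h x) = φ.φ n x - ψ.φ n x}

theorem ho_zero (φ ψ : Mor P Q) : ∃ h : Ho φ ψ 0, ∀ x, Q.d 0 (h.1 x) = φ.φ 0 x - ψ.φ 0 x := by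
  obtain ⟨h, h1, h2⟩ := P.free 0 (Q.b 1) (Q.s 0 ∘ₗ (φ.φ 0 - ψ.φ 0))
  have h3 : Q.d 0 ∘ₗ h = φ.φ 0 - ψ.φ 0 := P.ext 0 (Q.b 0) _ _ (h1.comp (Q.bd 0)) ((φ.bi 0).sub (ψ.bi 0))
    (fun x hx => by
      rw [LinearMap.comp_apply, h2 x hx]
      refine Q.s0 _ ?_
      rw [LinearMap.sub_apply, map_sub, φ.eps, ψ.eps, sub_self])
  exact ⟨⟨h, h1, fun x _ => LinearMap.congr_fun h3 x⟩, fun x => LinearMap.congr_fun h3 x⟩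

theorem ho_succ (φ ψ : Mor P Q) (n : ℕ) (h : Ho φ ψ n) : ∃ g : Ho φ ψ (n + 1), ∀ x,
    Q.d (n + 1) (g.1 x) + h.1 (P.d n x) = φ.φ (n + 1) x - ψ.φ (n + 1) x := by
  obtain ⟨g, h1, h2⟩ := P.free (n + 1) (Q.b (n + 2)) (Q.s (n + 1) ∘ₗ (φ.φ (n + 1) - ψ.φ (n + 1) - h.1 ∘ₗ P.d n))
  have h3 : Q.d (n + 1) ∘ₗ g = φ.φ (n + 1) - ψ.φ (n + 1) - h.1 ∘ₗ P.d n :=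
    P.ext (n + 1) (Q.b (n + 1)) _ _ (h1.comp (Q.bd (n + 1)))
      (((φ.bi _).sub (ψ.bi _)).sub ((P.bd n).comp h.2.1))
    (fun x hx => by
      rw [LinearMap.comp_apply, h2 x hx]
      refine Q.s1 n _ ?_
      rw [LinearMap.sub_apply, LinearMap.sub_apply, map_sub, map_sub, φ.comm, ψ.comm, LinearMap.comp_apply,
        h.2.2 _ (P.d_Z n x), sub_self])
  have h4 : ∀ x, Q.d (n + 1) (g x) + h.1 (P.d n x) = φ.φ (n + 1) x - ψ.φ (n + 1) x := fun x => by
    have := LinearMap.congr_fun h3 x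
    rw [LinearMap.comp_apply] at this
    rw [this]
    exact sub_add_cancel _ _
  refine ⟨⟨g, h1, fun x hx => ?_⟩, h4⟩
  have hx' : P.d n x = 0 := hx
  have := h4 x
  rwa [hx', map_zero, add_zero] at this

theorem exists_ho (φ ψ : Mor P Q) : ∃ h : ∀ n, N n →ₗ[k] N' (n + 1), (∀ n, IsBi (P.b n) (Q.b (n + 1)) (h n)) ∧
    (∀ x, Q.d 0 (h 0 x) = φ.φ 0 x - ψ.φ 0 x) ∧
    ∀ n x, Q.d (n + 1) (h (n + 1) x) + h n (P.d n x) = φ.φ (n + 1) x - ψ.φ (n + 1) x := by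
  obtain ⟨z, hz⟩ := ho_zero φ ψ
  choose f hf using ho_succ φ ψ
  let F : ∀ n, Ho φ ψ n := fun n => Nat.rec z (fun n p => f n p) n
  exact ⟨fun n => (F n).1, fun n => (F n).2.1, hz, fun n x => hf n (F n) x⟩

def Mor.comp {N'' : ℕ → Type} [∀ n, AddCommGroup (N'' n)] [∀ n, Module k (N'' n)] {T : Res k E N''}
    (φ : Mor P Q) (ψ : Mor Q T) : Mor P T where
  φ n := ψ.φ n ∘ₗ φ.φ n
  bi n := (φ.bi n).comp (ψ.bi n)
  eps x := by rw [LinearMap.comp_apply, ψ.eps, φ.eps]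
  comm n x := by rw [LinearMap.comp_apply, ψ.comm, φ.comm]; rfl

variable (P) in
def Mor.id : Mor P P where
  φ n := LinearMap.id
  bi n := IsBi.id
  eps x := rfl
  comm n x := rfl

end Res

structure Coin (Bi : Bimod k E M) (b : Bimod k E X) (C : Type) [AddCommGroup C] [Module k C] where
  ev : M ⊗[k] X →ₗ[k] C
  inj : C →ₗ[k] M ⊗[k] X
  ev_inj : ∀ c, ev (inj c) = c
  ev_l : ∀ m e x, ev (m ⊗ₜ[k] b.l e x) = ev (Bi.r e m ⊗ₜ[k] x)
  ev_r : ∀ m e x, ev (m ⊗ₜ[k] b.r e x) = ev (Bi.l e m ⊗ₜ[k] x)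
  univ : ∀ {Z : Type} [AddCommGroup Z] [Module k Z] (f : M ⊗[k] X →ₗ[k] Z),
    (∀ m e x, f (m ⊗ₜ[k] b.l e x) = f (Bi.r e m ⊗ₜ[k] x)) →
    (∀ m e x, f (m ⊗ₜ[k] b.r e x) = f (Bi.l e m ⊗ₜ[k] x)) → ∀ z, f (inj (ev z)) = f z

variable {Bi : Bimod k E M}

def hat {b : Bimod k E X} {c : Bimod k E Y} (p : Coin Bi b C) (q : Coin Bi c D) (φ : X →ₗ[k] Y) : C →ₗ[k] D :=
  q.ev ∘ₗ LinearMap.lTensor M φ ∘ₗ p.inj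

theorem hat_comp {b : Bimod k E X} {c : Bimod k E Y} {b' : Bimod k E W} (p : Coin Bi b C) (q : Coin Bi c D)
    (t : Coin Bi b' D') {φ : X →ₗ[k] Y} {ψ : Y →ₗ[k] W} (hψ : IsBi c b' ψ) (x : C) :
    hat p t (ψ ∘ₗ φ) x = hat q t ψ (hat p q φ x) := by
  have := q.univ (t.ev ∘ₗ LinearMap.lTensor M ψ)
    (fun m e x => by
      simp only [LinearMap.comp_apply, LinearMap.lTensor_tmul]; rw [hψ.1, t.ev_l])
    (fun m e x => by
      simp only [LinearMap.comp_apply, LinearMap.lTensor_tmul]; rw [hψ.2, t.ev_r])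
    (LinearMap.lTensor M φ (p.inj x))
  simp only [hat, LinearMap.comp_apply] at this ⊢
  rw [this, LinearMap.lTensor_comp]; rfl

theorem hat_add {b : Bimod k E X} {c : Bimod k E Y} (p : Coin Bi b C) (q : Coin Bi c D) (φ ψ : X →ₗ[k] Y) (x : C) :
    hat p q (φ + ψ) x = hat p q φ x + hat p q ψ x := by
  simp only [hat, LinearMap.comp_apply, LinearMap.lTensor_add, LinearMap.add_apply, map_add]

theorem hat_sub {b : Bimod k E X} {c : Bimod k E Y} (p : Coin Bi b C) (q : Coin Bi c D) (φ ψ : X →ₗ[k] Y) (x : C) :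
    hat p q (φ - ψ) x = hat p q φ x - hat p q ψ x := by
  simp only [hat, LinearMap.comp_apply, LinearMap.lTensor_sub, LinearMap.sub_apply, map_sub]

theorem hat_id {b : Bimod k E X} (p : Coin Bi b C) (x : C) : hat p p LinearMap.id x = x := by
  simp only [hat, LinearMap.comp_apply, LinearMap.lTensor_id, LinearMap.id_apply, p.ev_inj]

section Homology

variable {C D : ℕ → Type} [∀ n, AddCommGroup (C n)] [∀ n, Module k (C n)]
  [∀ n, AddCommGroup (D n)] [∀ n, Module k (D n)]

def Hmap (dC : ∀ n : ℕ, C (n + 1) →ₗ[k] C n) (dD : ∀ n : ℕ, D (n + 1) →ₗ[k] D n)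
    (f : ∀ n, C n →ₗ[k] D n) (hf : ∀ n x, dD n (f (n + 1) x) = f n (dC n x)) :
    ∀ n, Hml k dC n →ₗ[k] Hml k dD n
  | 0 => Submodule.mapQ _ _ (f 0) (by
      rintro _ ⟨x, rfl⟩
      exact ⟨f 1 x, hf 0 x⟩)
  | n + 1 => Submodule.mapQ _ _ ((f (n + 1)).restrict (p := LinearMap.ker (dC n)) (q := LinearMap.ker (dD n))
      (fun x hx => by
        rw [LinearMap.mem_ker] at hx ⊢
        rw [hf, hx, map_zero])) (by
      rintro ⟨_, h⟩ ⟨x, rfl⟩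
      exact ⟨f (n + 2) x, hf (n + 1) x⟩)

theorem Hmap_comp (dC : ∀ n : ℕ, C (n + 1) →ₗ[k] C n) (dD : ∀ n : ℕ, D (n + 1) →ₗ[k] D n)
    (f : ∀ n, C n →ₗ[k] D n) (hf : ∀ n x, dD n (f (n + 1) x) = f n (dC n x))
    (g : ∀ n, D n →ₗ[k] C n) (hg : ∀ n x, dC n (g (n + 1) x) = g n (dD n x))
    (h : ∀ n, C n →ₗ[k] C (n + 1)) (h0 : ∀ x, dC 0 (h 0 x) = g 0 (f 0 x) - x)
    (h1 : ∀ n x, dC (n + 1) (h (n + 1) x) + h n (dC n x) = g (n + 1) (f (n + 1) x) - x) :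
    ∀ n, Hmap dD dC g hg n ∘ₗ Hmap dC dD f hf n = LinearMap.id
  | 0 => by
    apply Submodule.linearMap_qext
    ext x
    refine (Submodule.Quotient.eq _).2 ?_
    exact ⟨h 0 x, h0 x⟩
  | n + 1 => by
    apply Submodule.linearMap_qext
    ext x
    refine (Submodule.Quotient.eq _).2 ?_
    refine ⟨h (n + 1) x.1, ?_⟩
    have := h1 n x.1
    have hx : dC n x.1 = 0 := x.2
    rw [hx, map_zero, add_zero] at this
    exact this

end Homology

theorem comparison {N N' C D : ℕ → Type} [∀ n, AddCommGroup (N n)] [∀ n, Module k (N n)]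
    [∀ n, AddCommGroup (N' n)] [∀ n, Module k (N' n)] [∀ n, AddCommGroup (C n)] [∀ n, Module k (C n)]
    [∀ n, AddCommGroup (D n)] [∀ n, Module k (D n)] (P : Res k E N) (Q : Res k E N')
    (p : ∀ n, Coin Bi (P.b n) (C n)) (q : ∀ n, Coin Bi (Q.b n) (D n))
    (dC : ∀ n : ℕ, C (n + 1) →ₗ[k] C n) (dD : ∀ n : ℕ, D (n + 1) →ₗ[k] D n)
    (hC : ∀ n x, dC n x = hat (p (n + 1)) (p n) (P.d n) x)
    (hD : ∀ n x, dD n x = hat (q (n + 1)) (q n) (Q.d n) x) (n : ℕ) :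
    Nonempty (Hml k dC n ≃ₗ[k] Hml k dD n) := by
  obtain ⟨φ⟩ := Res.exists_mor P Q
  obtain ⟨ψ⟩ := Res.exists_mor Q P
  obtain ⟨h, hb, h0, h1⟩ := Res.exists_ho (φ.comp ψ) (Res.Mor.id P)
  obtain ⟨g, gb, g0, g1⟩ := Res.exists_ho (ψ.comp φ) (Res.Mor.id Q)
  have c1 : ∀ n x, dD n (hat (p (n + 1)) (q (n + 1)) (φ.φ (n + 1)) x) = hat (p n) (q n) (φ.φ n) (dC n x) := by
    intro n x
    rw [hC, hD, ← hat_comp _ _ _ (Q.bd n), ← hat_comp _ _ _ (φ.bi n),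
      show Q.d n ∘ₗ φ.φ (n + 1) = φ.φ n ∘ₗ P.d n from LinearMap.ext (φ.comm n)]
  have c2 : ∀ n x, dC n (hat (q (n + 1)) (p (n + 1)) (ψ.φ (n + 1)) x) = hat (q n) (p n) (ψ.φ n) (dD n x) := by
    intro n x
    rw [hC, hD, ← hat_comp _ _ _ (P.bd n), ← hat_comp _ _ _ (ψ.bi n),
      show P.d n ∘ₗ ψ.φ (n + 1) = ψ.φ n ∘ₗ Q.d n from LinearMap.ext (ψ.comm n)]
  have k1 := Hmap_comp dC dD (fun n => hat (p n) (q n) (φ.φ n)) c1 (fun n => hat (q n) (p n) (ψ.φ n)) c2 (fun n => hat (p n) (p (n + 1)) (h n))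
    (fun x => by
      beta_reduce
      rw [hC, ← hat_comp _ _ _ (P.bd 0), ← hat_comp _ _ _ (ψ.bi 0), show P.d 0 ∘ₗ h 0 = ψ.φ 0 ∘ₗ φ.φ 0 - LinearMap.id from LinearMap.ext h0,
        hat_sub, hat_id])
    (fun n x => by
      beta_reduce
      rw [hC, hC, ← hat_comp _ _ _ (P.bd (n + 1)), ← hat_comp _ _ _ (ψ.bi (n + 1)), ← hat_comp _ _ _ (hb n),
        ← hat_add, show P.d (n + 1) ∘ₗ h (n + 1) + h n ∘ₗ P.d n = ψ.φ (n + 1) ∘ₗ φ.φ (n + 1) - LinearMap.id from LinearMap.ext (h1 n),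
        hat_sub, hat_id])
  have k2 := Hmap_comp dD dC (fun n => hat (q n) (p n) (ψ.φ n)) c2 (fun n => hat (p n) (q n) (φ.φ n)) c1 (fun n => hat (q n) (q (n + 1)) (g n))
    (fun x => by
      beta_reduce
      rw [hD, ← hat_comp _ _ _ (Q.bd 0), ← hat_comp _ _ _ (φ.bi 0), show Q.d 0 ∘ₗ g 0 = φ.φ 0 ∘ₗ ψ.φ 0 - LinearMap.id from LinearMap.ext g0,
        hat_sub, hat_id])
    (fun n x => by
      beta_reduce
      rw [hD, hD, ← hat_comp _ _ _ (Q.bd (n + 1)), ← hat_comp _ _ _ (φ.bi (n + 1)), ← hat_comp _ _ _ (gb n),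
        ← hat_add, show Q.d (n + 1) ∘ₗ g (n + 1) + g n ∘ₗ Q.d n = φ.φ (n + 1) ∘ₗ ψ.φ (n + 1) - LinearMap.id from LinearMap.ext (g1 n),
        hat_sub, hat_id])
  exact ⟨LinearEquiv.ofLinear _ _ (k2 n) (k1 n)⟩

end PComp


section PBar

variable {k E M X Y W T T' C : Type} [CommRing k] [Ring E] [Algebra k E] [AddCommGroup M] [Module k M]
  [AddCommGroup X] [Module k X] [AddCommGroup Y] [Module k Y] [AddCommGroup W] [Module k W]
  [AddCommGroup T] [Module k T] [AddCommGroup T'] [Module k T'] [AddCommGroup C] [Module k C]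

def IsFree (b : Bimod k E X) (g : T →ₗ[k] X) : Prop :=
  (∀ {W : Type} [AddCommGroup W] [Module k W] (c : Bimod k E W) (P : T →ₗ[k] W),
    ∃ φ : X →ₗ[k] W, IsBi b c φ ∧ ∀ t, φ (g t) = P t) ∧
  (∀ {W : Type} [AddCommGroup W] [Module k W] (c : Bimod k E W) (φ ψ : X →ₗ[k] W),
    IsBi b c φ → IsBi b c ψ → (∀ t, φ (g t) = ψ (g t)) → φ = ψ)

def homBi (Bi : Bimod k E M) (Z : Type) [AddCommGroup Z] [Module k Z] : Bimod k E (M →ₗ[k] Z) where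
  l := (LinearMap.llcomp k M M Z).flip ∘ₗ Bi.r
  r := (LinearMap.llcomp k M M Z).flip ∘ₗ Bi.l
  l_one := by ext f m; simp [Bi.r_one]
  r_one := by ext f m; simp [Bi.l_one]
  l_mul x y := by ext f m; simp [Bi.r_mul]
  r_mul x y := by ext f m; simp [Bi.l_mul]
  lr_comm x y := by
    ext f m
    have := LinearMap.congr_fun (Bi.lr_comm y x) m
    simp only [LinearMap.comp_apply] at this
    simp [this]

theorem homBi_l (Bi : Bimod k E M) (e : E) (f : M →ₗ[k] W) (m : M) : (homBi Bi W).l e f m = f (Bi.r e m) := rfl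
theorem homBi_r (Bi : Bimod k E M) (e : E) (f : M →ₗ[k] W) (m : M) : (homBi Bi W).r e f m = f (Bi.l e m) := rfl

theorem IsFree.coin (Bi : Bimod k E M) {b : Bimod k E X} {g : T →ₗ[k] X} (h : IsFree b g) :
    ∃ p : Coin Bi b (M ⊗[k] T), (∀ m t, p.ev (m ⊗ₜ[k] g t) = m ⊗ₜ[k] t) ∧ p.inj = LinearMap.lTensor M g := by
  obtain ⟨φ, hφ, hg⟩ := h.1 (homBi Bi (M ⊗[k] T)) (TensorProduct.mk k M T).flip
  have e1 : ∀ m t, TensorProduct.lift φ.flip (m ⊗ₜ[k] g t) = m ⊗ₜ[k] t := fun m t => by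
    rw [TensorProduct.lift.tmul, LinearMap.flip_apply, hg]; rfl
  have e2 : ∀ m e x, TensorProduct.lift φ.flip (m ⊗ₜ[k] b.l e x) = TensorProduct.lift φ.flip (Bi.r e m ⊗ₜ[k] x) :=
    fun m e x => by
      rw [TensorProduct.lift.tmul, LinearMap.flip_apply, hφ.1, homBi_l, TensorProduct.lift.tmul, LinearMap.flip_apply]
  have e3 : ∀ m e x, TensorProduct.lift φ.flip (m ⊗ₜ[k] b.r e x) = TensorProduct.lift φ.flip (Bi.l e m ⊗ₜ[k] x) :=
    fun m e x => by
      rw [TensorProduct.lift.tmul, LinearMap.flip_apply, hφ.2, homBi_r, TensorProduct.lift.tmul, LinearMap.flip_apply]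
  refine ⟨⟨TensorProduct.lift φ.flip, LinearMap.lTensor M g, ?_, e2, e3, ?_⟩, e1, rfl⟩
  · intro c
    have : TensorProduct.lift φ.flip ∘ₗ LinearMap.lTensor M g = LinearMap.id := by
      apply TensorProduct.ext'
      intro m t
      rw [LinearMap.comp_apply, LinearMap.lTensor_tmul, e1]; rfl
    exact LinearMap.congr_fun this c
  · intro Z _ _ f hl hr z
    have : (TensorProduct.curry (f ∘ₗ LinearMap.lTensor M g ∘ₗ TensorProduct.lift φ.flip)).flip =
        (TensorProduct.curry f).flip := by
      refine h.2 (homBi Bi Z) _ _ ⟨fun e x => ?_, fun e x => ?_⟩ ⟨fun e x => ?_, fun e x => ?_⟩ (fun t => ?_)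
      · ext m; rw [homBi_l]; simp only [LinearMap.flip_apply, TensorProduct.curry_apply, LinearMap.comp_apply]; rw [e2]
      · ext m; rw [homBi_r]; simp only [LinearMap.flip_apply, TensorProduct.curry_apply, LinearMap.comp_apply]; rw [e3]
      · ext m; rw [homBi_l]; simp only [LinearMap.flip_apply, TensorProduct.curry_apply]; rw [hl]
      · ext m; rw [homBi_r]; simp only [LinearMap.flip_apply, TensorProduct.curry_apply]; rw [hr]
      · ext m; simp only [LinearMap.flip_apply, TensorProduct.curry_apply, LinearMap.comp_apply]
        rw [e1, LinearMap.lTensor_tmul]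
    have h2 : f ∘ₗ LinearMap.lTensor M g ∘ₗ TensorProduct.lift φ.flip = f := by
      apply TensorProduct.ext'
      intro m x
      exact LinearMap.congr_fun (LinearMap.congr_fun this x) m
    exact LinearMap.congr_fun h2 z

theorem IsFree.equiv {b : Bimod k E X} {c : Bimod k E Y} {g : T →ₗ[k] X} (h : IsFree b g) (u : X ≃ₗ[k] Y)
    (hu : IsBi b c u.toLinearMap) (hu' : IsBi c b u.symm.toLinearMap) : IsFree c (u.toLinearMap ∘ₗ g) := by
  refine ⟨fun {W} _ _ c' P => ?_, fun {W} _ _ c' φ ψ h1 h2 h3 => ?_⟩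
  · obtain ⟨φ, h1, h2⟩ := h.1 c' P
    exact ⟨φ ∘ₗ u.symm.toLinearMap, hu'.comp h1, fun t => by simp [h2]⟩
  · have := h.2 c' (φ ∘ₗ u.toLinearMap) (ψ ∘ₗ u.toLinearMap) (hu.comp h1) (hu.comp h2) h3
    ext y
    simpa using LinearMap.congr_fun this (u.symm y)

variable (k E T) in
def stdBi : Bimod k E (E ⊗[k] (T ⊗[k] E)) where
  l := (LinearMap.rTensorHom (T ⊗[k] E)).comp (LinearMap.mul k E)
  r := (LinearMap.lTensorHom E).comp ((LinearMap.lTensorHom T).comp (LinearMap.mul k E).flip)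
  l_one := by ext; simp
  r_one := by ext; simp
  l_mul x y := by ext; simp [mul_assoc]
  r_mul x y := by ext; simp [mul_assoc]
  lr_comm x y := by ext; simp

theorem stdBi_l (e x : E) (t : T) (y : E) : (stdBi k E T).l e (x ⊗ₜ[k] (t ⊗ₜ[k] y)) = (e * x) ⊗ₜ[k] (t ⊗ₜ[k] y) := rfl
theorem stdBi_r (e x : E) (t : T) (y : E) : (stdBi k E T).r e (x ⊗ₜ[k] (t ⊗ₜ[k] y)) = x ⊗ₜ[k] (t ⊗ₜ[k] (y * e)) := rfl
theorem stdBi_l' (e x : E) (z : T ⊗[k] E) : (stdBi k E T).l e (x ⊗ₜ[k] z) = (e * x) ⊗ₜ[k] z := rfl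

variable (k E T) in
def stdG : T →ₗ[k] E ⊗[k] (T ⊗[k] E) := (TensorProduct.mk k E (T ⊗[k] E) 1) ∘ₗ (TensorProduct.mk k T E).flip 1

theorem stdG_apply (t : T) : stdG k E T t = 1 ⊗ₜ[k] (t ⊗ₜ[k] 1) := rfl

theorem std_eq (x : E) (t : T) (y : E) :
    x ⊗ₜ[k] (t ⊗ₜ[k] y) = (stdBi k E T).l x ((stdBi k E T).r y (stdG k E T t)) := by
  rw [stdG_apply, stdBi_r, stdBi_l, one_mul, mul_one]

theorem std_free : IsFree (stdBi k E T) (stdG k E T) := by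
  refine ⟨fun {W} _ _ c P => ?_, fun {W} _ _ c φ ψ h1 h2 h3 => ?_⟩
  · refine ⟨TensorProduct.lift c.l ∘ₗ LinearMap.lTensor E (TensorProduct.lift c.r ∘ₗ
      (TensorProduct.comm k W E).toLinearMap ∘ₗ LinearMap.rTensor E P), ⟨fun e x => ?_, fun e x => ?_⟩, fun t => ?_⟩
    · rw [← LinearMap.comp_apply, ← LinearMap.comp_apply]
      congr 1
      ext x t y
      simp [stdBi, c.l_mul]
    · rw [← LinearMap.comp_apply, ← LinearMap.comp_apply]
      congr 1
      ext x t y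
      have := LinearMap.congr_fun (c.lr_comm x e) (c.r y (P t))
      simp only [LinearMap.comp_apply] at this
      simp [stdBi, c.r_mul, this]
    · simp [stdG_apply, c.l_one, c.r_one]
  · ext x t y
    change φ (x ⊗ₜ[k] (t ⊗ₜ[k] y)) = ψ (x ⊗ₜ[k] (t ⊗ₜ[k] y))
    rw [std_eq, h1.1, h1.2, h2.1, h2.2, h3]


theorem IsFree.directSum {ι : Type} [DecidableEq ι] {X T : ι → Type} [∀ i, AddCommGroup (X i)] [∀ i, Module k (X i)]
    [∀ i, AddCommGroup (T i)] [∀ i, Module k (T i)] {b : ∀ i, Bimod k E (X i)} {g : ∀ i, T i →ₗ[k] X i}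
    (h : ∀ i, IsFree (b i) (g i)) (c : Bimod k E (⨁ i, X i)) (hc : ∀ i, IsBi (b i) c (DirectSum.lof k ι X i)) :
    IsFree c (DirectSum.toModule k ι (⨁ i, X i) (fun i => DirectSum.lof k ι X i ∘ₗ g i)) := by
  refine ⟨fun {W} _ _ c' P => ?_, fun {W} _ _ c' φ ψ h1 h2 h3 => ?_⟩
  · have := fun i => (h i).1 c' (P ∘ₗ DirectSum.lof k ι T i)
    choose φ h1 h2 using this
    refine ⟨DirectSum.toModule k ι W φ, ⟨fun e x => ?_, fun e x => ?_⟩, fun t => ?_⟩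
    · rw [← LinearMap.comp_apply, ← LinearMap.comp_apply]
      congr 1
      refine DirectSum.linearMap_ext _ fun i => LinearMap.ext fun x => ?_
      simp only [LinearMap.comp_apply, DirectSum.toModule_lof]
      rw [← (hc i).1, DirectSum.toModule_lof, (h1 i).1]
    · rw [← LinearMap.comp_apply, ← LinearMap.comp_apply]
      congr 1
      refine DirectSum.linearMap_ext _ fun i => LinearMap.ext fun x => ?_
      simp only [LinearMap.comp_apply, DirectSum.toModule_lof]
      rw [← (hc i).2, DirectSum.toModule_lof, (h1 i).2]
    · rw [← LinearMap.comp_apply]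
      congr 1
      refine DirectSum.linearMap_ext _ fun i => LinearMap.ext fun x => ?_
      simp only [LinearMap.comp_apply, DirectSum.toModule_lof]
      rw [h2]; rfl
  · refine DirectSum.linearMap_ext _ fun i => ?_
    refine (h i).2 c' _ _ ((hc i).comp h1) ((hc i).comp h2) (fun t => ?_)
    have := h3 (DirectSum.lof k ι T i t)
    rwa [DirectSum.toModule_lof] at this

/-! bar resolution -/

variable (k E) in
abbrev Br (n : ℕ) : Type := E ⊗[k] (Tpow k (Qbar k E) n ⊗[k] E)

variable (k E) in
def brs (n : ℕ) : Br k E n →ₗ[k] Br k E (n + 1) :=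
  TensorProduct.mk k E _ 1 ∘ₗ TensorProduct.lift
    ((LinearMap.rTensorHom E).comp ((tcons (V := Qbar k E) (n := n)) ∘ₗ qbar k E))

theorem brs_apply (n : ℕ) (x : E) (t : Tpow k (Qbar k E) n) (y : E) :
    brs k E n (x ⊗ₜ[k] (t ⊗ₜ[k] y)) = 1 ⊗ₜ[k] (tcons (qbar k E x) t ⊗ₜ[k] y) := rfl

theorem brs_one (n : ℕ) (z : Tpow k (Qbar k E) n ⊗[k] E) : brs k E n (1 ⊗ₜ[k] z) = 0 := by
  change TensorProduct.mk k E _ 1 (LinearMap.rTensor E (tcons (qbar k E 1)) z) = 0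
  rw [qbar_one]
  simp

theorem brs_brs (n : ℕ) (z : Br k E n) : brs k E (n + 1) (brs k E n z) = 0 := brs_one _ _

theorem brs_r (n : ℕ) (e : E) (z : Br k E n) :
    brs k E n ((stdBi k E _).r e z) = (stdBi k E _).r e (brs k E n z) := by
  rw [← LinearMap.comp_apply, ← LinearMap.comp_apply]
  congr 1
  ext x t y
  rfl

theorem br_zero : ∃ d : Br k E 1 →ₗ[k] Br k E 0, IsBi (stdBi k E _) (stdBi k E _) d ∧
    ∀ x : E, d (stdG k E _ (tcons (qbar k E x) tone)) = x ⊗ₜ[k] (tone ⊗ₜ[k] 1) - 1 ⊗ₜ[k] (tone ⊗ₜ[k] x) := by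
  let P0 : E →ₗ[k] Br k E 0 := (TensorProduct.mk k E _).flip (tone ⊗ₜ[k] 1) - 
    TensorProduct.mk k E _ 1 ∘ₗ TensorProduct.mk k _ E tone
  have hP : unitSub k E ≤ LinearMap.ker P0 := by
    rintro _ ⟨c, rfl⟩
    simp [P0, Algebra.algebraMap_eq_smul_one, TensorProduct.smul_tmul]
  obtain ⟨d, hd, hg⟩ := (std_free (k := k) (E := E) (T := Tpow k (Qbar k E) 1)).1 (stdBi k E _)
    (tlift (N := Br k E 0) (tlift0 (N := Qbar k E →ₗ[k] Br k E 0) ((unitSub k E).liftQ P0 hP)).flip)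
  refine ⟨d, hd, fun x => ?_⟩
  rw [hg, tlift_tcons, LinearMap.flip_apply, tlift0_tone]
  rfl

theorem br_succ (n : ℕ) (d : Br k E (n + 1) →ₗ[k] Br k E n)
    (h : ∀ t, brs k E n (d (stdG k E _ t)) = stdG k E _ t) :
    ∃ d' : Br k E (n + 2) →ₗ[k] Br k E (n + 1), IsBi (stdBi k E _) (stdBi k E _) d' ∧
    ∀ (x : E) (t : Tpow k (Qbar k E) (n + 1)), d' (stdG k E _ (tcons (qbar k E x) t)) =
      x ⊗ₜ[k] (t ⊗ₜ[k] 1) - brs k E n (d (x ⊗ₜ[k] (t ⊗ₜ[k] 1))) := by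
  let P0 : E →ₗ[k] Tpow k (Qbar k E) (n + 1) →ₗ[k] Br k E (n + 1) := 
    LinearMap.llcomp k _ _ _ (LinearMap.id - brs k E n ∘ₗ d) ∘ₗ
      ((LinearMap.llcomp k (Tpow k (Qbar k E) (n + 1)) _ (Br k E (n + 1))).flip 
        ((TensorProduct.mk k (Tpow k (Qbar k E) (n + 1)) E).flip 1) ∘ₗ TensorProduct.mk k E (Tpow k (Qbar k E) (n + 1) ⊗[k] E))
  have hP0 : ∀ x t, P0 x t = x ⊗ₜ[k] (t ⊗ₜ[k] 1) - brs k E n (d (x ⊗ₜ[k] (t ⊗ₜ[k] 1))) := fun x t => rfl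
  have hP : unitSub k E ≤ LinearMap.ker P0 := by
    rintro _ ⟨c, rfl⟩
    rw [LinearMap.mem_ker]
    change P0 (algebraMap k E c) = 0
    rw [Algebra.algebraMap_eq_smul_one, map_smul]
    suffices P0 1 = 0 by rw [this, smul_zero]
    ext t
    rw [hP0]
    have := h t
    rw [stdG_apply] at this
    rw [this, sub_self]; rfl
  obtain ⟨d', hd, hg⟩ := (std_free (k := k) (E := E) (T := Tpow k (Qbar k E) (n + 2))).1 (stdBi k E _)
    (tlift (N := Br k E (n + 1)) ((unitSub k E).liftQ P0 hP))
  refine ⟨d', hd, fun x t => ?_⟩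
  rw [hg, tlift_tcons]
  rfl

theorem tcons_qext {n : ℕ} {f g : Tpow k (Qbar k E) (n + 1) →ₗ[k] W}
    (h : ∀ x t, f (tcons (qbar k E x) t) = g (tcons (qbar k E x) t)) : f = g := by
  apply tlift_ext
  intro v t
  obtain ⟨x, rfl⟩ := qbar_surj v
  exact h x t

variable (k E) in
theorem br_exists : ∃ d : ∀ n, Br k E (n + 1) →ₗ[k] Br k E n, (∀ n, IsBi (stdBi k E _) (stdBi k E _) (d n)) ∧
    (∀ x : E, d 0 (stdG k E _ (tcons (qbar k E x) tone)) = x ⊗ₜ[k] (tone ⊗ₜ[k] 1) - 1 ⊗ₜ[k] (tone ⊗ₜ[k] x)) ∧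
    (∀ (n : ℕ) (x : E) (t : Tpow k (Qbar k E) (n + 1)), d (n + 1) (stdG k E _ (tcons (qbar k E x) t)) =
      x ⊗ₜ[k] (t ⊗ₜ[k] 1) - brs k E n (d n (x ⊗ₜ[k] (t ⊗ₜ[k] 1)))) := by
  obtain ⟨z, z1, z2⟩ := br_zero (k := k) (E := E)
  choose f f1 f2 using br_succ (k := k) (E := E)
  let F : ∀ n, {d : Br k E (n + 1) →ₗ[k] Br k E n // IsBi (stdBi k E _) (stdBi k E _) d ∧ 
      ∀ t, brs k E n (d (stdG k E _ t)) = stdG k E _ t} := fun n => Nat.rec ⟨z, z1, by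
        intro t
        rw [← LinearMap.comp_apply, ← LinearMap.comp_apply]
        congr 1
        apply tcons_qext
        intro x s
        have : (brs k E 0 ∘ₗ z ∘ₗ stdG k E _) ∘ₗ tcons (qbar k E x) = stdG k E _ ∘ₗ tcons (qbar k E x) := by
          apply tzero_ext
          rw [LinearMap.comp_apply, LinearMap.comp_apply, LinearMap.comp_apply, z2, map_sub, brs_apply, brs_one, sub_zero]
          rfl
        exact LinearMap.congr_fun this s⟩ (fun n p => ⟨f n p.1 p.2.2, f1 n p.1 p.2.2, by
        intro t
        rw [← LinearMap.comp_apply, ← LinearMap.comp_apply]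
        congr 1
        apply tcons_qext
        intro x s
        rw [LinearMap.comp_apply, LinearMap.comp_apply, f2, map_sub, brs_brs, sub_zero]
        rfl⟩) n
  exact ⟨fun n => (F n).1, fun n => (F n).2.1, z2, fun n x t => f2 n (F n).1 (F n).2.2 x t⟩

end PBar


section PBar2

variable {k E M W : Type} [CommRing k] [Ring E] [Algebra k E] [AddCommGroup M] [Module k M]
  [AddCommGroup W] [Module k W]

variable (k E) in
def breps : Br k E 0 →ₗ[k] E :=
  LinearMap.mul' k E ∘ₗ LinearMap.lTensor E (TensorProduct.lift (tlift0 (LinearMap.id : E →ₗ[k] E)))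

theorem breps_apply (x y : E) : breps k E (x ⊗ₜ[k] ((tone : Tpow k (Qbar k E) 0) ⊗ₜ[k] y)) = x * y := by
  rw [breps, LinearMap.comp_apply, LinearMap.lTensor_tmul, TensorProduct.lift.tmul, tlift0_tone]; rfl

theorem br0_ext {f g : Br k E 0 →ₗ[k] W} (h : ∀ x y, f (x ⊗ₜ[k] (tone ⊗ₜ[k] y)) = g (x ⊗ₜ[k] (tone ⊗ₜ[k] y))) :
    f = g := by
  apply TensorProduct.ext
  ext x : 1
  apply TensorProduct.ext
  apply tzero_ext
  ext y
  exact h x y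

theorem br_ext {n : ℕ} {f g : Br k E n →ₗ[k] W} (h : ∀ x t y, f (x ⊗ₜ[k] (t ⊗ₜ[k] y)) = g (x ⊗ₜ[k] (t ⊗ₜ[k] y))) :
    f = g := by
  ext x t y
  exact h x t y

theorem breps_bi : IsBi (stdBi k E _) (regBi k E) (breps k E) := by
  refine ⟨fun e x => ?_, fun e x => ?_⟩ <;>
  · rw [← LinearMap.comp_apply, ← LinearMap.comp_apply]
    congr 1
    apply br0_ext
    intro x y
    rw [LinearMap.comp_apply, LinearMap.comp_apply]
    first
    | rw [stdBi_l, breps_apply, breps_apply, mul_assoc]; rfl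
    | rw [stdBi_r, breps_apply, breps_apply, ← mul_assoc]; rfl

theorem mulAt_succ {n : ℕ} (x : Fin (n + 2) → E) (i : Fin n) :
    (fun j => mulAt x i.succ j) = Fin.cons (x 0) (mulAt (fun i => x i.succ) i) := by
  funext j
  refine Fin.cases ?_ (fun j => ?_) j
  · simp [mulAt]
  · simp [mulAt]

theorem mulAt_zero {n : ℕ} (x : Fin (n + 2) → E) :
    (fun j => mulAt x 0 j) = (Fin.cons (x 0 * x 1) (fun i => x i.succ.succ) : Fin (n + 1) → E) := by
  funext j
  refine Fin.cases ?_ (fun j => ?_) j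
  · simp [mulAt]
  · simp [mulAt]

def brg {n : ℕ} (e : E) (x : Fin n → E) (e' : E) : Br k E n := e ⊗ₜ[k] (tp k (fun i => qbar k E (x i)) ⊗ₜ[k] e')

theorem brs_brg {n : ℕ} (e : E) (x : Fin n → E) (e' : E) :
    brs k E n (brg e x e') = brg 1 (Fin.cons e x) e' := rfl

theorem l_brg {n : ℕ} (a e : E) (x : Fin n → E) (e' : E) :
    (stdBi k E _).l a (brg (k := k) e x e') = brg (a * e) x e' := rfl

theorem br_formula (d : ∀ n, Br k E (n + 1) →ₗ[k] Br k E n) (hb : ∀ n, IsBi (stdBi k E _) (stdBi k E _) (d n))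
    (h0 : ∀ x : E, d 0 (stdG k E _ (tcons (qbar k E x) tone)) = x ⊗ₜ[k] (tone ⊗ₜ[k] 1) - 1 ⊗ₜ[k] (tone ⊗ₜ[k] x))
    (h1 : ∀ (n : ℕ) (x : E) (t : Tpow k (Qbar k E) (n + 1)), d (n + 1) (stdG k E _ (tcons (qbar k E x) t)) =
      x ⊗ₜ[k] (t ⊗ₜ[k] 1) - brs k E n (d n (x ⊗ₜ[k] (t ⊗ₜ[k] 1)))) :
    ∀ n (x : Fin (n + 1) → E), d n (brg 1 x 1) = brg (x 0) (fun i : Fin n => x i.succ) 1 +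
      (∑ i : Fin n, ((-1 : ℤ) ^ ((i : ℕ) + 1)) • brg 1 (fun j => mulAt x i j) 1) +
      ((-1 : ℤ) ^ (n + 1)) • brg 1 (fun i : Fin n => x i.castSucc) (x (Fin.last n))
  | 0, x => by
    refine (h0 (x 0)).trans ?_
    simp only [Finset.univ_eq_empty, Finset.sum_empty, add_zero, zero_add, pow_one, neg_smul, one_smul,
      ← sub_eq_add_neg]
    rfl
  | n + 1, x => by
    have ih := br_formula d hb h0 h1 n (fun i => x i.succ)
    refine (h1 n (x 0) _).trans ?_
    have e1 : (x 0 ⊗ₜ[k] ((tp k fun i : Fin (n + 1) => qbar k E (x i.succ)) ⊗ₜ[k] (1 : E)) : Br k E (n + 1)) =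
      (stdBi k E _).l (x 0) (brg 1 (fun i => x i.succ) 1) := by
        rw [l_brg, mul_one]; rfl
    have e2 : (x 0 ⊗ₜ[k] ((tp k fun i : Fin (n + 1) => qbar k E (x i.succ)) ⊗ₜ[k] (1 : E)) : Br k E (n + 1)) =
      brg (x 0) (fun i => x i.succ) 1 := rfl
    rw [e2, ← mul_one (x 0), ← l_brg, (hb n).1, ih]
    simp only [map_add, map_sum, map_smul, map_zsmul, l_brg, brs_brg, mul_one]
    rw [Fin.sum_univ_succ, mulAt_zero]
    simp only [mulAt_succ]
    have e3 : (Fin.cons (x 0) fun i : Fin n => x i.castSucc.succ) = fun i : Fin (n + 1) => x i.castSucc := by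
      funext j
      refine Fin.cases rfl (fun j => rfl) j
    rw [e3]
    simp only [Fin.val_succ, Fin.val_zero, pow_succ, mul_neg, mul_one, neg_smul, Finset.sum_neg_distrib, pow_zero,
      one_smul, Fin.succ_last, neg_neg, zero_add]
    simp only [Fin.succ_zero_eq_one]
    abel

theorem hat_apply {X Y C D : Type} [AddCommGroup X] [Module k X] [AddCommGroup Y] [Module k Y] [AddCommGroup C]
    [Module k C] [AddCommGroup D] [Module k D] {Bi : Bimod k E M} {b : Bimod k E X} {c : Bimod k E Y}
    (p : Coin Bi b C) (q : Coin Bi c D) (φ : X →ₗ[k] Y) (z : C) (m : M) (x : X) (hz : p.inj z = m ⊗ₜ[k] x) :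
    hat p q φ z = q.ev (m ⊗ₜ[k] φ x) := by
  rw [hat, LinearMap.comp_apply, LinearMap.comp_apply, hz, LinearMap.lTensor_tmul]

theorem bar_main (Bi : Bimod k E M) (bd : ∀ n : ℕ, HCh k E M (n + 1) →ₗ[k] HCh k E M n)
    (hbd : IsHochschildD k Bi.l Bi.r bd) :
    ∃ (P : Res k E (Br k E)) (p : ∀ n, Coin Bi (P.b n) (HCh k E M n)),
      ∀ n x, bd n x = hat (p (n + 1)) (p n) (P.d n) x := by
  obtain ⟨d, hb, h0, h1⟩ := br_exists k E
  have hf := br_formula d hb h0 h1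
  have ds0 : ∀ x : Br k E 0, d 0 (brs k E 0 x) = x - 1 ⊗ₜ[k] (tone ⊗ₜ[k] breps k E x) := by
    intro x
    have : d 0 ∘ₗ brs k E 0 = LinearMap.id - TensorProduct.mk k E _ 1 ∘ₗ TensorProduct.mk k _ E tone ∘ₗ breps k E := by
      apply br0_ext
      intro x y
      have e : (1 ⊗ₜ[k] (tcons (qbar k E x) tone ⊗ₜ[k] y) : Br k E 1) = 
        (stdBi k E _).r y (stdG k E _ (tcons (qbar k E x) tone)) := by
          rw [stdG_apply, stdBi_r, one_mul]
      rw [LinearMap.comp_apply, brs_apply, e, (hb 0).2, h0, map_sub, stdBi_r, stdBi_r, one_mul, LinearMap.sub_apply,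
        LinearMap.comp_apply, LinearMap.comp_apply, breps_apply]
      rfl
    exact LinearMap.congr_fun this x
  have ds : ∀ n (x : Br k E (n + 1)), d (n + 1) (brs k E (n + 1) x) = x - brs k E n (d n x) := by
    intro n x
    have : d (n + 1) ∘ₗ brs k E (n + 1) = LinearMap.id - brs k E n ∘ₗ d n := by
      apply br_ext
      intro x t y
      have e : (1 ⊗ₜ[k] (tcons (qbar k E x) t ⊗ₜ[k] y) : Br k E (n + 2)) = 
        (stdBi k E _).r y (stdG k E _ (tcons (qbar k E x) t)) := by
          rw [stdG_apply, stdBi_r, one_mul]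
      have e' : (x ⊗ₜ[k] (t ⊗ₜ[k] y) : Br k E (n + 1)) = 
        (stdBi k E _).r y (x ⊗ₜ[k] (t ⊗ₜ[k] 1)) := by
          rw [stdBi_r, one_mul]
      rw [LinearMap.comp_apply, brs_apply, e, (hb (n + 1)).2, h1, map_sub, LinearMap.sub_apply, LinearMap.comp_apply,
        e', (hb n).2, brs_r]
      rfl
    exact LinearMap.congr_fun this x
  have deps : ∀ x, breps k E (d 0 x) = 0 := by
    intro x
    have : breps k E ∘ₗ d 0 = 0 := by
      refine std_free.2 (regBi k E) _ _ ((hb 0).comp breps_bi) ⟨fun _ _ => by simp, fun _ _ => by simp⟩ (fun t => ?_)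
      rw [← LinearMap.comp_apply, ← LinearMap.comp_apply (0 : Br k E 1 →ₗ[k] E)]
      congr 1
      apply tcons_qext
      intro x s
      have : ((breps k E ∘ₗ d 0) ∘ₗ stdG k E _) ∘ₗ tcons (qbar k E x) = 0 := by
        apply tzero_ext
        rw [LinearMap.comp_apply, LinearMap.comp_apply, LinearMap.comp_apply, h0, map_sub, breps_apply, breps_apply,
          mul_one, one_mul, sub_self]; rfl
      exact LinearMap.congr_fun this s
    exact LinearMap.congr_fun this x
  have dd : ∀ n x, d n (d (n + 1) x) = 0 := by
    have key : ∀ n, (∀ x t, d n (d (n + 1) (stdG k E _ (tcons (qbar k E x) t))) = 0) → ∀ x, d n (d (n + 1) x) = 0 := by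
      intro n H x
      have : d n ∘ₗ d (n + 1) = 0 := by
        refine std_free.2 (stdBi k E _) _ _ ((hb (n + 1)).comp (hb n)) ⟨fun _ _ => by simp, fun _ _ => by simp⟩ (fun t => ?_)
        rw [← LinearMap.comp_apply, ← LinearMap.comp_apply (0 : Br k E (n + 2) →ₗ[k] Br k E n)]
        congr 1
        apply tcons_qext
        intro x s
        exact H x s
      exact LinearMap.congr_fun this x
    intro n
    induction n with
    | zero =>
      apply key
      intro x t
      rw [h1, map_sub, ds0, deps, TensorProduct.tmul_zero, TensorProduct.tmul_zero, sub_zero, sub_self]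
    | succ n ih =>
      apply key
      intro x t
      rw [h1, map_sub, ds, ih, map_zero, sub_zero, sub_self]
  let P : Res k E (Br k E) :=
    { b := fun n => stdBi k E _
      d := d
      bd := hb
      eps := breps k E
      beps := breps_bi
      eps_d := deps
      dd := dd
      sm := TensorProduct.mk k E _ 1 ∘ₗ TensorProduct.mk k _ E tone
      eps_sm := fun e => by
        rw [LinearMap.comp_apply]
        exact (breps_apply 1 e).trans (one_mul e)
      s := brs k E
      s0 := fun x hx => by rw [ds0, hx, TensorProduct.tmul_zero, TensorProduct.tmul_zero, sub_zero]
      s1 := fun n x hx => by rw [ds, hx, map_zero, sub_zero]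
      G := fun n => Set.range (stdG k E _)
      free := fun n {W} _ _ c Q => by
        obtain ⟨φ, h1, h2⟩ := (std_free (k := k) (E := E) (T := Tpow k (Qbar k E) n)).1 c (Q ∘ₗ stdG k E _)
        exact ⟨φ, h1, by rintro _ ⟨t, rfl⟩; exact h2 t⟩
      ext := fun n {W} _ _ c φ ψ h1 h2 h3 => std_free.2 c φ ψ h1 h2 fun t => h3 _ ⟨t, rfl⟩ }
  have hp := fun n => (std_free (k := k) (E := E) (T := Tpow k (Qbar k E) n)).coin Bi
  choose p p1 p2 using hp
  refine ⟨P, p, fun n => ?_⟩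
  suffices bd n = hat (p (n + 1)) (p n) (P.d n) from fun x => LinearMap.congr_fun this x
  apply TensorProduct.ext
  ext m : 1
  apply tpow_ext (qbar k E) qbar_surj
  intro x
  have ev : ∀ n e (y : Fin n → E) e', (p n).ev (m ⊗ₜ[k] brg e y e') =
      Bi.l e' (Bi.r e m) ⊗ₜ[k] tp k (fun i => qbar k E (y i)) := by
    intro n e y e'
    rw [brg, std_eq, (p n).ev_l, (p n).ev_r, p1]
  change bd n (m ⊗ₜ[k] tp k (fun i => qbar k E (x i))) = hat (p (n + 1)) (p n) (d n) (m ⊗ₜ[k] tp k (fun i => qbar k E (x i)))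
  rw [hbd, hat_apply _ _ _ _ m (brg 1 x 1) (by rw [p2]; rfl), hf]
  simp only [TensorProduct.tmul_add, TensorProduct.tmul_sum, TensorProduct.tmul_smul, map_add, map_sum, map_zsmul]
  simp only [TensorProduct.tmul_smul, map_zsmul, ev, Bi.l_one, Bi.r_one, LinearMap.id_apply]

end PBar2


section PX

variable {k A H E M N : Type} [CommRing k] [Ring A] [Algebra k A] [Ring H] [HopfAlgebra k H]
  [Ring E] [Algebra k E] [AddCommGroup M] [Module k M] [AddCommGroup N] [Module k N]

variable (k A H E) in
abbrev xtMod (n : ℕ) : Module k (XT k A H E n) := 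
  @DirectSum.instModule k _ (Fin (n + 1)) (fun s => Xc k A H E (n - (s : ℕ)) (s : ℕ)) _ _
variable (k A H M) in
abbrev xhMod (n : ℕ) : Module k (XhT k A H M n) := 
  @DirectSum.instModule k _ (Fin (n + 1)) (fun s => Cms k A H M (n - (s : ℕ)) (s : ℕ)) _ _
attribute [local instance] xtMod xhMod

def xin (n : ℕ) (s : Fin (n + 1)) : Xc k A H E (n - (s : ℕ)) (s : ℕ) →ₗ[k] XT k A H E n :=
  DirectSum.lof k (Fin (n + 1)) (fun s' : Fin (n + 1) => Xc k A H E (n - (s' : ℕ)) (s' : ℕ)) s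

def xmod (n : ℕ) (f : ∀ s : Fin (n + 1), Xc k A H E (n - (s : ℕ)) (s : ℕ) →ₗ[k] N) : XT k A H E n →ₗ[k] N :=
  DirectSum.toModule k (Fin (n + 1)) N f

theorem xmod_xin {n : ℕ} (f : ∀ s : Fin (n + 1), Xc k A H E (n - (s : ℕ)) (s : ℕ) →ₗ[k] N) (s : Fin (n + 1))
    (x : Xc k A H E (n - (s : ℕ)) (s : ℕ)) : xmod n f (xin n s x) = f s x := DirectSum.toModule_lof k _ _

theorem xt_ext {n : ℕ} {f g : XT k A H E n →ₗ[k] N} (h : ∀ s x, f (xin n s x) = g (xin n s x)) : f = g :=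
  DirectSum.linearMap_ext k fun p => LinearMap.ext fun x => h p x

theorem lT_xin (e : E) (n : ℕ) (s : Fin (n + 1)) (x : Xc k A H E (n - (s : ℕ)) (s : ℕ)) :
    lT e n (xin n s x) = xin n s (lX e x) := xmod_xin _ s x

theorem rT_xin (e : E) (n : ℕ) (s : Fin (n + 1)) (x : Xc k A H E (n - (s : ℕ)) (s : ℕ)) :
    rT e n (xin n s x) = xin n s (rX e x) := xmod_xin _ s x

variable (k A H E) in
def xBi (r s : ℕ) : Bimod k E (Xc k A H E r s) where
  l := (LinearMap.rTensorHom _).comp (LinearMap.mul k E)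
  r := (LinearMap.lTensorHom E).comp ((LinearMap.lTensorHom _).comp
    ((LinearMap.lTensorHom _).comp (LinearMap.mul k E).flip))
  l_one := by apply x_ext; intro e hs as e'; change xgen _ _ _ _ = xgen _ _ _ _; simp
  r_one := by apply x_ext; intro e hs as e'; change xgen _ _ _ _ = xgen _ _ _ _; simp
  l_mul x y := by apply x_ext; intro e hs as e'; change xgen _ _ _ _ = xgen _ _ _ _; simp [mul_assoc]
  r_mul x y := by apply x_ext; intro e hs as e'; change xgen _ _ _ _ = xgen _ _ _ _; simp [mul_assoc]
  lr_comm x y := by apply x_ext; intro e hs as e'; rfl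

theorem xBi_l (r s : ℕ) (e : E) : (xBi k A H E r s).l e = lX e := rfl
theorem xBi_r (r s : ℕ) (e : E) : (xBi k A H E r s).r e = rX e := rfl

variable (k A H E) in
def xG (r s : ℕ) : (Tpow k (Qbar k H) s ⊗[k] Tpow k (Qbar k A) r) →ₗ[k] Xc k A H E r s :=
  (TensorProduct.congr (LinearEquiv.refl k E) (TensorProduct.assoc k (Tpow k (Qbar k H) s) (Tpow k (Qbar k A) r) E)).toLinearMap
    ∘ₗ stdG k E _

theorem xG_tmul (r s : ℕ) (t : Tpow k (Qbar k H) s) (u : Tpow k (Qbar k A) r) :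
    xG k A H E r s (t ⊗ₜ[k] u) = 1 ⊗ₜ[k] (t ⊗ₜ[k] (u ⊗ₜ[k] 1)) := rfl

theorem xG_gen {r s : ℕ} (hs : Fin s → H) (as : Fin r → A) :
    xG k A H E r s (tp k (fun i => qbar k H (hs i)) ⊗ₜ[k] tp k (fun i => qbar k A (as i))) = xgen 1 hs as 1 := rfl

theorem xG_free (r s : ℕ) : IsFree (xBi k A H E r s) (xG k A H E r s) := by
  have h : ∀ (e : E) (z), (TensorProduct.congr (LinearEquiv.refl k E)
      (TensorProduct.assoc k (Tpow k (Qbar k H) s) (Tpow k (Qbar k A) r) E)).toLinearMap ((stdBi k E _).l e z) =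
      (xBi k A H E r s).l e ((TensorProduct.congr (LinearEquiv.refl k E)
      (TensorProduct.assoc k (Tpow k (Qbar k H) s) (Tpow k (Qbar k A) r) E)).toLinearMap z) := by
    intro e z
    rw [← LinearMap.comp_apply, ← LinearMap.comp_apply]
    congr 1
    ext a b c d
    rfl
  have h' : ∀ (e : E) (z), (TensorProduct.congr (LinearEquiv.refl k E)
      (TensorProduct.assoc k (Tpow k (Qbar k H) s) (Tpow k (Qbar k A) r) E)).toLinearMap ((stdBi k E _).r e z) =
      (xBi k A H E r s).r e ((TensorProduct.congr (LinearEquiv.refl k E)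
      (TensorProduct.assoc k (Tpow k (Qbar k H) s) (Tpow k (Qbar k A) r) E)).toLinearMap z) := by
    intro e z
    rw [← LinearMap.comp_apply, ← LinearMap.comp_apply]
    congr 1
    ext a b c d
    rfl
  refine std_free.equiv _ ⟨h, h'⟩ ⟨fun e z => ?_, fun e z => ?_⟩
  · obtain ⟨y, rfl⟩ := (TensorProduct.congr (LinearEquiv.refl k E)
      (TensorProduct.assoc k (Tpow k (Qbar k H) s) (Tpow k (Qbar k A) r) E)).surjective z
    have := h e y
    simp only [LinearEquiv.coe_coe] at this ⊢
    rw [← this, LinearEquiv.symm_apply_apply, LinearEquiv.symm_apply_apply]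
  · obtain ⟨y, rfl⟩ := (TensorProduct.congr (LinearEquiv.refl k E)
      (TensorProduct.assoc k (Tpow k (Qbar k H) s) (Tpow k (Qbar k A) r) E)).surjective z
    have := h' e y
    simp only [LinearEquiv.coe_coe] at this ⊢
    rw [← this, LinearEquiv.symm_apply_apply, LinearEquiv.symm_apply_apply]

theorem lT_add (n : ℕ) (a b : E) : lT (k := k) (A := A) (H := H) (a + b) n = lT a n + lT b n := by
  apply xt_ext; intro s x
  rw [LinearMap.add_apply, lT_xin, lT_xin, lT_xin, ← map_add]
  exact congrArg _ (LinearMap.congr_fun ((xBi k A H E _ _).l.map_add a b) x)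

theorem rT_add (n : ℕ) (a b : E) : rT (k := k) (A := A) (H := H) (a + b) n = rT a n + rT b n := by
  apply xt_ext; intro s x
  rw [LinearMap.add_apply, rT_xin, rT_xin, rT_xin, ← map_add]
  exact congrArg _ (LinearMap.congr_fun ((xBi k A H E _ _).r.map_add a b) x)

theorem lT_smul (n : ℕ) (c : k) (b : E) : lT (k := k) (A := A) (H := H) (c • b) n = c • lT b n := by
  apply xt_ext; intro s x
  rw [LinearMap.smul_apply, lT_xin, lT_xin, ← map_smul]
  exact congrArg _ (LinearMap.congr_fun ((xBi k A H E _ _).l.map_smul c b) x)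

theorem rT_smul (n : ℕ) (c : k) (b : E) : rT (k := k) (A := A) (H := H) (c • b) n = c • rT b n := by
  apply xt_ext; intro s x
  rw [LinearMap.smul_apply, rT_xin, rT_xin, ← map_smul]
  exact congrArg _ (LinearMap.congr_fun ((xBi k A H E _ _).r.map_smul c b) x)

theorem lT_one (n : ℕ) : lT (k := k) (A := A) (H := H) (1 : E) n = LinearMap.id := by
  apply xt_ext; intro s x
  rw [lT_xin]
  exact congrArg _ (LinearMap.congr_fun ((xBi k A H E _ _).l_one) x)

theorem rT_one (n : ℕ) : rT (k := k) (A := A) (H := H) (1 : E) n = LinearMap.id := by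
  apply xt_ext; intro s x
  rw [rT_xin]
  exact congrArg _ (LinearMap.congr_fun ((xBi k A H E _ _).r_one) x)

theorem lT_mul (n : ℕ) (a b : E) : lT (k := k) (A := A) (H := H) (a * b) n = lT a n ∘ₗ lT b n := by
  apply xt_ext; intro s x
  rw [LinearMap.comp_apply, lT_xin, lT_xin, lT_xin]
  exact congrArg _ (LinearMap.congr_fun ((xBi k A H E _ _).l_mul a b) x)

theorem rT_mul (n : ℕ) (a b : E) : rT (k := k) (A := A) (H := H) (a * b) n = rT b n ∘ₗ rT a n := by
  apply xt_ext; intro s x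
  rw [LinearMap.comp_apply, rT_xin, rT_xin, rT_xin]
  exact congrArg _ (LinearMap.congr_fun ((xBi k A H E _ _).r_mul a b) x)

theorem lT_rT (n : ℕ) (a b : E) : lT (k := k) (A := A) (H := H) a n ∘ₗ rT b n = rT b n ∘ₗ lT a n := by
  apply xt_ext; intro s x
  rw [LinearMap.comp_apply, LinearMap.comp_apply, rT_xin, lT_xin, lT_xin, rT_xin]
  exact congrArg _ (LinearMap.congr_fun ((xBi k A H E _ _).lr_comm a b) x)

variable (k A H E) in
def xtBi (n : ℕ) : Bimod k E (XT k A H E n) where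
  l := { toFun := fun e => lT e n, map_add' := lT_add n, map_smul' := lT_smul n }
  r := { toFun := fun e => rT e n, map_add' := rT_add n, map_smul' := rT_smul n }
  l_one := lT_one n
  r_one := rT_one n
  l_mul := lT_mul n
  r_mul := rT_mul n
  lr_comm := lT_rT n

theorem xtBi_l (n : ℕ) (e : E) (x : XT k A H E n) : (xtBi k A H E n).l e x = lT e n x := rfl
theorem xtBi_r (n : ℕ) (e : E) (x : XT k A H E n) : (xtBi k A H E n).r e x = rT e n x := rfl

variable (k A H E) in
def xtG (n : ℕ) : (⨁ s : Fin (n + 1), (Tpow k (Qbar k H) (s : ℕ) ⊗[k] Tpow k (Qbar k A) (n - (s : ℕ)))) →ₗ[k] XT k A H E n :=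
  DirectSum.toModule k (Fin (n + 1)) _ (fun s => xin n s ∘ₗ xG k A H E (n - (s : ℕ)) (s : ℕ))

theorem xtG_free (n : ℕ) : IsFree (xtBi k A H E n) (xtG k A H E n) :=
  IsFree.directSum (fun s => xG_free _ _) (xtBi k A H E n)
    (fun s => ⟨fun e x => (lT_xin e n s x).symm, fun e x => (rT_xin e n s x).symm⟩)

theorem Coin.trans {X C D : Type} [AddCommGroup X] [Module k X] [AddCommGroup C] [Module k C] [AddCommGroup D] [Module k D]
    {Bi : Bimod k E M} {b : Bimod k E X} (p : Coin Bi b C) (u : C ≃ₗ[k] D) :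
    ∃ q : Coin Bi b D, (∀ z, q.ev z = u (p.ev z)) ∧ (∀ z, q.inj z = p.inj (u.symm z)) :=
  ⟨{ ev := u.toLinearMap ∘ₗ p.ev
     inj := p.inj ∘ₗ u.symm.toLinearMap
     ev_inj := fun c => by simp [p.ev_inj]
     ev_l := fun m e x => by simp [p.ev_l]
     ev_r := fun m e x => by simp [p.ev_r]
     univ := fun f h1 h2 z => by simp [p.univ f h1 h2] }, fun _ => rfl, fun _ => rfl⟩

theorem xt_coin (Bi : Bimod k E M) (n : ℕ) : ∃ p : Coin Bi (xtBi k A H E n) (XhT k A H M n),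
    (∀ (m : M) (s : Fin (n + 1)) t, p.ev (m ⊗ₜ[k] xin n s (xG k A H E (n - (s : ℕ)) (s : ℕ) t)) =
      DirectSum.lof k (Fin (n + 1)) (fun s' : Fin (n + 1) => Cms k A H M (n - (s' : ℕ)) (s' : ℕ)) s (m ⊗ₜ[k] t)) ∧
    (∀ (m : M) (s : Fin (n + 1)) t,
      p.inj (DirectSum.lof k (Fin (n + 1)) (fun s' : Fin (n + 1) => Cms k A H M (n - (s' : ℕ)) (s' : ℕ)) s (m ⊗ₜ[k] t)) =
      m ⊗ₜ[k] xin n s (xG k A H E (n - (s : ℕ)) (s : ℕ) t)) := by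
  obtain ⟨p, h1, h2⟩ := (xtG_free (k := k) (A := A) (H := H) (E := E) n).coin Bi
  obtain ⟨q, h3, h4⟩ := p.trans (TensorProduct.directSumRight k k M
    (fun s : Fin (n + 1) => Tpow k (Qbar k H) (s : ℕ) ⊗[k] Tpow k (Qbar k A) (n - (s : ℕ))))
  have hx : ∀ (s : Fin (n + 1)) t, xtG k A H E n (DirectSum.lof k (Fin (n + 1))
      (fun s : Fin (n + 1) => Tpow k (Qbar k H) (s : ℕ) ⊗[k] Tpow k (Qbar k A) (n - (s : ℕ))) s t) =
      xin n s (xG k A H E (n - (s : ℕ)) (s : ℕ) t) := fun s t => by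
    rw [xtG, DirectSum.toModule_lof]; rfl
  refine ⟨q, fun m s t => ?_, fun m s t => ?_⟩
  · rw [h3, ← hx, h1, TensorProduct.directSumRight_tmul_lof]
  · rw [h4, TensorProduct.directSumRight_symm_lof_tmul, h2, LinearMap.lTensor_tmul, hx]

def emb (n : ℕ) : XT k A H E n →ₗ[k] TT k A H E := xmod n fun s => inn (n - (s : ℕ)) (s : ℕ)

theorem emb_xin (n : ℕ) (s : Fin (n + 1)) (x : Xc k A H E (n - (s : ℕ)) (s : ℕ)) :
    emb n (xin n s x) = inn (n - (s : ℕ)) (s : ℕ) x := xmod_xin _ s x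

def retc (n r s : ℕ) : Xc k A H E r s →ₗ[k] XT k A H E n :=
  if h : r + s = n then xin n ⟨s, by omega⟩ ∘ₗ xcast (show r = n - s by omega) rfl else 0

def ret (n : ℕ) : TT k A H E →ₗ[k] XT k A H E n := tmod (retc n)

theorem xin_xcast {n r s s' : ℕ} (hs : s < n + 1) (h : s' = s) (hr : r = n - s') (hr' : r = n - s) (x : Xc k A H E r s') :
    xin n ⟨s, hs⟩ (xcast hr' h x) = xin n ⟨s', h ▸ hs⟩ (xcast hr rfl x) := by
  subst h; rfl

theorem xcast_rfl {r s : ℕ} (h : r = r) (h' : s = s) (x : Xc k A H E r s) : xcast h h' x = x := rfl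

theorem ret_inn {n r s : ℕ} (h : r + s = n) (x : Xc k A H E r s) :
    ret n (inn r s x) = xin n ⟨s, by omega⟩ (xcast (show r = n - s by omega) rfl x) := by
  rw [ret, tmod_inn, retc, dif_pos h]; rfl

theorem ret_inn0 {n r s : ℕ} (h : r + s ≠ n) (x : Xc k A H E r s) : ret n (inn r s x) = 0 := by
  rw [ret, tmod_inn, retc, dif_neg h]; rfl

theorem ret_emb (n : ℕ) (x : XT k A H E n) : ret n (emb n x) = x := by
  have : ret n ∘ₗ emb n = LinearMap.id (M := XT k A H E n) := by
    apply xt_ext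
    intro s x
    rw [LinearMap.comp_apply, emb_xin, ret_inn (by omega)]
    rfl
  exact LinearMap.congr_fun this x

theorem emb_l (n : ℕ) (e : E) (x : XT k A H E n) : emb n (lT e n x) = LT e (emb n x) := by
  have : emb n ∘ₗ lT e n = LT (k := k) (A := A) (H := H) e ∘ₗ emb n := by
    apply xt_ext
    intro s x
    rw [LinearMap.comp_apply, LinearMap.comp_apply, lT_xin, emb_xin, emb_xin, LT_inn]
  exact LinearMap.congr_fun this x

theorem emb_r (n : ℕ) (e : E) (x : XT k A H E n) : emb n (rT e n x) = RT e (emb n x) := by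
  have : emb n ∘ₗ rT e n = RT (k := k) (A := A) (H := H) e ∘ₗ emb n := by
    apply xt_ext
    intro s x
    rw [LinearMap.comp_apply, LinearMap.comp_apply, rT_xin, emb_xin, emb_xin, RT_inn]
  exact LinearMap.congr_fun this x

theorem emb_mem (n : ℕ) (x : XT k A H E n) : emb n x ∈ FT k A H E (n + 1) := by
  have : (FT k A H E (n + 1)).mkQ ∘ₗ emb n = 0 := by
    apply xt_ext
    intro s x
    rw [LinearMap.comp_apply, emb_xin, Submodule.mkQ_apply, LinearMap.zero_apply, Submodule.Quotient.mk_eq_zero]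
    exact inn_mem s.2 x
  have := LinearMap.congr_fun this x
  rwa [LinearMap.comp_apply, Submodule.mkQ_apply, LinearMap.zero_apply, Submodule.Quotient.mk_eq_zero] at this

namespace ResData

variable {S : CrossedProduct k A H E} (R : ResData k A H E S)

theorem dT_xin (n : ℕ) (s : Fin (n + 2)) (x : Xc k A H E (n + 1 - (s : ℕ)) (s : ℕ)) :
    dT R n (xin (n + 1) s x) = ∑ l : Fin ((s : ℕ) + 1), if h : 0 < (n + 1 - (s : ℕ)) + (l : ℕ) then
        xin n ⟨(s : ℕ) - (l : ℕ), by have := s.isLt; have := l.isLt; omega⟩ (xcast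
            (show (n + 1 - (s : ℕ)) + (l : ℕ) - 1 = n - ((s : ℕ) - (l : ℕ)) by
              have := s.isLt; have := l.isLt; omega)
            rfl (R.dl (l : ℕ) (n + 1 - (s : ℕ)) (s : ℕ) x))
      else 0 := by
  have := xmod_xin (k := k) (A := A) (H := H) (E := E) (N := XT k A H E n) (n := n + 1) (fun s =>
    ∑ l : Fin ((s : ℕ) + 1),
      if h : 0 < (n + 1 - (s : ℕ)) + (l : ℕ) then
        (DirectSum.lof k (Fin (n + 1)) (fun s' : Fin (n + 1) => Xc k A H E (n - (s' : ℕ)) (s' : ℕ))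
            ⟨(s : ℕ) - (l : ℕ), by have := s.isLt; have := l.isLt; omega⟩) ∘ₗ
          xcast
            (show (n + 1 - (s : ℕ)) + (l : ℕ) - 1 = n - ((s : ℕ) - (l : ℕ)) by
              have := s.isLt; have := l.isLt; omega)
            rfl ∘ₗ
          R.dl (l : ℕ) (n + 1 - (s : ℕ)) (s : ℕ)
      else 0) s x
  refine this.trans ?_
  rw [LinearMap.sum_apply]
  refine Finset.sum_congr rfl fun l _ => ?_
  split_ifs <;> rfl

theorem emb_dT (n : ℕ) (x : XT k A H E (n + 1)) : emb n (dT R n x) = R.dt (emb (n + 1) x) := by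
  have : emb n ∘ₗ dT R n = R.dt ∘ₗ emb (n + 1) := by
    apply xt_ext
    intro s x
    rw [LinearMap.comp_apply, LinearMap.comp_apply, dT_xin, emb_xin, dt_inn, map_sum, Finset.sum_range]
    refine Finset.sum_congr rfl fun l _ => ?_
    split_ifs with h
    · rw [emb_xin, R.dd_inn (by omega) h]
      exact inn_xcast _ _ _
    · rw [R.dd_inn0 (by omega), map_zero]
  exact LinearMap.congr_fun this x

theorem ret_dt (n : ℕ) (z : TT k A H E) : ret n (R.dt z) = dT R n (ret (n + 1) z) := by
  have : ret n ∘ₗ R.dt = dT R n ∘ₗ ret (n + 1) := by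
    apply t_ext
    intro r s x
    rw [LinearMap.comp_apply, LinearMap.comp_apply]
    by_cases h : r + s = n + 1
    · obtain rfl : r = n + 1 - s := by omega
      have e : inn (n + 1 - s) s x = emb (n + 1) (xin (n + 1) ⟨s, by omega⟩ x) := (emb_xin (n + 1) ⟨s, by omega⟩ x).symm
      rw [e, ret_emb, ← emb_dT, ret_emb]
    · rw [ret_inn0 h, map_zero, dt_inn, map_sum]
      refine Finset.sum_eq_zero fun l hl => ?_
      rw [Finset.mem_range] at hl
      by_cases h' : 0 < r + l
      · rw [R.dd_inn (by omega) h', ret_inn0 (by omega)]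
      · rw [R.dd_inn0 (by omega), map_zero]
  exact LinearMap.congr_fun this z

end ResData

end PX


section PXR

variable {k A H E M N : Type} [CommRing k] [Ring A] [Algebra k A] [Ring H] [HopfAlgebra k H]
  [Ring E] [Algebra k E] [AddCommGroup M] [Module k M] [AddCommGroup N] [Module k N]

attribute [local instance] xtMod xhMod

namespace ResData

variable {S : CrossedProduct k A H E} (R : ResData k A H E S)

def xeps : XT k A H E 0 →ₗ[k] E := S.eYT ∘ₗ R.muT ∘ₗ emb 0

theorem eT_gen (e : E) (hs : Fin 0 → H) (as : Fin 0 → A) (e' : E) :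
    S.eYT (R.muT (inn 0 0 (xgen e hs as e'))) = e * e' := by
  rw [muT_zero, CrossedProduct.eYT, ymod_yin, R.mu_Yof]
  change S.eY _ = _
  rw [S.eY_Yof, S.zb_zero_zcons, CrossedProduct.PZ, S.zL_zE, S.zeps_zE]

theorem xin0_ext {f g : XT k A H E 0 →ₗ[k] N}
    (h : ∀ e (hs : Fin 0 → H) (as : Fin 0 → A) e', f (xin 0 0 (xgen e hs as e')) = g (xin 0 0 (xgen e hs as e'))) :
    f = g := by
  apply xt_ext
  intro s x
  obtain rfl : s = 0 := Fin.fin_one_eq_zero s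
  have : f ∘ₗ xin 0 0 = g ∘ₗ xin 0 0 := by
    apply x_ext
    intro e hs as e'
    exact h e hs as e'
  exact LinearMap.congr_fun this x

theorem xeps_gen (e : E) (hs : Fin 0 → H) (as : Fin 0 → A) (e' : E) :
    R.xeps (xin 0 0 (xgen e hs as e')) = e * e' := by
  rw [xeps, LinearMap.comp_apply, LinearMap.comp_apply, emb_xin]
  exact R.eT_gen e hs as e'

theorem xeps_bi : IsBi (xtBi k A H E 0) (regBi k E) R.xeps := by
  refine ⟨fun e x => ?_, fun e x => ?_⟩
  · rw [← LinearMap.comp_apply, ← LinearMap.comp_apply]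
    congr 1
    apply xin0_ext
    intro a hs as b
    rw [LinearMap.comp_apply, LinearMap.comp_apply, xeps_gen, xtBi_l, lT_xin]
    refine (R.xeps_gen (e * a) hs as b).trans ?_
    rw [mul_assoc]; rfl
  · rw [← LinearMap.comp_apply, ← LinearMap.comp_apply]
    congr 1
    apply xin0_ext
    intro a hs as b
    rw [LinearMap.comp_apply, LinearMap.comp_apply, xeps_gen, xtBi_r, rT_xin]
    refine (R.xeps_gen a hs as (b * e)).trans ?_
    rw [← mul_assoc]; rfl

theorem emb_inj {n : ℕ} {x y : XT k A H E n} (h : emb n x = emb n y) : x = y := by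
  rw [← ret_emb n x, h, ret_emb]

theorem dt_emb_zero (x : XT k A H E 0) : R.dt (emb 0 x) = 0 := by
  have : R.dt ∘ₗ emb 0 = 0 := by
    apply xin0_ext
    intro e hs as e'
    rw [LinearMap.comp_apply, emb_xin]
    refine (R.dt_inn 0 0 _).trans ?_
    rw [Finset.sum_range_one, dd_zero0]; rfl
  exact LinearMap.congr_fun this x

theorem eT_emb_succ (n : ℕ) (x : XT k A H E (n + 1)) : S.eYT (R.muT (emb (n + 1) x)) = 0 := by
  have : S.eYT ∘ₗ R.muT ∘ₗ emb (n + 1) = 0 := by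
    apply xt_ext
    rintro ⟨s, hs⟩ x
    rw [LinearMap.comp_apply, LinearMap.comp_apply, emb_xin]
    by_cases h : 0 < n + 1 - s
    · rw [R.muT_pos h, map_zero]; rfl
    · have hs' : s = n + 1 := by omega
      subst hs'
      have : ∀ (r : ℕ) (hr : r = 0) (y : Xc k A H E r (n + 1)), S.eYT (R.muT (inn r (n + 1) y)) = 0 := by
        intro r hr y
        subst hr
        rw [muT_zero, CrossedProduct.eYT, ymod_yin]; rfl
      exact this (n + 1 - (n + 1)) (by omega) x
  exact LinearMap.congr_fun this x

theorem sc_exists : ∃ s : ∀ n, XT k A H E n →ₗ[k] XT k A H E (n + 1),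
    (∀ x, R.xeps x = 0 → dT R 0 (s 0 x) = x) ∧ (∀ n x, dT R n x = 0 → dT R (n + 1) (s (n + 1) x) = x) := by
  choose c hc using fun n => R.contraction (n + 1)
  refine ⟨fun n => ret (n + 1) ∘ₗ c n ∘ₗ emb n, fun x hx => ?_, fun n x hx => ?_⟩
  · rw [LinearMap.comp_apply, LinearMap.comp_apply, ← R.ret_dt, hc 0 _ (emb_mem 0 x) (R.dt_emb_zero x) hx, ret_emb]
  · rw [LinearMap.comp_apply, LinearMap.comp_apply, ← R.ret_dt, hc (n + 1) _ (emb_mem _ x)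
      (by rw [← R.emb_dT, hx, map_zero]) (R.eT_emb_succ n x), ret_emb]

def xRes : Res k E (XT k A H E) where
  b n := xtBi k A H E n
  d n := dT R n
  bd n := ⟨fun e x => emb_inj (by rw [xtBi_l, xtBi_l, emb_l, emb_dT, emb_l, dt_L, emb_dT]),
    fun e x => emb_inj (by rw [xtBi_r, xtBi_r, emb_r, emb_dT, emb_r, dt_R, emb_dT])⟩
  eps := R.xeps
  beps := R.xeps_bi
  eps_d x := by
    rw [xeps, LinearMap.comp_apply, LinearMap.comp_apply, emb_dT, i4, map_neg, i3', neg_zero]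
  dd n x := emb_inj (by rw [emb_dT, emb_dT, dt_dt, map_zero])
  sm := xin 0 0 ∘ₗ R.sig0 0 ∘ₗ S.sm1
  eps_sm e := by
    rw [xeps, LinearMap.comp_apply, LinearMap.comp_apply, LinearMap.comp_apply, LinearMap.comp_apply, emb_xin]
    refine (congrArg S.eYT (R.muT_zero 0 _)).trans ?_
    rw [R.mu_sig0, CrossedProduct.eYT, ymod_yin]
    exact S.eY_sm1 e
  s := R.sc_exists.choose
  s0 := R.sc_exists.choose_spec.1
  s1 := R.sc_exists.choose_spec.2
  G n := Set.range (xtG k A H E n)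
  free n {W} _ _ c P := by
    obtain ⟨φ, h1, h2⟩ := (xtG_free n).1 c (P ∘ₗ xtG k A H E n)
    refine ⟨φ, h1, ?_⟩
    rintro _ ⟨t, rfl⟩
    exact h2 t
  ext n {W} _ _ c φ ψ h1 h2 h3 := (xtG_free n).2 c φ ψ h1 h2 fun t => h3 _ ⟨t, rfl⟩

end ResData

def xCoin (Bi : Bimod k E M) (r s : ℕ) : Coin Bi (xBi k A H E r s) (Cms k A H M r s) :=
  ((xG_free r s).coin Bi).choose

theorem xCoin_ev (Bi : Bimod k E M) (r s : ℕ) (m : M) (t) :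
    (xCoin Bi r s).ev (m ⊗ₜ[k] xG k A H E r s t) = m ⊗ₜ[k] t := ((xG_free r s).coin Bi).choose_spec.1 m t

theorem xCoin_inj (Bi : Bimod k E M) (r s : ℕ) : (xCoin Bi r s).inj = LinearMap.lTensor M (xG k A H E r s) :=
  ((xG_free r s).coin Bi).choose_spec.2

theorem c_ext {r s : ℕ} {f g : Cms k A H M r s →ₗ[k] N}
    (h : ∀ m (hs : Fin s → H) (as : Fin r → A), f (cgen m hs as) = g (cgen m hs as)) : f = g := by
  apply TensorProduct.ext'
  intro m t
  have h1 : f ∘ₗ TensorProduct.mk k M (Tpow k (Qbar k H) s ⊗[k] Tpow k (Qbar k A) r) m =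
      g ∘ₗ TensorProduct.mk k M (Tpow k (Qbar k H) s ⊗[k] Tpow k (Qbar k A) r) m := by
    apply TensorProduct.ext
    apply tpow_ext (qbar k H) qbar_surj
    intro hs
    apply tpow_ext (qbar k A) qbar_surj
    intro as
    exact h m hs as
  exact LinearMap.congr_fun h1 t

theorem xCoin_gen (Bi : Bimod k E M) {r s : ℕ} (m : M) (e : E) (hs : Fin s → H) (as : Fin r → A) (e' : E) :
    (xCoin Bi r s).ev (m ⊗ₜ[k] xgen e hs as e') = cgen (Bi.l e' (Bi.r e m)) hs as := by
  rw [xgen_eq, ← xBi_l, ← xBi_r, Coin.ev_l, Coin.ev_r, ← xG_gen, xCoin_ev]; rfl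

theorem xCoin_ev' (Bi : Bimod k E M) {r s : ℕ} (m : M) (e : E) (t : Tpow k (Qbar k H) s) (u : Tpow k (Qbar k A) r) (e' : E) :
    (xCoin Bi r s).ev (m ⊗ₜ[k] (e ⊗ₜ[k] (t ⊗ₜ[k] (u ⊗ₜ[k] e')))) = (Bi.l e' (Bi.r e m)) ⊗ₜ[k] (t ⊗ₜ[k] u) := by
  have : (e ⊗ₜ[k] (t ⊗ₜ[k] (u ⊗ₜ[k] e')) : Xc k A H E r s) = lX e (rX e' (xG k A H E r s (t ⊗ₜ[k] u))) := by
    rw [xG_tmul]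
    change _ = (e * 1) ⊗ₜ[k] (t ⊗ₜ[k] (u ⊗ₜ[k] (1 * e')))
    rw [one_mul, mul_one]
  rw [this, ← xBi_l, ← xBi_r, Coin.ev_l, Coin.ev_r, xCoin_ev]

theorem xCoin_cast (Bi : Bimod k E M) {r r' s s' : ℕ} (hr : r = r') (hs : s = s') (m : M) (x : Xc k A H E r s) :
    (xCoin Bi r' s').ev (m ⊗ₜ[k] xcast hr hs x) = ccast hr hs ((xCoin Bi r s).ev (m ⊗ₜ[k] x)) := by
  subst hr; subst hs; rfl

theorem xt_coin_ev (Bi : Bimod k E M) {n : ℕ} (p : Coin Bi (xtBi k A H E n) (XhT k A H M n))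
    (hp : ∀ (m : M) (s : Fin (n + 1)) t, p.ev (m ⊗ₜ[k] xin n s (xG k A H E (n - (s : ℕ)) (s : ℕ) t)) =
      DirectSum.lof k (Fin (n + 1)) (fun s' : Fin (n + 1) => Cms k A H M (n - (s' : ℕ)) (s' : ℕ)) s (m ⊗ₜ[k] t))
    (m : M) (s : Fin (n + 1)) (x : Xc k A H E (n - (s : ℕ)) (s : ℕ)) :
    p.ev (m ⊗ₜ[k] xin n s x) = DirectSum.lof k (Fin (n + 1))
      (fun s' : Fin (n + 1) => Cms k A H M (n - (s' : ℕ)) (s' : ℕ)) s ((xCoin Bi _ _).ev (m ⊗ₜ[k] x)) := by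
  have h := (xCoin Bi (n - (s : ℕ)) (s : ℕ)).univ (p.ev ∘ₗ LinearMap.lTensor M (xin n s))
    (fun m e x => by
      simp only [LinearMap.comp_apply, LinearMap.lTensor_tmul]
      rw [← p.ev_l, xBi_l, xtBi_l, lT_xin])
    (fun m e x => by
      simp only [LinearMap.comp_apply, LinearMap.lTensor_tmul]
      rw [← p.ev_r, xBi_r, xtBi_r, rT_xin]) (m ⊗ₜ[k] x)
  have h2 : ∀ z, p.ev (LinearMap.lTensor M (xin n s) ((xCoin Bi (n - (s : ℕ)) (s : ℕ)).inj z)) =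
      DirectSum.lof k (Fin (n + 1)) (fun s' : Fin (n + 1) => Cms k A H M (n - (s' : ℕ)) (s' : ℕ)) s z := by
    intro z
    rw [xCoin_inj]
    have : p.ev ∘ₗ LinearMap.lTensor M (xin n s) ∘ₗ LinearMap.lTensor M (xG k A H E (n - (s : ℕ)) (s : ℕ)) =
      DirectSum.lof k (Fin (n + 1)) (fun s' : Fin (n + 1) => Cms k A H M (n - (s' : ℕ)) (s' : ℕ)) s := by
      apply TensorProduct.ext'
      intro m t
      exact hp m s t
    exact LinearMap.congr_fun this z
  rw [← h2]
  exact h.symm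

theorem x_main {S : CrossedProduct k A H E} (R : ResData k A H E S) (Bi : Bimod k E M)
    (dc : ∀ l r s : ℕ, Cms k A H M r s →ₗ[k] Cms k A H M (r + l - 1) (s - l))
    (key : ∀ l r s : ℕ, l ≤ s → 0 < r + l → ∀ m (hs : Fin s → H) (as : Fin r → A),
      dc l r s (cgen m hs as) = (xCoin Bi _ _).ev (m ⊗ₜ[k] R.dl l r s (xgen 1 hs as 1))) :
    ∃ p : ∀ n, Coin Bi (R.xRes.b n) (XhT k A H M n),
      ∀ n x, dhT dc n x = hat (p (n + 1)) (p n) (R.xRes.d n) x := by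
  choose p hp hp' using fun n => xt_coin (k := k) (A := A) (H := H) (E := E) Bi n
  refine ⟨p, fun n x => ?_⟩
  congr 1
  refine DirectSum.linearMap_ext k fun s => ?_
  apply c_ext
  intro m hs as
  rw [LinearMap.comp_apply, LinearMap.comp_apply]
  have e1 := hat_apply (p (n + 1)) (p n) (R.xRes.d n) _ m _ 
    (hp' (n + 1) m s (tp k (fun i => qbar k H (hs i)) ⊗ₜ[k] tp k (fun i => qbar k A (as i))))
  rw [xG_gen] at e1
  refine Eq.trans ?_ e1.symm
  change _ = (p n).ev (m ⊗ₜ[k] dT R n _)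
  rw [R.dT_xin, TensorProduct.tmul_sum, map_sum, dhT, DirectSum.toModule_lof, LinearMap.sum_apply]
  refine Finset.sum_congr rfl fun l _ => ?_
  split_ifs with h
  · rw [xt_coin_ev Bi (p n) (hp n), xCoin_cast, ← key l _ _ (by omega) h]; rfl
  · rw [TensorProduct.tmul_zero, map_zero]; rfl

theorem th_main (Bi : Bimod k E M) (r s : ℕ) (th : Cms k A H M r s →ₗ[k] MQ k A H E M Bi r s)
    (hth : ∀ (m : M) (hs : Fin s → H) (as : Fin r → A),
      th (cgen m hs as) = Submodule.Quotient.mk (m ⊗ₜ[k] xgen (1 : E) hs as (1 : E))) :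
    Function.Bijective th ∧ ∀ z, th ((xCoin Bi r s).ev z) = Submodule.Quotient.mk z := by
  have h0 : relSub Bi r s ≤ LinearMap.ker (xCoin (k := k) (A := A) (H := H) (E := E) Bi r s).ev := by
    rw [relSub, Submodule.span_le]
    rintro _ (⟨m, e, x, rfl⟩ | ⟨m, e, x, rfl⟩)
    · rw [SetLike.mem_coe, LinearMap.mem_ker, map_sub, ← xBi_l, Coin.ev_l, sub_self]
    · rw [SetLike.mem_coe, LinearMap.mem_ker, map_sub, ← xBi_r, Coin.ev_r, sub_self]
  have h1 : th = (relSub Bi r s).mkQ ∘ₗ (xCoin Bi r s).inj := by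
    apply c_ext
    intro m hs as
    rw [hth, LinearMap.comp_apply, xCoin_inj]; rfl
  have h2 : ∀ z, th ((xCoin Bi r s).ev z) = Submodule.Quotient.mk z := by
    intro z
    rw [h1]
    refine (xCoin Bi r s).univ (relSub Bi r s).mkQ (fun m e x => ?_) (fun m e x => ?_) z
    · exact (Submodule.Quotient.eq _).2 (Submodule.subset_span (Or.inl ⟨m, e, x, rfl⟩))
    · exact (Submodule.Quotient.eq _).2 (Submodule.subset_span (Or.inr ⟨m, e, x, rfl⟩))
  have h3 : ∀ c, (relSub Bi r s).liftQ (xCoin Bi r s).ev h0 (th c) = c := by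
    intro c
    rw [h1]
    exact (xCoin Bi r s).ev_inj c
  refine ⟨⟨Function.LeftInverse.injective h3, fun q => ?_⟩, h2⟩
  obtain ⟨z, rfl⟩ := Submodule.Quotient.mk_surjective _ q
  exact ⟨_, h2 z⟩

end PXR


section PKey

variable {k A H E M N : Type} [CommRing k] [Ring A] [Algebra k A] [Ring H] [HopfAlgebra k H]
  [Ring E] [Algebra k E] [AddCommGroup N] [Module k N] [AddCommGroup M] [Module k M]

def spl : ∀ r : ℕ, Tpow k H (r + 1) →ₗ[k] Tpow k H (r + 2)
  | 0 => tlift (tlift0 (k := k) (V := H) (itComul k 1)).flip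
  | r + 1 => tlift (LinearMap.lcomp k (Tpow k H (r + 3)) (spl r) ∘ₗ tcons (k := k) (V := H) (n := r + 2))

theorem spl_zero (h : H) : spl (k := k) 0 (tcons h tone) = itComul k 1 h := by
  rw [spl, tlift_tcons, LinearMap.flip_apply, tlift0_tone]

theorem spl_succ (r : ℕ) (h : H) (t : Tpow k H (r + 1)) :
    spl (r + 1) (tcons h t) = tcons h (spl r t) := by
  rw [spl, tlift_tcons]; rfl

theorem spl_itComul : ∀ (r : ℕ) (h : H), spl r (itComul k r h) = itComul k (r + 1) h
  | 0, h => by rw [itComul_zero, spl_zero]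
  | r + 1, h => by
    rw [itComul_succ, itComul_succ]
    generalize (Coalgebra.comul (R := k) h : H ⊗[k] H) = z
    induction z using TensorProduct.induction_on with
    | zero => simp only [map_zero]
    | tmul x y =>
      rw [TensorProduct.map_tmul, TensorProduct.lift.tmul, TensorProduct.map_tmul, TensorProduct.lift.tmul,
        spl_succ, spl_itComul]
    | add x y hx hy => rw [map_add, map_add, map_add, map_add, map_add, hx, hy]

theorem spl_tp : ∀ {r : ℕ} (w : Fin r → H) (l : H) {N : ℕ} {u : Fin N → Fin 2 → H} (_ : SRep k 1 l N u),
    spl r (tp k (Fin.snoc w l : Fin (r + 1) → H)) =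
      ∑ i, tp k (Fin.snoc (Fin.snoc w (u i 0) : Fin (r + 1) → H) (u i 1) : Fin (r + 2) → H)
  | 0, w, l, N, u, hu => by
    have h1 : tp k (Fin.snoc w l : Fin 1 → H) = tcons l tone := rfl
    rw [h1, spl_zero]
    refine (show itComul k 1 l = _ from hu).trans (Finset.sum_congr rfl fun i _ => ?_)
    congr 1
    funext j
    refine Fin.cases rfl (fun j => ?_) j
    obtain rfl : j = 0 := Fin.fin_one_eq_zero j
    rfl
  | r + 1, w, l, N, u, hu => by
    rw [tp_succ (Fin.snoc w l : Fin (r + 2) → H), snoc_fun_succ, snoc_fun_zero, spl_succ, spl_tp _ _ hu, map_sum]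
    refine Finset.sum_congr rfl fun i _ => ?_
    rw [tp_succ (n := r + 2), snoc_fun_succ, snoc_fun_succ, snoc_fun_zero, snoc_fun_zero]

namespace CrossedProduct
variable (S : CrossedProduct k A H E)

def Lact : ∀ (r : ℕ) (_ : Fin r → A), Tpow k H (r + 1) →ₗ[k] Tpow k (Qbar k A) r ⊗[k] E
  | 0, _ => tlift ((tlift0 (k := k) (V := H)
      (TensorProduct.mk k (Tpow k (Qbar k A) 0) E (tone (k := k) (V := Qbar k A)) ∘ₗ S.hE)).flip)
  | r + 1, as => tlift (LinearMap.lcomp k (Tpow k (Qbar k A) (r + 1) ⊗[k] E) (Lact r (fun i => as i.succ)) ∘ₗ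
      LinearMap.rTensorHom E ∘ₗ tcons (k := k) (n := r) ∘ₗ qbar k A ∘ₗ S.act.flip (as 0))

theorem Lact_tp : ∀ {r : ℕ} (as : Fin r → A) (w : Fin r → H) (l : H),
    S.Lact r as (tp k (Fin.snoc w l : Fin (r + 1) → H)) =
      tp k (fun i => qbar k A (S.act (w i) (as i))) ⊗ₜ[k] S.hE l
  | 0, as, w, l => by
    have h1 : tp k (Fin.snoc w l : Fin 1 → H) = tcons l tone := rfl
    rw [h1, Lact, tlift_tcons, LinearMap.flip_apply, tlift0_tone]; rfl
  | r + 1, as, w, l => by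
    rw [tp_succ (Fin.snoc w l : Fin (r + 2) → H), snoc_fun_succ, snoc_fun_zero, Lact, tlift_tcons]
    change LinearMap.rTensor E (tcons (k := k) (n := r) (qbar k A (S.act (w 0) (as 0))))
      (S.Lact r (fun i => as i.succ) _) = _
    rw [Lact_tp]; rfl

def LX {r s : ℕ} (hs : Fin s → H) (as : Fin r → A) : Tpow k H (r + 1) →ₗ[k] Xc k A H E r s :=
  TensorProduct.mk k E (Tpow k (Qbar k H) s ⊗[k] (Tpow k (Qbar k A) r ⊗[k] E)) 1 ∘ₗ
    TensorProduct.mk k (Tpow k (Qbar k H) s) (Tpow k (Qbar k A) r ⊗[k] E) (tp k (fun i => qbar k H (hs i))) ∘ₗ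
    S.Lact r as

theorem LX_tp {r s : ℕ} (hs : Fin s → H) (as : Fin r → A) (w : Fin r → H) (l : H) :
    S.LX hs as (tp k (Fin.snoc w l : Fin (r + 1) → H)) = xgen 1 hs (fun i => S.act (w i) (as i)) (S.hE l) := by
  rw [LX, LinearMap.comp_apply, LinearMap.comp_apply, Lact_tp]; rfl

def zm (i : ℕ) : ∀ (s : ℕ) (_ : Fin (s + 1) → H), A ⊗[k] Tpow k H s
  | 0, _ => 0
  | s + 1, x => S.zmid i s 1 x

def yh {s : ℕ} (hs : Fin (s + 1) → H) : E ⊗[k] Tpow k (Qbar k H) s :=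
  S.hE (hs 0) ⊗ₜ[k] tp k (fun i => qbar k H (hs i.succ)) -
    ∑ i ∈ Finset.range s, ((-1 : ℤ) ^ i) • TensorProduct.map S.aE (tpQ k s) (S.zm i s hs)

end CrossedProduct

def ins {r s : ℕ} (as : Fin r → A) : E ⊗[k] Tpow k (Qbar k H) s →ₗ[k] Xc k A H E r s :=
  TensorProduct.map LinearMap.id ((TensorProduct.mk k (Tpow k (Qbar k H) s) (Tpow k (Qbar k A) r ⊗[k] E)).flip
    (tp k (fun i => qbar k A (as i)) ⊗ₜ[k] 1))

theorem ins_tmul {r s : ℕ} (as : Fin r → A) (e : E) (q : Tpow k (Qbar k H) s) :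
    ins as (e ⊗ₜ[k] q) = (e ⊗ₜ[k] (q ⊗ₜ[k] (tp k (fun i => qbar k A (as i)) ⊗ₜ[k] 1)) : Xc k A H E r s) := rfl

theorem et_ext {s : ℕ} {f g : E ⊗[k] Tpow k (Qbar k H) s →ₗ[k] N}
    (h : ∀ e (hs : Fin s → H), f (e ⊗ₜ[k] tp k fun i => qbar k H (hs i)) = g (e ⊗ₜ[k] tp k fun i => qbar k H (hs i))) :
    f = g := by
  apply TensorProduct.ext
  ext e : 1
  apply tpow_ext (qbar k H) qbar_surj
  intro hs
  exact h e hs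

theorem xgen_zero {r s : ℕ} (e : E) (hs : Fin s → H) (as : Fin r → A) (e' : E) :
    (xgen e hs (Fin.snoc as 1 : Fin (r + 1) → A) e' : Xc k A H E (r + 1) s) = 0 := by
  rw [xgen, tp_eq_zero _ (Fin.last r) (by rw [Fin.snoc_last, qbar_one]), TensorProduct.zero_tmul,
    TensorProduct.tmul_zero, TensorProduct.tmul_zero]

namespace ResData
variable {S : CrossedProduct k A H E} (R : ResData k A H E S)

theorem sig_ins {r s : ℕ} (as : Fin r → A) (b : A) (y : E ⊗[k] Tpow k (Qbar k H) s) :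
    R.sig r s (rX (S.aE b) (ins as y)) = ((-1 : ℤ) ^ (r + 1)) • ins (Fin.snoc as b : Fin (r + 1) → A) y := by
  have : R.sig r s ∘ₗ rX (S.aE b) ∘ₗ ins as = ((-1 : ℤ) ^ (r + 1)) • ins (Fin.snoc as b : Fin (r + 1) → A) := by
    apply et_ext
    intro e hs
    change R.sig r s (xgen e hs as (1 * S.aE b)) = ((-1 : ℤ) ^ (r + 1)) • xgen e hs (Fin.snoc as b : Fin (r + 1) → A) 1
    rw [one_mul, R.sig_hE]
  exact LinearMap.congr_fun this y

theorem t_snoc_ext {r : ℕ} {f g : Tpow k H (r + 1) →ₗ[k] N}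
    (h : ∀ (w : Fin r → H) l, f (tp k (Fin.snoc w l : Fin (r + 1) → H)) = g (tp k (Fin.snoc w l : Fin (r + 1) → H))) :
    f = g := by
  apply tpow_ext (LinearMap.id (R := k) (M := H)) Function.surjective_id
  intro w
  have := h (fun i => w i.castSucc) (w (Fin.last r))
  have e : (Fin.snoc (fun i => w i.castSucc) (w (Fin.last r)) : Fin (r + 1) → H) = w := Fin.snoc_init_self w
  rw [e] at this
  exact this

theorem sig_LX {r s : ℕ} (hs : Fin s → H) (as : Fin r → A) (b : A) (t : Tpow k H (r + 1)) :
    R.sig r s (rX (S.aE b) (S.LX hs as t)) =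
      ((-1 : ℤ) ^ (r + 1)) • S.LX hs (Fin.snoc as b : Fin (r + 1) → A) (spl r t) := by
  have : R.sig r s ∘ₗ rX (S.aE b) ∘ₗ S.LX hs as =
      ((-1 : ℤ) ^ (r + 1)) • S.LX hs (Fin.snoc as b : Fin (r + 1) → A) ∘ₗ spl r := by
    apply t_snoc_ext
    intro w l
    obtain ⟨N, u, hu⟩ := exists_SRep (k := k) 1 l
    rw [LinearMap.comp_apply, LinearMap.comp_apply, LinearMap.smul_apply, LinearMap.comp_apply, S.LX_tp,
      spl_tp _ _ hu, map_sum, rX_xgen, S.hE_mul_aE _ _ hu, xgen_eq, Finset.smul_sum]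
    have e1 : ∀ z : Fin N → E, (rX (∑ i, z i) (xgen 1 hs (fun i => S.act (w i) (as i)) 1) : Xc k A H E r s) =
        ∑ i, xgen 1 hs (fun i => S.act (w i) (as i)) (z i) := by
      intro z
      rw [rX_xgen, one_mul, xgen, TensorProduct.tmul_sum, TensorProduct.tmul_sum, TensorProduct.tmul_sum]; rfl
    rw [e1, map_sum, map_sum]
    refine Finset.sum_congr rfl fun i _ => ?_
    rw [lX_xgen, one_mul, R.sig_eq, S.LX_tp]
    congr 2
    funext j
    refine Fin.lastCases ?_ (fun j => ?_) j
    · rw [Fin.snoc_last, Fin.snoc_last, Fin.snoc_last]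
    · rw [Fin.snoc_castSucc, Fin.snoc_castSucc, Fin.snoc_castSucc]
  exact LinearMap.congr_fun this t

theorem ins_zero {r s : ℕ} (as : Fin r → A) (y : E ⊗[k] Tpow k (Qbar k H) s) : R.sig r s (ins as y) = 0 := by
  have : R.sig r s ∘ₗ ins as = 0 := by
    apply et_ext
    intro e hs
    change R.sig r s (xgen e hs as 1) = 0
    rw [← S.aE_one, R.sig_hE, xgen_zero, smul_zero]
  exact LinearMap.congr_fun this y

theorem LX_zero {r s : ℕ} (hs : Fin s → H) (as : Fin r → A) (t : Tpow k H (r + 1)) : R.sig r s (S.LX hs as t) = 0 := by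
  have : R.sig r s ∘ₗ S.LX hs as = 0 := by
    apply t_snoc_ext
    intro w l
    rw [LinearMap.comp_apply, S.LX_tp, hE_ι, R.sig_eq, xgen_zero, smul_zero]; rfl
  exact LinearMap.congr_fun this t

theorem sig_l (r s : ℕ) (e : E) (x : Xc k A H E r s) : R.sig r s (lX e x) = lX e (R.sig r s x) := by
  have : R.sig r s ∘ₗ lX e = lX e ∘ₗ R.sig r s := by
    apply x_ext
    intro e₁ hs as
    intro e₂
    have h : ∀ z : A ⊗[k] H, R.sig r s (xgen (e * e₁) hs as (S.ι z)) = lX e (R.sig r s (xgen e₁ hs as (S.ι z))) := by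
      intro z
      induction z using TensorProduct.induction_on with
      | zero =>
        rw [map_zero]
        have h0 : ∀ e : E, (xgen e hs as (0 : E) : Xc k A H E r s) = 0 := fun e => by
          rw [xgen, TensorProduct.tmul_zero, TensorProduct.tmul_zero, TensorProduct.tmul_zero]
        rw [h0, h0, map_zero, map_zero]
      | tmul a h => rw [R.sig_eq, R.sig_eq, map_zsmul, lX_xgen]
      | add x y hx hy =>
        have h0 : ∀ e u v : E, (xgen e hs as (u + v) : Xc k A H E r s) = xgen e hs as u + xgen e hs as v :=
          fun e u v => by
          rw [xgen, TensorProduct.tmul_add, TensorProduct.tmul_add, TensorProduct.tmul_add]; rfl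
        rw [map_add, h0, h0, map_add, map_add, map_add, hx, hy]
    obtain ⟨z, rfl⟩ := S.ι.surjective e₂
    exact h z
  exact LinearMap.congr_fun this x

theorem d1_step (r s : ℕ) (hs : Fin (s + 1) → H) (as : Fin (r + 1) → A) :
    R.d1 (r + 1) s (xgen 1 hs as 1) = - R.sig r s (R.d1 r s (R.d0 r (s + 1) (xgen 1 hs as 1))) := by
  refine (R.dl_succ 1 r (s + 1) le_rfl (by omega) hs as).trans ?_
  rw [Fin.sum_univ_one]
  rfl

theorem Yof_zc (s : ℕ) (z : A ⊗[k] Tpow k H s) :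
    R.sig0 s (S.Yof s (S.zcons 1 (LinearMap.lTensor A (tsnoc 1 s) z))) =
      ins (fun i : Fin 0 => i.elim0) (TensorProduct.map S.aE (tpQ k s) z) := by
  have : R.sig0 s ∘ₗ S.Yof s ∘ₗ S.zcons 1 ∘ₗ (LinearMap.lTensor A (tsnoc 1 s)) =
      ins (fun i : Fin 0 => i.elim0) ∘ₗ (TensorProduct.map S.aE (tpQ k s)) := by
    apply TensorProduct.ext
    ext a : 1
    apply tpow_ext (LinearMap.id (R := k) (M := H)) Function.surjective_id
    intro hs
    change R.sig0 s (S.Yof s (S.zcons 1 (a ⊗ₜ[k] tsnoc 1 s (tp k hs)))) =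
      ins (fun i : Fin 0 => i.elim0) (S.aE a ⊗ₜ[k] tpQ k s (tp k hs))
    rw [S.zcons_tmul, one_mul, S.Yof_zE, split_tsnoc, tpQ_tp]
    refine (R.sig0_eq s (S.aE a) hs 1).trans ?_
    rw [S.hE_one]; rfl
  exact LinearMap.congr_fun this z

theorem d1_base (s : ℕ) (hs : Fin (s + 1) → H) (as : Fin 0 → A) :
    R.d1 0 s (xgen 1 hs as 1) = ins as (S.yh hs) +
      ((-1 : ℤ) ^ (s + 1)) • S.LX (fun i : Fin s => hs i.castSucc) as (itComul k 0 (hs (Fin.last s))) := by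
  obtain rfl : as = (fun i : Fin 0 => i.elim0) := Subsingleton.elim _ _
  refine (R.dl_one_zero s hs).trans ?_
  rw [R.mu_Yof, R.del_Yof, map_neg, neg_neg, S.zb_succ_zcons, S.zL_one, S.PZ_one, S.zb_tp, Finset.sum_range_succ,
    S.zmid_last, map_add, map_sub, map_sub, map_add, map_add, map_sum, map_sum, map_sum]
  have e1 : R.sig0 s (S.Yof s (1 ⊗ₜ[k] tp k (Fin.snoc hs 1 : Fin (s + 2) → H))) =
      ins (fun i : Fin 0 => i.elim0) (S.hE (hs 0) ⊗ₜ[k] tp k (fun i => qbar k H (hs i.succ))) := by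
    rw [tp_succ (Fin.snoc hs 1 : Fin (s + 2) → H), snoc_fun_succ, snoc_fun_zero, ← S.zE_ι, S.Yof_zE, split_tp]
    refine (R.sig0_eq s _ (fun i => hs i.succ) 1).trans ?_
    rw [S.hE_one]; rfl
  have e2 : R.sig0 s (S.Yof s (S.zcons 1 (1 ⊗ₜ[k] tp k hs))) =
      S.LX (fun i : Fin s => hs i.castSucc) (fun i : Fin 0 => i.elim0) (itComul k 0 (hs (Fin.last s))) := by
    have e : (Fin.snoc (fun i => hs i.castSucc) (hs (Fin.last s)) : Fin (s + 1) → H) = hs := Fin.snoc_init_self hs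
    have h1 : itComul k 0 (hs (Fin.last s)) = tp k (Fin.snoc (fun i : Fin 0 => i.elim0) (hs (Fin.last s)) : Fin 1 → H) := rfl
    rw [h1, S.LX_tp, S.zcons_one]
    conv_lhs => rw [← e]
    rw [S.Yof_zE, split_tp]
    refine (R.sig0_eq s _ _ _).trans ?_
    congr 1
    exact Subsingleton.elim _ _
  have e3 : ∀ i ∈ Finset.range s, R.sig0 s (S.Yof s (S.zcons 1 (((-1 : ℤ) ^ i) • S.zmid i s 1 (Fin.snoc hs 1 : Fin (s + 2) → H)))) =
      ins (fun i : Fin 0 => i.elim0) (((-1 : ℤ) ^ i) • TensorProduct.map S.aE (tpQ k s) (S.zm i s hs)) := by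
    intro i hi
    rw [Finset.mem_range] at hi
    rw [map_zsmul, map_zsmul, map_zsmul, map_zsmul]
    congr 1
    cases s with
    | zero => omega
    | succ s => rw [S.zmid_snoc i s hi]; exact R.Yof_zc _ _
  rw [e1, Finset.sum_congr rfl e3, map_zsmul, map_zsmul, map_zsmul, e2, CrossedProduct.yh, map_sub, map_sum, pow_succ,
    mul_neg_one, neg_smul]
  abel

theorem d1_formula : ∀ (r s : ℕ) (hs : Fin (s + 1) → H) (as : Fin r → A),
    R.d1 r s (xgen 1 hs as 1) = ((-1 : ℤ) ^ r) • ins as (S.yh hs) +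
      ((-1 : ℤ) ^ (r + s + 1)) • S.LX (fun i : Fin s => hs i.castSucc) as (itComul k r (hs (Fin.last s))) := by
  intro r
  induction r with
  | zero =>
    intro s hs as
    rw [R.d1_base, pow_zero, one_smul, show (0 + s + 1) = s + 1 by omega]
  | succ r ih =>
    intro s hs as
    obtain ⟨as, b, rfl⟩ : ∃ as' b, as = (Fin.snoc as' b : Fin (r + 1) → A) :=
      ⟨fun i => as i.castSucc, as (Fin.last _), (Fin.snoc_init_self as).symm⟩
    have z : ∀ (e : E) (hs : Fin (s + 1) → H) (as : Fin r → A), R.sig r s (R.d1 r s (xgen e hs as 1)) = 0 := by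
      intro e hs as
      rw [← mul_one e, ← lX_xgen, R.d1_l, R.sig_l, ih, map_add, map_zsmul, map_zsmul, R.ins_zero, R.LX_zero,
        smul_zero, smul_zero, add_zero, map_zero]
    have h1 : (1 : E) = S.ι (1 ⊗ₜ[k] 1) := S.ι_one.symm
    choose Nv v hv using fun i => exists_SRep (k := k) 1 ((Fin.cons 1 hs : Fin (s + 2) → H) i)
    have h2 : ∀ x : Xc k A H E (r + 1) (s + 1), x = xgen 1 hs (Fin.snoc as b : Fin (r + 1) → A) 1 →
        R.sig r s (R.d1 r s (R.d0 r (s + 1) x)) =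
        ((-1 : ℤ) ^ (r + 1)) • R.sig r s (R.d1 r s (xgen 1 hs as (S.aE b))) := by
      intro x hx
      rw [h1] at hx
      rw [hx, R.d0_gen r (s + 1) 1 1 hs _ 1 1 Nv v hv]
      simp only [S.ι_one, map_add, map_sum, map_zsmul, z, smul_zero, Finset.sum_const_zero, zero_add, mul_one,
        Fin.snoc_castSucc, Fin.snoc_last]
      rfl
    rw [R.d1_step, h2 _ rfl, ← one_mul (S.aE b), ← rX_xgen, R.d1_r, ih, map_add, map_zsmul, map_zsmul, map_add,
      map_zsmul, map_zsmul, R.sig_ins, R.sig_LX, spl_itComul, smul_add, neg_add]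
    simp only [smul_smul, ← neg_smul]
    congr 2
    · rcases neg_one_pow_eq_or ℤ r with h | h <;> simp [pow_add, h]
    · rcases neg_one_pow_eq_or ℤ r with h | h <;> simp [pow_add, h]

end ResData

end PKey


section PFin

variable {k A H E M N : Type} [CommRing k] [Ring A] [Algebra k A] [Ring H] [HopfAlgebra k H]
  [Ring E] [Algebra k E] [AddCommGroup N] [Module k N] [AddCommGroup M] [Module k M]

theorem key0 {S : CrossedProduct k A H E} (Bi : Bimod k E M) (R : ResData k A H E S)
    (F : ∀ l r : ℕ, (Tpow k (Qbar k H) l ⊗[k] Tpow k (Qbar k A) r) →ₗ[k] Tpow k A (r + l - 1))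
    (dc : ∀ l r s : ℕ, Cms k A H M r s →ₗ[k] Cms k A H M (r + l - 1) (s - l))
    (hdc : IsDhat k S Bi F dc) (r s : ℕ) (m : M) (hs : Fin s → H) (as : Fin (r + 1) → A) :
    dc 0 (r + 1) s (cgen m hs as) = (xCoin Bi r s).ev (m ⊗ₜ[k] R.d0 r s (xgen 1 hs as 1)) := by
  choose Nv v hv using fun i => exists_SRep (k := k) 1 (hs i)
  refine (hdc.1 r s m hs as Nv v hv).trans ?_
  have h2 : ∀ x : Xc k A H E (r + 1) s, x = xgen 1 hs as 1 → R.d0 r s x =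
      (∑ c : (∀ i, Fin (Nv i)), xgen (S.aE (iterAct k S.act (fun i => v i (c i) 0) (as 0)))
          (fun i => v i (c i) 1) (fun i : Fin r => as i.succ) 1)
      + (∑ i : Fin r, ((-1 : ℤ) ^ ((i : ℕ) + 1)) • xgen 1 hs (mulAt as i) 1)
      + ((-1 : ℤ) ^ (r + 1)) • xgen 1 hs (fun i : Fin r => as i.castSucc) (S.aE (as (Fin.last r))) := by
    intro x hx
    rw [← S.ι_one] at hx
    rw [hx, R.d0_gen r s 1 1 hs as 1 1 (Fin.cons 1 Nv : Fin (s + 1) → ℕ)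
      (Fin.cons (fun _ _ => 1) v : ∀ i : Fin (s + 1), Fin ((Fin.cons 1 Nv : Fin (s + 1) → ℕ) i) → Fin 2 → H)
      (fun i => Fin.cases SRep_one hv i), sum_cons, S.ι_one, mul_one]
    congr 2
    refine (Finset.sum_eq_single (0 : Fin 1) (fun b _ hb => absurd (Fin.fin_one_eq_zero b) hb)
      (fun h => absurd (Finset.mem_univ _) h)).trans ?_
    refine Finset.sum_congr rfl fun c _ => ?_
    rw [one_mul]
    change xgen (S.ι (S.act 1 (iterAct k S.act (fun i => v i (c i) 0) (as 0)) ⊗ₜ[k] 1)) _ _ _ = _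
    rw [S.one_act]; rfl
  rw [h2 _ rfl, TensorProduct.tmul_add, TensorProduct.tmul_add, TensorProduct.tmul_sum, TensorProduct.tmul_sum,
    map_add, map_add, map_sum, map_sum, TensorProduct.tmul_smul, map_zsmul]
  have hr1 : ∀ m, Bi.r 1 m = m := fun m => by simp [Bi.r_one]
  have hl1 : ∀ m, Bi.l 1 m = m := fun m => by simp [Bi.l_one]
  simp only [TensorProduct.tmul_smul, map_zsmul, xCoin_gen, hr1, hl1]

theorem ev_ins (Bi : Bimod k E M) {r s : ℕ} (m : M) (as : Fin r → A) (e : E) (q : Tpow k (Qbar k H) s) :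
    (xCoin Bi r s).ev (m ⊗ₜ[k] ins as (e ⊗ₜ[k] q)) = Bi.r e m ⊗ₜ[k] (q ⊗ₜ[k] tp k (fun i => qbar k A (as i))) := by
  have hl1 : ∀ m, Bi.l 1 m = m := fun m => by simp [Bi.l_one]
  rw [ins_tmul, xCoin_ev', hl1]

theorem key1 {S : CrossedProduct k A H E} (Bi : Bimod k E M) (R : ResData k A H E S)
    (F : ∀ l r : ℕ, (Tpow k (Qbar k H) l ⊗[k] Tpow k (Qbar k A) r) →ₗ[k] Tpow k A (r + l - 1))
    (dc : ∀ l r s : ℕ, Cms k A H M r s →ₗ[k] Cms k A H M (r + l - 1) (s - l))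
    (hdc : IsDhat k S Bi F dc) (r s : ℕ) (m : M) (hs : Fin (s + 1) → H) (as : Fin r → A) :
    dc 1 r (s + 1) (cgen m hs as) = (xCoin Bi r s).ev (m ⊗ₜ[k] R.d1 r s (xgen 1 hs as 1)) := by
  choose Nv v hv using fun i => exists_SRep (k := k) 1 (hs i)
  obtain ⟨Nw, w, hw⟩ := exists_SRep (k := k) r (hs (Fin.last s))
  refine (hdc.2.1 r s m hs as Nv v Nw w hv hw).trans ?_
  have hr1 : ∀ m, Bi.r 1 m = m := fun m => by simp [Bi.r_one]
  have e1 : (xCoin Bi r s).ev (m ⊗ₜ[k] S.LX (fun i : Fin s => hs i.castSucc) as (itComul k r (hs (Fin.last s)))) =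
      ∑ mw : Fin Nw, cgen (Bi.l (S.hE (w mw (Fin.last r))) m) (fun i : Fin s => hs i.castSucc)
              (fun j : Fin r => S.act (w mw j.castSucc) (as j)) := by
    rw [show itComul k r (hs (Fin.last s)) = _ from hw, map_sum, TensorProduct.tmul_sum, map_sum]
    refine Finset.sum_congr rfl fun i _ => ?_
    have e : (Fin.snoc (fun j => w i j.castSucc) (w i (Fin.last r)) : Fin (r + 1) → H) = w i := Fin.snoc_init_self _
    rw [← e, S.LX_tp, xCoin_gen, hr1, Fin.snoc_last]
    simp only [Fin.snoc_castSucc]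
  have e2 : (xCoin Bi r s).ev (m ⊗ₜ[k] ins as (S.yh hs)) =
      cgen (Bi.r (S.hE (hs 0)) m) (fun i : Fin s => hs i.succ) as - ∑ t : Fin s, ((-1 : ℤ) ^ (t : ℕ)) •
        (xCoin Bi r s).ev (m ⊗ₜ[k] ins as (TensorProduct.map S.aE (tpQ k s) (S.zm t s hs))) := by
    rw [CrossedProduct.yh, map_sub, TensorProduct.tmul_sub, map_sub, ev_ins, Finset.sum_range, map_sum,
      TensorProduct.tmul_sum, map_sum]
    congr 1
    refine Finset.sum_congr rfl fun i _ => ?_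
    rw [map_zsmul, TensorProduct.tmul_smul, map_zsmul]
  rw [R.d1_formula, TensorProduct.tmul_add, TensorProduct.tmul_smul, TensorProduct.tmul_smul, map_add, map_zsmul,
    map_zsmul, e1, e2, smul_sub, sub_add_eq_add_sub, sub_eq_add_neg]
  congr 1
  rw [Finset.smul_sum, ← Finset.sum_neg_distrib]
  refine Finset.sum_congr rfl fun t _ => ?_
  rw [smul_smul, ← neg_smul, ← pow_add, pow_succ, mul_neg_one]
  congr 1
  cases s with
  | zero => exact t.elim0
  | succ s =>
    rw [CrossedProduct.zm, S.zmid_sum t s t.isLt 1 hs Nv v hv, map_sum, map_sum, TensorProduct.tmul_sum, map_sum]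
    refine Finset.sum_congr rfl fun c _ => ?_
    rw [TensorProduct.map_tmul, ev_ins, one_mul, tpQ_tp]; rfl

theorem key2 {S : CrossedProduct k A H E} (Bi : Bimod k E M) (R : ResData k A H E S)
    (F : ∀ l r : ℕ, (Tpow k (Qbar k H) l ⊗[k] Tpow k (Qbar k A) r) →ₗ[k] Tpow k A (r + l - 1))
    (hF : IsF k S R F)
    (dc : ∀ l r s : ℕ, Cms k A H M r s →ₗ[k] Cms k A H M (r + l - 1) (s - l))
    (hdc : IsDhat k S Bi F dc) (l r s : ℕ) (hl : 2 ≤ l) (hls : l ≤ s) (m : M) (hs : Fin s → H) (as : Fin r → A) :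
    dc l r s (cgen m hs as) = (xCoin Bi _ _).ev (m ⊗ₜ[k] R.dl l r s (xgen 1 hs as 1)) := by
  choose Nv v hv using fun j : Fin l => exists_SRep (k := k) 1 (hs ⟨s - l + (j : ℕ), by have := j.isLt; omega⟩)
  refine (hdc.2.2 l r s hl hls m hs as Nv v hv).trans ?_
  have hr1 : ∀ m, Bi.r 1 m = m := fun m => by simp [Bi.r_one]
  have h := hF.2 l r s hl hls 1 1 hs as Nv v hv
  rw [S.ι_one] at h
  rw [h, TensorProduct.tmul_smul, map_zsmul, TensorProduct.tmul_sum, map_sum]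
  congr 1
  refine Finset.sum_congr rfl fun c _ => ?_
  rw [xCoin_ev', hr1]

theorem key {S : CrossedProduct k A H E} (Bi : Bimod k E M) (R : ResData k A H E S)
    (F : ∀ l r : ℕ, (Tpow k (Qbar k H) l ⊗[k] Tpow k (Qbar k A) r) →ₗ[k] Tpow k A (r + l - 1))
    (hF : IsF k S R F)
    (dc : ∀ l r s : ℕ, Cms k A H M r s →ₗ[k] Cms k A H M (r + l - 1) (s - l))
    (hdc : IsDhat k S Bi F dc) (l r s : ℕ) (hls : l ≤ s) (hrl : 0 < r + l) (m : M) (hs : Fin s → H) (as : Fin r → A) :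
    dc l r s (cgen m hs as) = (xCoin Bi _ _).ev (m ⊗ₜ[k] R.dl l r s (xgen 1 hs as 1)) := by
  match l, r, s, hls, hrl, hs, as with
  | 0, 0, _, _, h, _, _ => exact absurd h (by omega)
  | 0, r + 1, s, _, _, hs, as => exact key0 Bi R F dc hdc r s m hs as
  | 1, r, 0, h, _, _, _ => exact absurd h (by omega)
  | 1, r, s + 1, _, _, hs, as => exact key1 Bi R F dc hdc r s m hs as
  | l + 2, r, s, hls, _, hs, as => exact key2 Bi R F hF dc hdc (l + 2) r s (by omega) hls m hs as

end PFin



end FastAll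

section Statement6

variable {k A H E M : Type} [CommRing k] [Ring A] [Algebra k A] [Ring H] [HopfAlgebra k H]
  [Ring E] [Algebra k E] [AddCommGroup M] [Module k M]

/-- **Theorem 2.1.1: the complex `X̂_*(E, M)` computes `H_*(E, M)`.**
Let `E = A #_f H` be a crossed product and `M` an `E`-bimodule.  The maps
`θ̂_{rs} : M ⊗ H̄^s ⊗ Ā^r → M ⊗_{E^e} X_{rs}`, `θ̂(m ⊗ 𝐡 ⊗ 𝐚) = m ⊗ (1 ⊗ 𝐡 ⊗ 𝐚 ⊗ 1)`,
assemble into an isomorphism of chain complexes `X̂_*(E, M) ≅ M ⊗_{E^e} (X_*, d_*)`,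
where `(X_*, d_*)` is the resolution of Theorem 1.1.1; consequently the Hochschild
homology of `E` with coefficients in `M` is the homology of `X̂_*(E, M)`. -/
theorem hochschild_homology_via_Xhat
    (S : CrossedProduct k A H E) (Bi : Bimod k E M) (R : ResData k A H E S)
    (F : ∀ l r : ℕ, (Tpow k (Qbar k H) l ⊗[k] Tpow k (Qbar k A) r) →ₗ[k] Tpow k A (r + l - 1))
    (hF : IsF k S R F)
    (dc : ∀ l r s : ℕ, Cms k A H M r s →ₗ[k] Cms k A H M (r + l - 1) (s - l))
    (hdc : IsDhat k S Bi F dc)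
    -- the normalized Hochschild chain complex of `E` with coefficients in `M`
    (bd : ∀ n : ℕ, HCh k E M (n + 1) →ₗ[k] HCh k E M n)
    (hbd : IsHochschildD k Bi.l Bi.r bd)
    -- the maps `θ̂_{rs}` and the differentials induced on `M ⊗_{E^e} X_*`
    (th : ∀ r s : ℕ, Cms k A H M r s →ₗ[k] MQ k A H E M Bi r s)
    (hth : ∀ (r s : ℕ) (m : M) (hs : Fin s → H) (as : Fin r → A),
      th r s (cgen m hs as) =
        Submodule.Quotient.mk (m ⊗ₜ[k] xgen (1 : E) hs as (1 : E)))
    (Dq : ∀ l r s : ℕ, MQ k A H E M Bi r s →ₗ[k] MQ k A H E M Bi (r + l - 1) (s - l))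
    (hDq : ∀ (l r s : ℕ) (z : MX k A H E M r s),
      Dq l r s (Submodule.Quotient.mk z) =
        Submodule.Quotient.mk (LinearMap.lTensor M (R.dl l r s) z)) :
    -- `θ̂` is an isomorphism of complexes
    (∀ r s : ℕ, Function.Bijective (th r s)) ∧
    (∀ l r s : ℕ, l ≤ s → 0 < r + l →
      th (r + l - 1) (s - l) ∘ₗ dc l r s = Dq l r s ∘ₗ th r s) ∧
    -- consequently `H_*(E, M)` is the homology of `X̂_*(E, M)`
    (∀ n : ℕ, Nonempty (Hml k bd n ≃ₗ[k] Hml k (dhT dc) n)) := by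
  have hk := key Bi R F hF dc hdc
  have hm := fun r s => th_main Bi r s (th r s) (hth r s)
  refine ⟨fun r s => (hm r s).1, fun l r s hl hr => ?_, fun n => ?_⟩
  · apply c_ext
    intro m hs as
    rw [LinearMap.comp_apply, LinearMap.comp_apply, hk l r s hl hr, (hm _ _).2, hth, hDq,
      LinearMap.lTensor_tmul]
  · obtain ⟨P, p, hp⟩ := bar_main Bi bd hbd
    obtain ⟨q, hq⟩ := x_main R Bi dc hk
    exact comparison P R.xRes p q bd (dhT dc) hp hq n

end Statement6

end HopfCrossed
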